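/- Let f ∈ C²((0,∞)) solve the profile equation f'' + ((N−1)/r + r/2)f' + f/α + |f|^α f = 0 on (0,∞) and satisfy r^{2/α} f(r) → β^{1/α} as r→0. Let μ = lim_{r→∞} r^{2/α} f(r) (which exists and is finite), and set U(t,x) = t^{−1/α} f(|x|/√t) for t>0, x≠0, so that U is a self-similar solution of ∂_t v = Δv + |v|^α v. Then for every δ>0 and every u₀ ∈ L¹_loc(ℝ^N) that is essentially bounded on {|x|>δ} and satisfies u₀(x) = μ|x|^{−2/α} a.e. on {|x|<δ}, there exist T>0, a constant C, and a function u ∈ L^{α+1}_loc((0,T)×ℝ^N), continuous on (0,T)×(ℝ^N∖{0}), such that: (a) for every test function ζ ∈ C_c^∞ with compact support contained in (0,T)×ℝ^N, ∫₀^T∫_{ℝ^N} u(−∂_tζ−Δζ) dx dt = ∫₀^T∫_{ℝ^N} |u|^α u ζ dx dt; (b) u(t,·) → u₀ in L¹_loc(ℝ^N) as t→0; (c) |u(t,x) − U(t,x)| ≤ C(1+|x|^{−η}) for 0<t<T, x≠0; (d) for every 0<t<T, |x|^{2/α} u(t,x) → β^{1/α} as x→0, so that u(t) is singular at x=0. 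-/

import Mathlib

open MeasureTheory Filter

noncomputable section

/-- `N`-dimensional Euclidean space. -/
abbrev Euc (N : ℕ) := EuclideanSpace ℝ (Fin N)

/-- The Laplacian of a function on `ℝ^N`, as the sum of the second partial derivatives. -/
def lapl {N : ℕ} (f : Euc N → ℝ) (x : Euc N) : ℝ :=
  ∑ i : Fin N,
    fderiv ℝ (fderiv ℝ f) x (EuclideanSpace.single i (1 : ℝ)) (EuclideanSpace.single i (1 : ℝ))



/-- The heat kernel on `ℝ × ℝ^N`, extended by `0` to nonpositive times. -/
def hk {N : ℕ} (p : ℝ × Euc N) : ℝ :=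
  if 0 < p.1 then (4 * Real.pi * p.1) ^ (-((N : ℝ) / 2)) * Real.exp (-(1 / (4 * p.1)) * ‖p.2‖ ^ 2)
  else 0

lemma hk_pos_eq {N : ℕ} {t : ℝ} (ht : 0 < t) (x : Euc N) :
    hk (t, x) = (4 * Real.pi * t) ^ (-((N : ℝ) / 2)) * Real.exp (-(1 / (4 * t)) * ‖x‖ ^ 2) := by
  simp [hk, ht]

lemma hk_nonpos {N : ℕ} {t : ℝ} (ht : t ≤ 0) (x : Euc N) : hk (t, x) = 0 := by
  simp [hk, not_lt.2 ht]

lemma hk_nonneg {N : ℕ} (p : ℝ × Euc N) : 0 ≤ hk p := by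
  unfold hk
  split_ifs with h
  · positivity
  · exact le_rfl

lemma hk_symm {N : ℕ} (t : ℝ) (x : Euc N) : hk (t, -x) = hk (t, x) := by
  simp [hk]

lemma hk_measurable {N : ℕ} : Measurable (hk : ℝ × Euc N → ℝ) := by
  unfold hk
  refine Measurable.ite (measurableSet_lt measurable_const measurable_fst) ?_ measurable_const
  fun_prop

lemma gauss_integrable {N : ℕ} {b : ℝ} (hb : 0 < b) :
    Integrable (fun y : Euc N => Real.exp (-b * ‖y‖ ^ 2)) := by
  by_contra h
  have h1 := GaussianFourier.integral_rexp_neg_mul_sq_norm (V := Euc N) hb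
  rw [integral_undef h] at h1
  have : 0 < (Real.pi / b) ^ ((Module.finrank ℝ (Euc N) : ℝ) / 2) :=
    Real.rpow_pos_of_pos (div_pos Real.pi_pos hb) _
  linarith

lemma gauss_integral {N : ℕ} {b : ℝ} (hb : 0 < b) :
    ∫ y : Euc N, Real.exp (-b * ‖y‖ ^ 2) = (Real.pi / b) ^ ((N : ℝ) / 2) := by
  have h1 := GaussianFourier.integral_rexp_neg_mul_sq_norm (V := Euc N) hb
  simpa using h1

lemma gauss_square {N : ℕ} {a b : ℝ} (ha : 0 < a) (hb : 0 < b) (x y : Euc N) :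
    Real.exp (-a * ‖x - y‖ ^ 2) * Real.exp (-b * ‖y‖ ^ 2)
      = Real.exp (-(a * b / (a + b)) * ‖x‖ ^ 2)
        * Real.exp (-(a + b) * ‖y - (a / (a + b)) • x‖ ^ 2) := by
  rw [← Real.exp_add, ← Real.exp_add]
  congr 1
  rw [norm_sub_sq_real, norm_sub_sq_real, norm_smul, inner_smul_right, real_inner_comm y x,
    Real.norm_eq_abs, mul_pow, sq_abs]
  field_simp
  ring

lemma gauss_conv_integrable {N : ℕ} {a b : ℝ} (ha : 0 < a) (hb : 0 < b) (x : Euc N) :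
    Integrable (fun y : Euc N => Real.exp (-a * ‖x - y‖ ^ 2) * Real.exp (-b * ‖y‖ ^ 2)) := by
  simp_rw [gauss_square ha hb]
  exact ((gauss_integrable (add_pos ha hb)).comp_sub_right ((a / (a + b)) • x)).const_mul _

lemma gauss_conv {N : ℕ} {a b : ℝ} (ha : 0 < a) (hb : 0 < b) (x : Euc N) :
    ∫ y : Euc N, Real.exp (-a * ‖x - y‖ ^ 2) * Real.exp (-b * ‖y‖ ^ 2)
      = (Real.pi / (a + b)) ^ ((N : ℝ) / 2) * Real.exp (-(a * b / (a + b)) * ‖x‖ ^ 2) := by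
  simp_rw [gauss_square ha hb]
  rw [integral_const_mul, integral_sub_right_eq_self
    (fun y : Euc N => Real.exp (-(a + b) * ‖y‖ ^ 2)), gauss_integral (add_pos ha hb), mul_comm]

/-- Heat flow of a Gaussian. -/
lemma hk_gauss {N : ℕ} {t l : ℝ} (ht : 0 < t) (hl : 0 < l) (x : Euc N) :
    Integrable (fun y : Euc N => hk (t, x - y) * Real.exp (-l * ‖y‖ ^ 2)) ∧
    ∫ y : Euc N, hk (t, x - y) * Real.exp (-l * ‖y‖ ^ 2)
      = (1 + 4 * l * t) ^ (-((N : ℝ) / 2)) * Real.exp (-(l / (1 + 4 * l * t)) * ‖x‖ ^ 2) := by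
  have ha : 0 < 1 / (4 * t) := by positivity
  have hp := Real.pi_pos
  simp_rw [hk_pos_eq ht, mul_assoc ((4 * Real.pi * t) ^ (-((N : ℝ) / 2)))]
  refine ⟨(gauss_conv_integrable ha hl x).const_mul _, ?_⟩
  rw [integral_const_mul, gauss_conv ha hl, ← mul_assoc]
  congr 1
  · rw [Real.rpow_neg (by positivity), Real.rpow_neg (by positivity),
      ← Real.inv_rpow (by positivity), ← Real.inv_rpow (by positivity),
      ← Real.mul_rpow (by positivity) (by positivity)]
    congr 1
    field_simp
  · congr 2
    field_simp

lemma hk_integrable {N : ℕ} (t : ℝ) (x : Euc N) :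
    Integrable (fun y : Euc N => hk (t, x - y)) := by
  rcases le_or_gt t 0 with ht | ht
  · simp [hk_nonpos ht]
  · have ha : 0 < 1 / (4 * t) := by positivity
    simp_rw [hk_pos_eq ht]
    exact ((gauss_integrable ha).comp_sub_left x).const_mul _

lemma hk_mass {N : ℕ} {t : ℝ} (ht : 0 < t) (x : Euc N) :
    ∫ y : Euc N, hk (t, x - y) = 1 := by
  have ha : 0 < 1 / (4 * t) := by positivity
  have hp := Real.pi_pos
  simp_rw [hk_pos_eq ht]
  rw [integral_const_mul, integral_sub_left_eq_self
    (fun y : Euc N => Real.exp (-(1 / (4 * t)) * ‖y‖ ^ 2)), gauss_integral ha,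
    Real.rpow_neg (by positivity), ← Real.inv_rpow (by positivity),
      ← Real.mul_rpow (by positivity) (by positivity)]
  have : (4 * Real.pi * t)⁻¹ * (Real.pi / (1 / (4 * t))) = 1 := by field_simp
  rw [this, Real.one_rpow]

lemma hk_semigroup {N : ℕ} {a b : ℝ} (ha : 0 < a) (hb : 0 < b) (x y : Euc N) :
    ∫ z : Euc N, hk (a, x - z) * hk (b, z - y) = hk (a + b, x - y) := by
  have hp := Real.pi_pos
  rw [← integral_add_right_eq_self (fun z : Euc N => hk (a, x - z) * hk (b, z - y)) y]
  simp_rw [add_sub_cancel_right, hk_pos_eq hb, hk_pos_eq (add_pos ha hb),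
    mul_left_comm _ ((4 * Real.pi * b) ^ (-((N : ℝ) / 2)))]
  rw [integral_const_mul]
  have h := (hk_gauss ha (l := 1 / (4 * b)) (by positivity) (x - y)).2
  have e : ∀ z, x - (z + y) = x - y - z := fun z => by abel
  simp_rw [e]
  rw [h, ← mul_assoc, ← Real.mul_rpow (by positivity) (by positivity)]
  congr 1
  · congr 1
    field_simp
    ring
  · congr 2
    field_simp
    ring

lemma hk_semigroup_integrable {N : ℕ} {a b : ℝ} (ha : 0 < a) (hb : 0 < b) (x y : Euc N) :
    Integrable (fun z : Euc N => hk (a, x - z) * hk (b, z - y)) := by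
  by_contra h
  have h1 := hk_semigroup ha hb x y
  rw [integral_undef h, hk_pos_eq (add_pos ha hb)] at h1
  have : 0 < (4 * Real.pi * (a+b)) ^ (-((N : ℝ) / 2)) := by
    have := Real.pi_pos
    positivity
  have h2 := Real.exp_pos (-(1 / (4 * (a + b))) * ‖x - y‖ ^ 2)
  have := mul_pos this h2
  linarith



lemma lint_gamma {a r : ℝ} (ha : 0 < a) (hr : 0 < r) :
    ∫⁻ l in Set.Ioi (0 : ℝ), ENNReal.ofReal (l ^ (a - 1) * Real.exp (-(r * l)))
      = ENNReal.ofReal (r ^ (-a) * Real.Gamma a) := by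
  have h := Real.integral_rpow_mul_exp_neg_mul_Ioi ha hr
  have hg := Real.Gamma_pos_of_pos ha
  have hpos : 0 < (1 / r) ^ a * Real.Gamma a := by positivity
  have hi : IntegrableOn (fun l : ℝ => l ^ (a - 1) * Real.exp (-(r * l))) (Set.Ioi 0) := by
    by_contra hn
    rw [integral_undef hn] at h
    linarith
  rw [← ofReal_integral_eq_lintegral_ofReal hi, h, one_div, Real.inv_rpow hr.le,
    Real.rpow_neg hr.le]
  filter_upwards [ae_restrict_mem measurableSet_Ioi] with l hl
  have : (0 : ℝ) < l := hl
  positivity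

lemma lint_rpow_tail {a r : ℝ} (ha : a < -1) (hr : 0 < r) :
    ∫⁻ l in Set.Ioi r, ENNReal.ofReal (l ^ a)
      = ENNReal.ofReal (r ^ (a + 1) / (-(a + 1))) := by
  rw [← ofReal_integral_eq_lintegral_ofReal (integrableOn_Ioi_rpow_of_lt ha hr),
    integral_Ioi_rpow_of_lt ha hr]
  · congr 1
    have : a + 1 ≠ 0 := by linarith
    field_simp
  · filter_upwards [ae_restrict_mem measurableSet_Ioi] with l hl
    have : (0 : ℝ) < l := hr.trans hl
    simp only [Pi.zero_apply]
    positivity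

lemma subst_image {l : ℝ} (hl : 0 < l) :
    (fun t : ℝ => l / (1 + 4 * l * t)) '' Set.Ioi 0 = Set.Ioo 0 l := by
  ext r
  simp only [Set.mem_image, Set.mem_Ioi, Set.mem_Ioo]
  constructor
  · rintro ⟨t, ht, rfl⟩
    have h1 : 0 < 4 * l * t := by positivity
    refine ⟨by positivity, ?_⟩
    rw [div_lt_iff₀ (by positivity)]
    nlinarith
  · rintro ⟨h0, h1⟩
    refine ⟨(l - r) / (4 * l * r), div_pos (by linarith) (by positivity), ?_⟩
    field_simp
    ring

lemma lint_subst {l : ℝ} (hl : 0 < l) (k A : ℝ) :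
    ∫⁻ t in Set.Ioi (0 : ℝ), ENNReal.ofReal ((1 + 4 * l * t) ^ (-k)
        * Real.exp (-(l / (1 + 4 * l * t)) * A))
      = ∫⁻ r in Set.Ioo 0 l, ENNReal.ofReal (l ^ (-k) * (r ^ (k - 2) / 4 * Real.exp (-r * A))) := by
  rw [← subst_image hl, lintegral_image_eq_lintegral_abs_deriv_mul measurableSet_Ioi
    (f' := fun t => -(4 * l ^ 2) / (1 + 4 * l * t) ^ 2)]
  · refine setLIntegral_congr_fun measurableSet_Ioi ?_
    intro t ht
    have ht0 : (0 : ℝ) < t := ht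
    have h1 : 0 < 1 + 4 * l * t := by positivity
    simp only
    rw [← ENNReal.ofReal_mul (abs_nonneg _)]
    congr 1
    rw [neg_div, abs_neg, abs_of_pos (by positivity), Real.div_rpow hl.le h1.le,
      Real.rpow_sub hl, Real.rpow_sub h1, Real.rpow_neg hl.le, Real.rpow_neg h1.le]
    have h3 : 0 < l ^ k := by positivity
    have h4 : 0 < (1 + 4 * l * t) ^ k := by positivity
    norm_cast
    field_simp
  · intro t ht
    have ht0 : (0 : ℝ) < t := ht
    have h1 : 0 < 1 + 4 * l * t := by positivity
    have h2 : HasDerivAt (fun t : ℝ => 1 + 4 * l * t) (4 * l) t := by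
      simpa using ((hasDerivAt_id t).const_mul (4 * l)).const_add 1
    have h3 := (hasDerivAt_const t l).fun_div h2 h1.ne'
    refine (h3.congr_deriv ?_).hasDerivWithinAt
    ring
  · intro t ht s hs h
    have ht0 : (0 : ℝ) < t := ht
    have hs0 : (0 : ℝ) < s := hs
    simp only at h
    have h1 : 0 < 1 + 4 * l * t := by positivity
    have h2 : 0 < 1 + 4 * l * s := by positivity
    field_simp at h
    have h5 : (l * 4) * s = (l * 4) * t := by linarith
    exact (mul_left_cancel₀ (by positivity) h5).symm

lemma lint_radial {k a A : ℝ} (ha : 1 < a) (hk : a < k) (hA : 0 < A) :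
    ∫⁻ l in Set.Ioi (0 : ℝ), ∫⁻ t in Set.Ioi (0 : ℝ), ENNReal.ofReal (l ^ (a - 1)
      * ((1 + 4 * l * t) ^ (-k) * Real.exp (-(l / (1 + 4 * l * t)) * A)))
      = ENNReal.ofReal (A ^ (-(a - 1)) * Real.Gamma (a - 1) / (4 * (k - a))) := by
  have e1 : ∀ l ∈ Set.Ioi (0 : ℝ), (∫⁻ t in Set.Ioi (0 : ℝ), ENNReal.ofReal (l ^ (a - 1)
      * ((1 + 4 * l * t) ^ (-k) * Real.exp (-(l / (1 + 4 * l * t)) * A))))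
      = ∫⁻ r in Set.Ioi (0 : ℝ), (if r < l then ENNReal.ofReal (l ^ (a - 1 - k)
        * (r ^ (k - 2) / 4 * Real.exp (-r * A))) else 0) := by
    intro l hl
    have hl0 : (0 : ℝ) < l := hl
    have h1 : 0 ≤ l ^ (a - 1) := by positivity
    simp_rw [ENNReal.ofReal_mul h1]
    rw [lintegral_const_mul' _ _ ENNReal.ofReal_ne_top, lint_subst hl0,
      ← lintegral_const_mul' _ _ ENNReal.ofReal_ne_top]
    have : ∀ r : ℝ, (if r < l then ENNReal.ofReal (l ^ (a - 1 - k)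
        * (r ^ (k - 2) / 4 * Real.exp (-r * A))) else 0) = (Set.Iio l).indicator
        (fun r => ENNReal.ofReal (l ^ (a - 1 - k)
        * (r ^ (k - 2) / 4 * Real.exp (-r * A)))) r := by
      intro r
      simp [Set.indicator_apply]
    simp_rw [this]
    rw [lintegral_indicator measurableSet_Iio, Measure.restrict_restrict measurableSet_Iio]
    have : Set.Iio l ∩ Set.Ioi 0 = Set.Ioo 0 l := by
      ext; simp [and_comm]
    rw [this]
    refine setLIntegral_congr_fun measurableSet_Ioo ?_
    intro r hr
    simp only
    rw [← ENNReal.ofReal_mul h1, ← mul_assoc, ← Real.rpow_add hl0]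
    rfl
  rw [setLIntegral_congr_fun measurableSet_Ioi e1, lintegral_lintegral_swap]
  · have e2 : ∀ r ∈ Set.Ioi (0 : ℝ), (∫⁻ l in Set.Ioi (0 : ℝ), (if r < l then
        ENNReal.ofReal (l ^ (a - 1 - k) * (r ^ (k - 2) / 4 * Real.exp (-r * A))) else 0))
        = ENNReal.ofReal (1 / (4 * (k - a))) *
          ENNReal.ofReal (r ^ (a - 1 - 1) * Real.exp (-(A * r))) := by
      intro r hr
      have hr0 : (0 : ℝ) < r := hr
      have : ∀ l : ℝ, (if r < l then ENNReal.ofReal (l ^ (a - 1 - k)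
        * (r ^ (k - 2) / 4 * Real.exp (-r * A))) else 0) = (Set.Ioi r).indicator
        (fun l => ENNReal.ofReal (l ^ (a - 1 - k)
        * (r ^ (k - 2) / 4 * Real.exp (-r * A)))) l := by
        intro l
        simp [Set.indicator_apply]
      simp_rw [this]
      rw [lintegral_indicator measurableSet_Ioi, Measure.restrict_restrict measurableSet_Ioi]
      have : Set.Ioi r ∩ Set.Ioi 0 = Set.Ioi r := by
        rw [Set.Ioi_inter_Ioi, max_eq_left hr0.le]
      rw [this]
      have h1 : 0 ≤ r ^ (k - 2) / 4 * Real.exp (-r * A) := by positivity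
      simp_rw [ENNReal.ofReal_mul' h1]
      rw [lintegral_mul_const' _ _ ENNReal.ofReal_ne_top, lint_rpow_tail (by linarith) hr0,
        ← ENNReal.ofReal_mul, ← ENNReal.ofReal_mul]
      · congr 1
        have h2 : r ^ (a - 1 - 1) = r ^ (a - 1 - k + 1) * r ^ (k - 2) := by
          rw [← Real.rpow_add hr0]
          congr 1
          ring
        rw [h2]
        have h3 : k - a ≠ 0 := by linarith
        have h4 : -(a - 1 - k + 1) = k - a := by ring
        rw [h4]
        field_simp
      · have : 0 < k - a := by linarith
        positivity
      · exact div_nonneg (by positivity) (by linarith)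
    rw [setLIntegral_congr_fun measurableSet_Ioi e2, lintegral_const_mul' _ _ ENNReal.ofReal_ne_top,
      lint_gamma (by linarith) hA, ← ENNReal.ofReal_mul]
    · congr 1
      ring
    · have : 0 < k - a := by linarith
      positivity
  · refine (Measurable.ite (measurableSet_lt measurable_snd measurable_fst) ?_
      measurable_const).aemeasurable
    fun_prop

lemma lint_hk_gauss {N : ℕ} {t l : ℝ} (ht : 0 < t) (hl : 0 < l) (x : Euc N) :
    ∫⁻ y : Euc N, ENNReal.ofReal (hk (t, x - y) * Real.exp (-l * ‖y‖ ^ 2))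
      = ENNReal.ofReal ((1 + 4 * l * t) ^ (-((N : ℝ) / 2))
        * Real.exp (-(l / (1 + 4 * l * t)) * ‖x‖ ^ 2)) := by
  obtain ⟨h1, h2⟩ := hk_gauss ht hl x
  rw [← ofReal_integral_eq_lintegral_ofReal h1, h2]
  exact Eventually.of_forall fun y => mul_nonneg (hk_nonneg _) (Real.exp_nonneg _)

lemma lint_hk_rpow {N : ℕ} {s : ℝ} (hs0 : 0 < s) (hs : s < (N : ℝ) - 2) {x : Euc N} (hx : x ≠ 0) :
    ∫⁻ t in Set.Ioi (0 : ℝ), ∫⁻ y : Euc N, ENNReal.ofReal (hk (t, x - y) * ‖y‖ ^ (-(s + 2)))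
      = ENNReal.ofReal (‖x‖ ^ (-s) / (s * ((N : ℝ) - 2 - s))) := by
  have hN : Nontrivial (Euc N) := ⟨x, 0, hx⟩
  set a : ℝ := s / 2 + 1 with ha
  have ha1 : 1 < a := by linarith
  have hga : 0 < Real.Gamma a := Real.Gamma_pos_of_pos (by linarith)
  have hrep : ∀ y : Euc N, y ≠ 0 → ENNReal.ofReal (‖y‖ ^ (-(s + 2)))
      = ENNReal.ofReal ((Real.Gamma a)⁻¹) * ∫⁻ l in Set.Ioi (0 : ℝ),
        ENNReal.ofReal (l ^ (a - 1) * Real.exp (-l * ‖y‖ ^ 2)) := by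
    intro y hy
    have hy0 : 0 < ‖y‖ := norm_pos_iff.2 hy
    have h := lint_gamma (a := a) (r := ‖y‖ ^ 2) (by linarith) (by positivity)
    have e : ∀ l : ℝ, -(‖y‖ ^ 2 * l) = -l * ‖y‖ ^ 2 := fun l => by ring
    simp_rw [e] at h
    rw [h, ← ENNReal.ofReal_mul (by positivity)]
    congr 1
    rw [← Real.rpow_natCast, ← Real.rpow_mul hy0.le]
    have : ((2 : ℕ) : ℝ) * -a = -(s + 2) := by rw [ha]; push_cast; ring
    rw [this]
    field_simp
  have e1 : ∀ t ∈ Set.Ioi (0 : ℝ), (∫⁻ y : Euc N,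
      ENNReal.ofReal (hk (t, x - y) * ‖y‖ ^ (-(s + 2))))
      = ENNReal.ofReal ((Real.Gamma a)⁻¹) * ∫⁻ l in Set.Ioi (0 : ℝ), ENNReal.ofReal (l ^ (a - 1)
      * ((1 + 4 * l * t) ^ (-((N : ℝ) / 2)) * Real.exp (-(l / (1 + 4 * l * t)) * ‖x‖ ^ 2))) := by
    intro t ht
    have h1 : ∀ᵐ y : Euc N, ENNReal.ofReal (hk (t, x - y) * ‖y‖ ^ (-(s + 2)))
        = ENNReal.ofReal ((Real.Gamma a)⁻¹) * ∫⁻ l in Set.Ioi (0 : ℝ),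
          ENNReal.ofReal (l ^ (a - 1) * (hk (t, x - y) * Real.exp (-l * ‖y‖ ^ 2))) := by
      have h0 : ∀ᵐ y : Euc N, y ≠ 0 := by
        simp [ae_iff]
      filter_upwards [h0] with y hy
      rw [ENNReal.ofReal_mul (hk_nonneg _), hrep y hy, mul_left_comm,
        ← lintegral_const_mul' _ _ ENNReal.ofReal_ne_top]
      congr 2
      ext l
      rw [← ENNReal.ofReal_mul (hk_nonneg _)]
      congr 1
      ring
    rw [lintegral_congr_ae h1, lintegral_const_mul' _ _ ENNReal.ofReal_ne_top,
      lintegral_lintegral_swap]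
    · congr 1
      refine setLIntegral_congr_fun measurableSet_Ioi ?_
      intro l hl
      have hl0 : (0 : ℝ) < l := hl
      have h2 : 0 ≤ l ^ (a - 1) := by positivity
      simp only
      simp_rw [ENNReal.ofReal_mul h2]
      rw [lintegral_const_mul' _ _ ENNReal.ofReal_ne_top, lint_hk_gauss ht hl0]
    · refine Measurable.aemeasurable ?_
      simp only [Function.uncurry_def]
      have := hk_measurable (N := N)
      fun_prop
  rw [setLIntegral_congr_fun measurableSet_Ioi e1, lintegral_const_mul' _ _ ENNReal.ofReal_ne_top,
    lintegral_lintegral_swap, lint_radial ha1 (by rw [ha]; linarith)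
      (by have := norm_pos_iff.2 hx; positivity), ← ENNReal.ofReal_mul (by positivity)]
  · congr 1
    have hx0 : 0 < ‖x‖ := norm_pos_iff.2 hx
    rw [← Real.rpow_natCast, ← Real.rpow_mul hx0.le]
    have : ((2 : ℕ) : ℝ) * -(a - 1) = -s := by rw [ha]; push_cast; ring
    rw [this]
    have h5 : Real.Gamma a = (a - 1) * Real.Gamma (a - 1) := by
      have := Real.Gamma_add_one (s := a - 1) (by linarith)
      simpa using this
    have h6 : 0 < Real.Gamma (a - 1) := Real.Gamma_pos_of_pos (by linarith)
    rw [h5]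
    have h7 : a - 1 = s / 2 := by rw [ha]; ring
    have h8 : (4 * ((N : ℝ) / 2 - a)) = 2 * ((N : ℝ) - 2 - s) := by rw [ha]; ring
    rw [h7] at h6 ⊢
    rw [h8]
    have h9 : 0 < (N : ℝ) - 2 - s := by linarith
    field_simp
  · refine Measurable.aemeasurable ?_
    simp only [Function.uncurry_def]
    fun_prop

/-- The Newtonian potential of a power, written with the heat kernel. -/
lemma hk_rpow {N : ℕ} {s : ℝ} (hs0 : 0 < s) (hs : s < (N : ℝ) - 2) {x : Euc N} (hx : x ≠ 0) :
    Integrable (fun p : ℝ × Euc N => hk (p.1, x - p.2) * ‖p.2‖ ^ (-(s + 2))) ∧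
    ∫ p : ℝ × Euc N, hk (p.1, x - p.2) * ‖p.2‖ ^ (-(s + 2))
      = ‖x‖ ^ (-s) / (s * ((N : ℝ) - 2 - s)) := by
  have hm : Measurable (fun p : ℝ × Euc N => hk (p.1, x - p.2) * ‖p.2‖ ^ (-(s + 2))) := by
    have := hk_measurable (N := N)
    fun_prop
  have hnn : ∀ p : ℝ × Euc N, 0 ≤ hk (p.1, x - p.2) * ‖p.2‖ ^ (-(s + 2)) :=
    fun p => mul_nonneg (hk_nonneg _) (by positivity)
  have h9 : 0 < (N : ℝ) - 2 - s := by linarith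
  have key : ∫⁻ p : ℝ × Euc N, ENNReal.ofReal (hk (p.1, x - p.2) * ‖p.2‖ ^ (-(s + 2)))
      = ENNReal.ofReal (‖x‖ ^ (-s) / (s * ((N : ℝ) - 2 - s))) := by
    rw [← lint_hk_rpow hs0 hs hx, Measure.volume_eq_prod,
      lintegral_prod _ (hm.ennreal_ofReal.aemeasurable), ← lintegral_indicator measurableSet_Ioi]
    congr 1
    ext t
    by_cases ht : t ∈ Set.Ioi (0 : ℝ)
    · rw [Set.indicator_of_mem ht]
    · rw [Set.indicator_of_notMem ht]
      simp [hk_nonpos (not_lt.1 ht)]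
  have hi : Integrable (fun p : ℝ × Euc N => hk (p.1, x - p.2) * ‖p.2‖ ^ (-(s + 2))) := by
    rw [← lintegral_ofReal_ne_top_iff_integrable hm.aestronglyMeasurable
      (Eventually.of_forall hnn), key]
    exact ENNReal.ofReal_ne_top
  refine ⟨hi, ?_⟩
  rw [integral_eq_lintegral_of_nonneg_ae (Eventually.of_forall hnn) hm.aestronglyMeasurable, key,
    ENNReal.toReal_ofReal (by positivity)]



/-- The half space of positive times. -/
abbrev PosT (N : ℕ) : Set (ℝ × Euc N) := Set.Ioi (0 : ℝ) ×ˢ (Set.univ : Set (Euc N))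

/-- The Duhamel operator. -/
def Dop {N : ℕ} (g : ℝ × Euc N → ℝ) (q : ℝ × Euc N) : ℝ :=
  ∫ p in PosT N, hk (q - p) * g p

/-- The heat evolution of an initial value. -/
def Hop {N : ℕ} (φ : Euc N → ℝ) (q : ℝ × Euc N) : ℝ :=
  ∫ y : Euc N, hk (q.1, q.2 - y) * φ y

lemma measurableSet_PosT {N : ℕ} : MeasurableSet (PosT N) :=
  measurableSet_Ioi.prod MeasurableSet.univ

lemma flip_mp {N : ℕ} (t : ℝ) :
    MeasurePreserving (fun p : ℝ × Euc N => (t - p.1, p.2)) := by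
  exact (Measure.measurePreserving_sub_left volume t).prod (MeasurePreserving.id volume)

lemma flip_me {N : ℕ} (t : ℝ) :
    MeasurableEmbedding (fun p : ℝ × Euc N => (t - p.1, p.2)) := by
  have : Function.LeftInverse (fun p : ℝ × Euc N => (t - p.1, p.2))
      (fun p : ℝ × Euc N => (t - p.1, p.2)) := by
    intro p; simp
  have hm : Measurable (fun p : ℝ × Euc N => (t - p.1, p.2)) := by fun_prop
  exact MeasurableEquiv.measurableEmbedding ⟨⟨_, _, this, this⟩, hm, hm⟩

lemma Dop_pow {N : ℕ} {s : ℝ} (hs0 : 0 < s) (hs : s < (N : ℝ) - 2) (m : ℕ) {t : ℝ} (ht : 0 < t)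
    {x : Euc N} (hx : x ≠ 0) :
    IntegrableOn (fun p : ℝ × Euc N => hk ((t, x) - p) * (p.1 ^ m * ‖p.2‖ ^ (-(s + 2)))) (PosT N) ∧
    Dop (fun p : ℝ × Euc N => p.1 ^ m * ‖p.2‖ ^ (-(s + 2))) (t, x)
      ≤ t ^ m * (‖x‖ ^ (-s) / (s * ((N : ℝ) - 2 - s))) := by
  obtain ⟨h1, h2⟩ := hk_rpow hs0 hs hx
  have h3 : Integrable (fun p : ℝ × Euc N => hk ((t, x) - p) * ‖p.2‖ ^ (-(s + 2))) :=
    (flip_mp t).integrable_comp_of_integrable h1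
  have h4 : ∫ p : ℝ × Euc N, hk ((t, x) - p) * ‖p.2‖ ^ (-(s + 2))
      = ‖x‖ ^ (-s) / (s * ((N : ℝ) - 2 - s)) := by
    rw [← h2]
    exact (flip_mp t).integral_comp (flip_me t)
      (fun p : ℝ × Euc N => hk (p.1, x - p.2) * ‖p.2‖ ^ (-(s + 2)))
  have hm : Measurable (fun p : ℝ × Euc N =>
      hk ((t, x) - p) * (p.1 ^ m * ‖p.2‖ ^ (-(s + 2)))) := by
    have := hk_measurable (N := N)
    fun_prop
  have hle : ∀ p ∈ PosT N, hk ((t, x) - p) * (p.1 ^ m * ‖p.2‖ ^ (-(s + 2)))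
      ≤ t ^ m * (hk ((t, x) - p) * ‖p.2‖ ^ (-(s + 2))) := by
    rintro ⟨r, y⟩ ⟨hr, -⟩
    have hr0 : (0 : ℝ) < r := hr
    rcases le_or_gt t r with h | h
    · have : hk ((t, x) - (r, y)) = 0 := hk_nonpos (by simpa using h) _
      rw [this]
      simp
    · have h5 : r ^ m ≤ t ^ m := pow_le_pow_left₀ hr0.le h.le m
      have h6 : 0 ≤ hk ((t, x) - (r, y)) * ‖y‖ ^ (-(s + 2)) :=
        mul_nonneg (hk_nonneg _) (by positivity)
      calc _ = r ^ m * (hk ((t, x) - (r, y)) * ‖y‖ ^ (-(s + 2))) := by ring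
        _ ≤ _ := mul_le_mul_of_nonneg_right h5 h6
  have hi : IntegrableOn (fun p : ℝ × Euc N =>
      hk ((t, x) - p) * (p.1 ^ m * ‖p.2‖ ^ (-(s + 2)))) (PosT N) := by
    refine Integrable.mono' (h3.const_mul (t ^ m)).integrableOn hm.aestronglyMeasurable ?_
    filter_upwards [ae_restrict_mem measurableSet_PosT] with p hp
    rw [Real.norm_of_nonneg]
    · exact hle p hp
    · have : (0 : ℝ) < p.1 := hp.1
      exact mul_nonneg (hk_nonneg _) (by positivity)
  refine ⟨hi, ?_⟩
  have h5 : Dop (fun p : ℝ × Euc N => p.1 ^ m * ‖p.2‖ ^ (-(s + 2))) (t, x)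
      ≤ ∫ p in PosT N, t ^ m * (hk ((t, x) - p) * ‖p.2‖ ^ (-(s + 2))) :=
    setIntegral_mono_on hi (h3.const_mul (t ^ m)).integrableOn measurableSet_PosT hle
  refine h5.trans ?_
  rw [← h4, ← integral_const_mul]
  refine setIntegral_le_integral (h3.const_mul (t ^ m)) (Eventually.of_forall fun p => ?_)
  have := hk_nonneg ((t, x) - p)
  simp only [Pi.zero_apply]
  positivity

lemma Dop_slice {N : ℕ} {g : ℝ × Euc N → ℝ} (hgm : Measurable g)
    (hg0 : ∀ p ∈ PosT N, 0 ≤ g p) {t : ℝ} {x : Euc N} {b : ℝ → ℝ}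
    (hb : IntegrableOn b (Set.Ioo 0 t)) (hb0 : ∀ s ∈ Set.Ioo 0 t, 0 ≤ b s)
    (h : ∀ s ∈ Set.Ioo 0 t, ∫⁻ y, ENNReal.ofReal (hk (t - s, x - y) * g (s, y))
      ≤ ENNReal.ofReal (b s)) :
    IntegrableOn (fun p : ℝ × Euc N => hk ((t, x) - p) * g p) (PosT N) ∧
    Dop g (t, x) ≤ ∫ s in Set.Ioo 0 t, b s := by
  have hm : Measurable (fun p : ℝ × Euc N => hk ((t, x) - p) * g p) := by
    have := hk_measurable (N := N)
    fun_prop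
  have hb0' : 0 ≤ᵐ[volume.restrict (Set.Ioo 0 t)] b := by
    filter_upwards [ae_restrict_mem measurableSet_Ioo] with s hs using hb0 s hs
  have hnn : 0 ≤ᵐ[volume.restrict (PosT N)] (fun p : ℝ × Euc N => hk ((t, x) - p) * g p) := by
    filter_upwards [ae_restrict_mem measurableSet_PosT] with p hp
    exact mul_nonneg (hk_nonneg _) (hg0 p hp)
  have key : ∫⁻ p in PosT N, ENNReal.ofReal (hk ((t, x) - p) * g p)
      ≤ ENNReal.ofReal (∫ s in Set.Ioo 0 t, b s) := by
    rw [ofReal_integral_eq_lintegral_ofReal hb hb0', Measure.volume_eq_prod,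
      ← Measure.prod_restrict, Measure.restrict_univ,
      lintegral_prod _ (hm.ennreal_ofReal.aemeasurable), ← lintegral_indicator measurableSet_Ioi,
      ← lintegral_indicator measurableSet_Ioo]
    refine lintegral_mono fun s => ?_
    by_cases h1 : s ∈ Set.Ioo 0 t
    · rw [Set.indicator_of_mem h1, Set.indicator_of_mem (show s ∈ Set.Ioi (0 : ℝ) from h1.1)]
      exact h s h1
    · rw [Set.indicator_of_notMem h1]
      by_cases h2 : s ∈ Set.Ioi (0 : ℝ)
      · rw [Set.indicator_of_mem h2]
        have h3 : t - s ≤ 0 := by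
          by_contra h4
          exact h1 ⟨h2, by linarith⟩
        simp [hk_nonpos h3]
      · rw [Set.indicator_of_notMem h2]
  have hi : IntegrableOn (fun p : ℝ × Euc N => hk ((t, x) - p) * g p) (PosT N) := by
    rw [IntegrableOn, ← lintegral_ofReal_ne_top_iff_integrable hm.aestronglyMeasurable hnn]
    exact ne_top_of_le_ne_top ENNReal.ofReal_ne_top key
  refine ⟨hi, ?_⟩
  unfold Dop
  rw [integral_eq_lintegral_of_nonneg_ae hnn hm.aestronglyMeasurable]
  refine ENNReal.toReal_le_of_le_ofReal (integral_nonneg_of_ae hb0') key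

lemma lint_hk_semigroup {N : ℕ} {a b : ℝ} (ha : 0 < a) (hb : 0 < b) (x z : Euc N) :
    ∫⁻ y : Euc N, ENNReal.ofReal (hk (a, x - y) * hk (b, y - z))
      = ENNReal.ofReal (hk (a + b, x - z)) := by
  rw [← hk_semigroup ha hb, ← ofReal_integral_eq_lintegral_ofReal
    (hk_semigroup_integrable ha hb x z)]
  exact Eventually.of_forall fun y => mul_nonneg (hk_nonneg _) (hk_nonneg _)

/-- Powers `|x|^{-s}`, `0 < s < N - 2`, are supersolutions of the heat equation. -/
lemma lint_hk_super {N : ℕ} {s : ℝ} (hs0 : 0 < s) (hs : s < (N : ℝ) - 2) {τ : ℝ} (hτ : 0 < τ)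
    {x : Euc N} (hx : x ≠ 0) :
    ∫⁻ y : Euc N, ENNReal.ofReal (hk (τ, x - y) * ‖y‖ ^ (-s))
      ≤ ENNReal.ofReal (‖x‖ ^ (-s)) := by
  have hN : Nontrivial (Euc N) := ⟨x, 0, hx⟩
  have h9 : 0 < (N : ℝ) - 2 - s := by linarith
  set C : ℝ := s * ((N : ℝ) - 2 - s) with hC
  have hC0 : 0 < C := by positivity
  have hrep : ∀ y : Euc N, y ≠ 0 → ENNReal.ofReal (‖y‖ ^ (-s)) = ENNReal.ofReal C *
      ∫⁻ t in Set.Ioi (0 : ℝ), ∫⁻ z : Euc N, ENNReal.ofReal (hk (t, y - z) * ‖z‖ ^ (-(s + 2))) := by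
    intro y hy
    rw [lint_hk_rpow hs0 hs hy, ← ENNReal.ofReal_mul hC0.le]
    congr 1
    rw [← hC]
    field_simp
  have h0 : ∀ᵐ y : Euc N, y ≠ 0 := by simp [ae_iff]
  have hkm := hk_measurable (N := N)
  have e1 : ∫⁻ y : Euc N, ENNReal.ofReal (hk (τ, x - y) * ‖y‖ ^ (-s))
      = ENNReal.ofReal C * ∫⁻ y : Euc N, ∫⁻ t in Set.Ioi (0 : ℝ), ∫⁻ z : Euc N,
        ENNReal.ofReal (hk (τ, x - y) * hk (t, y - z) * ‖z‖ ^ (-(s + 2))) := by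
    rw [← lintegral_const_mul' _ _ ENNReal.ofReal_ne_top]
    refine lintegral_congr_ae ?_
    filter_upwards [h0] with y hy
    rw [ENNReal.ofReal_mul (hk_nonneg _), hrep y hy, mul_left_comm]
    congr 1
    rw [← lintegral_const_mul' _ _ ENNReal.ofReal_ne_top]
    congr 1
    ext t
    rw [← lintegral_const_mul' _ _ ENNReal.ofReal_ne_top]
    congr 1
    ext z
    rw [← ENNReal.ofReal_mul (hk_nonneg _), mul_assoc]
  rw [e1, lintegral_lintegral_swap]
  swap
  · refine Measurable.aemeasurable ?_
    simp only [Function.uncurry_def]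
    refine Measurable.lintegral_prod_right' (f := fun p : (Euc N × ℝ) × Euc N =>
      ENNReal.ofReal (hk (τ, x - p.1.1) * hk (p.1.2, p.1.1 - p.2) * ‖p.2‖ ^ (-(s + 2)))) ?_
    fun_prop
  have e2 : ∀ t ∈ Set.Ioi (0 : ℝ), (∫⁻ y : Euc N, ∫⁻ z : Euc N,
        ENNReal.ofReal (hk (τ, x - y) * hk (t, y - z) * ‖z‖ ^ (-(s + 2))))
      = ∫⁻ z : Euc N, ENNReal.ofReal (hk (τ + t, x - z) * ‖z‖ ^ (-(s + 2))) := by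
    intro t ht
    rw [lintegral_lintegral_swap]
    · congr 1
      ext z
      have h1 : 0 ≤ ‖z‖ ^ (-(s + 2)) := by positivity
      simp_rw [ENNReal.ofReal_mul' h1]
      rw [lintegral_mul_const' _ _ ENNReal.ofReal_ne_top, lint_hk_semigroup hτ ht]
    · refine Measurable.aemeasurable ?_
      simp only [Function.uncurry_def]
      fun_prop
  rw [setLIntegral_congr_fun measurableSet_Ioi e2, hrep x hx]
  refine mul_le_mul_right ?_ _
  set Q : ℝ → ENNReal := fun t => ∫⁻ z : Euc N, ENNReal.ofReal (hk (t, x - z) * ‖z‖ ^ (-(s + 2)))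
  calc ∫⁻ t in Set.Ioi (0 : ℝ), Q (τ + t)
      = ∫⁻ t, (Set.Ioi (0 : ℝ)).indicator (fun t => Q (τ + t)) t :=
        (lintegral_indicator measurableSet_Ioi _).symm
    _ ≤ ∫⁻ t, (Set.Ioi (0 : ℝ)).indicator Q (τ + t) := by
        refine lintegral_mono fun t => ?_
        by_cases h : t ∈ Set.Ioi (0 : ℝ)
        · have h' : τ + t ∈ Set.Ioi (0 : ℝ) := add_pos hτ h
          rw [Set.indicator_of_mem h, Set.indicator_of_mem h']
        · rw [Set.indicator_of_notMem h]
          exact zero_le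
    _ = ∫⁻ t, (Set.Ioi (0 : ℝ)).indicator Q t := lintegral_add_left_eq_self _ _
    _ = _ := lintegral_indicator measurableSet_Ioi _

lemma Dop_pow2 {N : ℕ} {s : ℝ} (hs0 : 0 < s) (hs : s < (N : ℝ) - 2) (k : ℕ) {t : ℝ} (ht : 0 < t)
    {x : Euc N} (hx : x ≠ 0) :
    IntegrableOn (fun p : ℝ × Euc N => hk ((t, x) - p) * (p.1 ^ k * ‖p.2‖ ^ (-s))) (PosT N) ∧
    Dop (fun p : ℝ × Euc N => p.1 ^ k * ‖p.2‖ ^ (-s)) (t, x)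
      ≤ t ^ (k + 1) / (k + 1) * ‖x‖ ^ (-s) := by
  have h := Dop_slice (g := fun p : ℝ × Euc N => p.1 ^ k * ‖p.2‖ ^ (-s)) (by fun_prop)
    (fun p hp => by have : (0 : ℝ) < p.1 := hp.1
                    positivity) (t := t) (x := x) (b := fun r => r ^ k * ‖x‖ ^ (-s))
    ((by fun_prop : Continuous fun r : ℝ => r ^ k * ‖x‖ ^ (-s)).integrableOn_Icc.mono_set
      Set.Ioo_subset_Icc_self)
    (fun r hr => by have := hr.1
                    positivity) ?_
  · refine ⟨h.1, h.2.trans ?_⟩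
    rw [integral_mul_const, ← integral_Ioc_eq_integral_Ioo,
      ← intervalIntegral.integral_of_le ht.le, integral_pow]
    simp
  · intro r hr
    have h1 : 0 ≤ r ^ k := pow_nonneg hr.1.le k
    simp_rw [mul_left_comm _ (r ^ k), ENNReal.ofReal_mul h1]
    rw [lintegral_const_mul' _ _ ENNReal.ofReal_ne_top]
    gcongr
    exact lint_hk_super hs0 hs (by linarith [hr.2]) hx



lemma Hop_measurable {N : ℕ} {φ : Euc N → ℝ} (hφ : Measurable φ) : Measurable (Hop φ) := by
  unfold Hop
  have hkm := hk_measurable (N := N)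
  have : StronglyMeasurable (fun p : (ℝ × Euc N) × Euc N => hk (p.1.1, p.1.2 - p.2) * φ p.2) := by
    refine Measurable.stronglyMeasurable ?_
    fun_prop
  exact this.integral_prod_right'.measurable

lemma Hop_integrable {N : ℕ} {φ : Euc N → ℝ} (hφ : Measurable φ) {M : ℝ} (hM : ∀ y, |φ y| ≤ M)
    (q : ℝ × Euc N) : Integrable (fun y => hk (q.1, q.2 - y) * φ y) := by
  refine (hk_integrable q.1 q.2).mul_bdd (c := M) hφ.aestronglyMeasurable ?_
  exact Eventually.of_forall hM

lemma Hop_abs_le {N : ℕ} (φ : Euc N → ℝ) (q : ℝ × Euc N) :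
    |Hop φ q| ≤ Hop (fun y => |φ y|) q := by
  unfold Hop
  refine (abs_integral_le_integral_abs).trans (le_of_eq ?_)
  congr 1
  ext y
  rw [abs_mul, abs_of_nonneg (hk_nonneg _)]

lemma Hop_nonneg {N : ℕ} {φ : Euc N → ℝ} (h0 : ∀ y, 0 ≤ φ y) (q : ℝ × Euc N) : 0 ≤ Hop φ q :=
  integral_nonneg fun y => mul_nonneg (hk_nonneg _) (h0 y)

lemma Hop_le {N : ℕ} {φ : Euc N → ℝ} (hφ : Measurable φ) {M : ℝ} (hM : ∀ y, |φ y| ≤ M)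
    {t : ℝ} (ht : 0 < t) (x : Euc N) : Hop φ (t, x) ≤ M := by
  have h : Hop φ (t, x) ≤ ∫ y, hk (t, x - y) * M := by
    refine integral_mono (Hop_integrable hφ hM (t, x)) ((hk_integrable t x).mul_const M) ?_
    intro y
    exact mul_le_mul_of_nonneg_left ((le_abs_self _).trans (hM y)) (hk_nonneg _)
  rwa [integral_mul_const, hk_mass ht, one_mul] at h

lemma lint_Hop {N : ℕ} {φ : Euc N → ℝ} (hφ : Measurable φ) {M : ℝ} (hM : ∀ y, |φ y| ≤ M)
    (h0 : ∀ y, 0 ≤ φ y) (q : ℝ × Euc N) :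
    ENNReal.ofReal (Hop φ q) = ∫⁻ y, ENNReal.ofReal (hk (q.1, q.2 - y) * φ y) := by
  unfold Hop
  rw [ofReal_integral_eq_lintegral_ofReal (Hop_integrable hφ hM q)]
  exact Eventually.of_forall fun y => mul_nonneg (hk_nonneg _) (h0 y)

lemma Dop_Hop {N : ℕ} {φ : Euc N → ℝ} (hφ : Measurable φ) {M : ℝ} (hM : ∀ y, |φ y| ≤ M)
    (h0 : ∀ y, 0 ≤ φ y) {t : ℝ} (ht : 0 < t) (x : Euc N) :
    IntegrableOn (fun p : ℝ × Euc N => hk ((t, x) - p) * Hop φ p) (PosT N) ∧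
    Dop (Hop φ) (t, x) ≤ t * Hop φ (t, x) := by
  have hkm := hk_measurable (N := N)
  have h := Dop_slice (g := Hop φ) (Hop_measurable hφ) (fun p _ => Hop_nonneg h0 p)
    (t := t) (x := x) (b := fun _ => Hop φ (t, x))
    (integrableOn_const (by simp)) (fun _ _ => Hop_nonneg h0 _) ?_
  · refine ⟨h.1, h.2.trans ?_⟩
    simp [ht.le]
  · intro s hs
    simp_rw [ENNReal.ofReal_mul (hk_nonneg _), lint_Hop hφ hM h0]
    simp_rw [← lintegral_const_mul' _ _ ENNReal.ofReal_ne_top]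
    rw [lintegral_lintegral_swap]
    · refine lintegral_mono fun z => ?_
      simp_rw [ENNReal.ofReal_mul (hk_nonneg _), ← mul_assoc]
      rw [lintegral_mul_const' _ _ ENNReal.ofReal_ne_top]
      simp_rw [← ENNReal.ofReal_mul (hk_nonneg _)]
      rw [lint_hk_semigroup (by linarith [hs.2]) hs.1, sub_add_cancel]
      exact (ENNReal.ofReal_mul (hk_nonneg _)).ge
    · refine Measurable.aemeasurable ?_
      simp only [Function.uncurry_def]
      fun_prop

lemma Dop_one {N : ℕ} {t : ℝ} (ht : 0 < t) (x : Euc N) :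
    IntegrableOn (fun p : ℝ × Euc N => hk ((t, x) - p) * 1) (PosT N) ∧
    Dop (fun _ => 1) (t, x) ≤ t := by
  have h := Dop_slice (g := fun _ : ℝ × Euc N => 1) measurable_const (fun p _ => zero_le_one)
    (t := t) (x := x) (b := fun _ => 1)
    (integrableOn_const (by simp)) (fun _ _ => zero_le_one) ?_
  · refine ⟨h.1, h.2.trans ?_⟩
    simp [ht.le]
  · intro s hs
    simp_rw [mul_one]
    rw [← ofReal_integral_eq_lintegral_ofReal (hk_integrable _ _)
      (Eventually.of_forall fun y => hk_nonneg _), hk_mass (by linarith [hs.2])]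

lemma hk_far {N : ℕ} {t d : ℝ} (ht : 0 < t) (hd : 0 ≤ d) {z : Euc N} (hz : d ≤ ‖z‖) :
    hk (t, z) ≤ (2 : ℝ) ^ ((N : ℝ) / 2) * Real.exp (-(d ^ 2 / (8 * t))) * hk (2 * t, z) := by
  rw [hk_pos_eq ht, hk_pos_eq (by positivity : (0 : ℝ) < 2 * t)]
  have hp := Real.pi_pos
  have e1 : (4 * Real.pi * t) ^ (-((N : ℝ) / 2))
      = (2 : ℝ) ^ ((N : ℝ) / 2) * (4 * Real.pi * (2 * t)) ^ (-((N : ℝ) / 2)) := by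
    have : 4 * Real.pi * (2 * t) = 2 * (4 * Real.pi * t) := by ring
    rw [this, Real.mul_rpow (x := 2) (y := 4 * Real.pi * t) (by norm_num) (by positivity), ← mul_assoc,
      ← Real.rpow_add (by norm_num : (0 : ℝ) < 2)]
    simp
  have e2 : Real.exp (-(1 / (4 * t)) * ‖z‖ ^ 2)
      ≤ Real.exp (-(d ^ 2 / (8 * t))) * Real.exp (-(1 / (4 * (2 * t))) * ‖z‖ ^ 2) := by
    rw [← Real.exp_add]
    apply Real.exp_le_exp.2
    have h1 : d ^ 2 ≤ ‖z‖ ^ 2 := by gcongr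
    have h2 : d ^ 2 / (8 * t) ≤ ‖z‖ ^ 2 / (8 * t) := by gcongr
    have h3 : -(1 / (4 * t)) * ‖z‖ ^ 2 = - (‖z‖ ^ 2 / (8 * t)) - ‖z‖ ^ 2 / (8 * t) := by
      field_simp
      ring
    have h4 : -(1 / (4 * (2 * t))) * ‖z‖ ^ 2 = - (‖z‖ ^ 2 / (8 * t)) := by
      field_simp
      ring
    rw [h3, h4]
    linarith
  rw [e1]
  calc _ ≤ 2 ^ ((N : ℝ) / 2) * (4 * Real.pi * (2 * t)) ^ (-((N : ℝ) / 2)) *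
      (Real.exp (-(d ^ 2 / (8 * t))) * Real.exp (-(1 / (4 * (2 * t))) * ‖z‖ ^ 2)) := by gcongr
    _ = _ := by ring

lemma Hop_small {N : ℕ} {φ : Euc N → ℝ} (hφ : Measurable φ) {M : ℝ} (hM : ∀ y, |φ y| ≤ M)
    (h0 : ∀ y, 0 ≤ φ y) {δ : ℝ} (hδ : 0 < δ) (hsupp : ∀ y, ‖y‖ < δ → φ y = 0) (k : ℕ) :
    ∃ C : ℝ, 0 ≤ C ∧ ∀ t x, 0 < t → ‖x‖ < δ / 2 → Hop φ (t, x) ≤ C * t ^ k := by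
  have hM0 : 0 ≤ M := (abs_nonneg _).trans (hM 0)
  refine ⟨(2 : ℝ) ^ ((N : ℝ) / 2) * M * (k.factorial * (32 / δ ^ 2) ^ k), by positivity, ?_⟩
  intro t x ht hx
  set A := (2 : ℝ) ^ ((N : ℝ) / 2) * Real.exp (-((δ / 2) ^ 2 / (8 * t))) with hA
  have hA0 : 0 ≤ A := by positivity
  have h1 : Hop φ (t, x) ≤ ∫ y, A * M * hk (2 * t, x - y) := by
    refine integral_mono (Hop_integrable hφ hM (t, x)) ((hk_integrable _ x).const_mul _) ?_
    intro y
    simp only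
    rcases lt_or_ge ‖y‖ δ with h | h
    · rw [hsupp y h, mul_zero]
      have := hk_nonneg (2 * t, x - y)
      positivity
    · have h2 : δ / 2 ≤ ‖x - y‖ := by
        have := norm_sub_norm_le y x
        rw [norm_sub_rev] at this
        linarith
      have h3 := hk_far ht (by positivity) h2
      calc hk (t, x - y) * φ y ≤ (A * hk (2 * t, x - y)) * M :=
            mul_le_mul h3 ((le_abs_self _).trans (hM y)) (h0 y)
              (mul_nonneg hA0 (hk_nonneg _))
        _ = _ := by ring
  rw [integral_const_mul, hk_mass (by positivity), mul_one] at h1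
  refine h1.trans ?_
  have h4 : Real.exp (-((δ / 2) ^ 2 / (8 * t))) ≤ k.factorial * (32 / δ ^ 2) ^ k * t ^ k := by
    have h5 := Real.pow_div_factorial_le_exp ((δ / 2) ^ 2 / (8 * t)) (by positivity) k
    rw [Real.exp_neg]
    have h6 : 0 < ((δ / 2) ^ 2 / (8 * t)) ^ k / k.factorial := by positivity
    refine (inv_anti₀ h6 h5).trans (le_of_eq ?_)
    have : (δ / 2) ^ 2 / (8 * t) = (32 / δ ^ 2 * t)⁻¹ := by
      field_simp
      norm_num
    rw [this, inv_pow, inv_div, div_inv_eq_mul, mul_pow]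
    ring
  calc A * M ≤ (2 : ℝ) ^ ((N : ℝ) / 2) * (k.factorial * (32 / δ ^ 2) ^ k * t ^ k) * M := by
        rw [hA]; gcongr
    _ = _ := by ring

lemma hk_dom {N : ℕ} {a b t : ℝ} (ha : 0 < a) (hat : a ≤ t) (htb : t ≤ b) {x x0 : Euc N}
    (hx : ‖x - x0‖ ≤ 1) (y : Euc N) :
    hk (t, x - y) ≤ ((4 * Real.pi * a) ^ (-((N : ℝ) / 2)) * Real.exp (1 / (4 * b)))
      * Real.exp (-(1 / (8 * b)) * ‖x0 - y‖ ^ 2) := by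
  have hp := Real.pi_pos
  have ht : 0 < t := ha.trans_le hat
  have hb : 0 < b := ht.trans_le htb
  rw [hk_pos_eq ht, mul_assoc ((4 * Real.pi * a) ^ (-((N : ℝ) / 2))), ← Real.exp_add]
  refine mul_le_mul ?_ (Real.exp_le_exp.2 ?_) (Real.exp_nonneg _) (by positivity)
  · rw [Real.rpow_neg (by positivity), Real.rpow_neg (by positivity)]
    gcongr
  · have h1 : ‖x0 - y‖ ^ 2 / 2 - 1 ≤ ‖x - y‖ ^ 2 := by
      have h2 : ‖x0 - y‖ ≤ ‖x - y‖ + 1 := by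
        calc ‖x0 - y‖ = ‖(x - y) - (x - x0)‖ := by congr 1; abel
          _ ≤ ‖x - y‖ + ‖x - x0‖ := norm_sub_le _ _
          _ ≤ _ := by linarith
      have h3 : ‖x0 - y‖ ^ 2 ≤ (‖x - y‖ + 1) ^ 2 := by gcongr
      nlinarith [sq_nonneg (‖x - y‖ - 1)]
    have h4 : ‖x - y‖ ^ 2 / (4 * b) ≤ ‖x - y‖ ^ 2 / (4 * t) := by gcongr
    have h5 : (‖x0 - y‖ ^ 2 / 2 - 1) / (4 * b) ≤ ‖x - y‖ ^ 2 / (4 * b) := by gcongr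
    have e1 : -(1 / (4 * t)) * ‖x - y‖ ^ 2 = -(‖x - y‖ ^ 2 / (4 * t)) := by ring
    have e2 : (‖x0 - y‖ ^ 2 / 2 - 1) / (4 * b) = 1 / (8 * b) * ‖x0 - y‖ ^ 2 - 1 / (4 * b) := by
      field_simp
      ring
    rw [e1]
    linarith

lemma hk_continuousAt {N : ℕ} {p : ℝ × Euc N} (hp : p.1 ≠ 0) : ContinuousAt hk p := by
  rcases lt_or_gt_of_ne hp with h | h
  · have h1 : (hk : ℝ × Euc N → ℝ) =ᶠ[nhds p] fun _ => 0 := by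
      filter_upwards [(isOpen_lt continuous_fst continuous_const).mem_nhds h] with q hq
      exact hk_nonpos (le_of_lt hq) q.2
    exact continuousAt_const.congr h1.symm
  · have h1 : (hk : ℝ × Euc N → ℝ) =ᶠ[nhds p] fun q => (4 * Real.pi * q.1) ^ (-((N : ℝ) / 2))
        * Real.exp (-(1 / (4 * q.1)) * ‖q.2‖ ^ 2) := by
      filter_upwards [(isOpen_lt continuous_const continuous_fst).mem_nhds h] with q hq
      exact hk_pos_eq hq q.2
    refine ContinuousAt.congr ?_ h1.symm
    have hpi := Real.pi_pos
    have h2 : 4 * Real.pi * p.1 ≠ 0 := by positivity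
    have h3 : 4 * p.1 ≠ 0 := by positivity
    refine ContinuousAt.mul ?_ ?_
    · exact ContinuousAt.rpow_const (by fun_prop) (Or.inl h2)
    · refine Real.continuous_exp.continuousAt.comp ?_
      refine ContinuousAt.mul ?_ (by fun_prop)
      have : ContinuousAt (fun q : ℝ × Euc N => 1 / (4 * q.1)) p :=
        continuousAt_const.div (by fun_prop) h3
      exact this.neg

lemma Hop_continuousAt {N : ℕ} {φ : Euc N → ℝ} (hφ : Measurable φ) {M : ℝ} (hM : ∀ y, |φ y| ≤ M)
    {q : ℝ × Euc N} (hq : 0 < q.1) : ContinuousAt (Hop φ) q := by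
  have hkm := hk_measurable (N := N)
  set K := ((4 * Real.pi * (q.1 / 2)) ^ (-((N : ℝ) / 2)) * Real.exp (1 / (4 * (2 * q.1))))
  refine continuousAt_of_dominated (bound := fun y =>
    K * Real.exp (-(1 / (8 * (2 * q.1))) * ‖q.2 - y‖ ^ 2) * M) ?_ ?_ ?_ ?_
  · refine Eventually.of_forall fun p => Measurable.aestronglyMeasurable ?_
    fun_prop
  · have h1 : ∀ᶠ p : ℝ × Euc N in nhds q, q.1 / 2 < p.1 :=
      (isOpen_lt continuous_const continuous_fst).mem_nhds (by simp; linarith)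
    have h2 : ∀ᶠ p : ℝ × Euc N in nhds q, p.1 < 2 * q.1 :=
      (isOpen_lt continuous_fst continuous_const).mem_nhds (by simp; linarith)
    have h3 : ∀ᶠ p : ℝ × Euc N in nhds q, ‖p.2 - q.2‖ < 1 :=
      (isOpen_lt (f := fun p : ℝ × Euc N => ‖p.2 - q.2‖) (by fun_prop) continuous_const).mem_nhds
        (by simp)
    filter_upwards [h1, h2, h3] with p hp1 hp2 hp3
    refine Eventually.of_forall fun y => ?_
    rw [norm_mul, Real.norm_of_nonneg (hk_nonneg _)]
    have h4 := hk_dom (half_pos hq) hp1.le hp2.le hp3.le y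
    exact mul_le_mul h4 (hM y) (norm_nonneg _) ((hk_nonneg _).trans h4)
  · refine (Integrable.const_mul ?_ _).mul_const _
    exact (gauss_integrable (by positivity)).comp_sub_left q.2
  · refine Eventually.of_forall fun y => ContinuousAt.mul ?_ continuousAt_const
    have : ContinuousAt (fun p : ℝ × Euc N => (p.1, p.2 - y)) q := by fun_prop
    exact ContinuousAt.comp (g := hk) (hk_continuousAt hq.ne') this



/-- The power nonlinearity. -/
def Fnl (α z : ℝ) : ℝ := |z| ^ α * z

lemma Fnl_of_pos {α z : ℝ} (hz : 0 < z) : Fnl α z = z ^ (α + 1) := by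
  rw [Fnl, abs_of_pos hz, Real.rpow_add hz, Real.rpow_one]

lemma hasDerivAt_Fnl_pos {α z : ℝ} (hz : 0 < z) : HasDerivAt (Fnl α) ((α + 1) * z ^ α) z := by
  have h := Real.hasDerivAt_rpow_const (x := z) (p := α + 1) (Or.inl hz.ne')
  rw [add_sub_cancel_right] at h
  refine h.congr_of_eventuallyEq ?_
  filter_upwards [lt_mem_nhds hz] with y hy using Fnl_of_pos hy

lemma Fnl_scale {α p r f : ℝ} (hp : p * α = 2) (hr : 0 < r) :
    Fnl α (r ^ p * f) = r ^ (2 + p) * (|f| ^ α * f) := by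
  rw [Fnl, abs_mul, abs_of_pos (Real.rpow_pos_of_pos hr p), Real.mul_rpow (by positivity) (abs_nonneg _),
    ← Real.rpow_mul hr.le, hp, Real.rpow_add hr]
  ring

lemma rate_aux {b a κ ε ν r1 : ℝ} {g h e : ℝ → ℝ} (hr1 : 0 < r1) (ha : 0 < a) (hb : 0 < b)
    (hκ : 0 < κ) (hκ1 : κ ≤ a / 2) (hκ2 : κ * (2 * a) ≤ b) (hκ3 : κ ^ 2 ≤ 2 * b)
    (hε : 0 < ε) (hε1 : ε ≤ a / 4) (hε2 : ε * (1 + κ) ≤ κ * b / 4)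
    (hν1 : ν * (1 + κ / 2) ≤ a / 2) (hν2 : ν * (b + κ / 2) ≤ κ * b / 2) (hν : 0 < ν)
    (hr1a : r1 ^ 2 ≤ a / 4)
    (hg : ∀ r ∈ Set.Ioc 0 r1, HasDerivAt g (h r / r) r)
    (hh : ∀ r ∈ Set.Ioc 0 r1, HasDerivAt h (((a - r ^ 2 / 2) * h r - b * g r + e r) / r) r)
    (he : ∀ r ∈ Set.Ioc 0 r1, |e r| ≤ ε * |g r|) :
    ∃ K : ℝ, 0 ≤ K ∧ ∀ r ∈ Set.Ioc 0 r1, |g r| ≤ K * r ^ (ν / 2) := by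
  set E : ℝ → ℝ := fun r => h r ^ 2 + b * g r ^ 2 - κ * (g r * h r) with hE
  have hElow : ∀ r, b / 2 * g r ^ 2 ≤ E r := by
    intro r
    simp only [hE]
    nlinarith [sq_nonneg (h r - κ / 2 * g r), sq_nonneg (g r)]
  have hEd : ∀ r ∈ Set.Ioc 0 r1, HasDerivAt (fun r => r ^ (-ν) * E r)
      (-ν * r ^ (-ν - 1) * E r + r ^ (-ν) *
        (2 * h r * (((a - r ^ 2 / 2) * h r - b * g r + e r) / r) + b * (2 * g r * (h r / r))
          - κ * (h r / r * h r + g r * (((a - r ^ 2 / 2) * h r - b * g r + e r) / r)))) r := by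
    intro r hr
    have h1 := (Real.hasDerivAt_rpow_const (x := r) (p := -ν) (Or.inl hr.1.ne'))
    have h2 : HasDerivAt E _ r := (((hh r hr).pow 2).add (((hg r hr).pow 2).const_mul b)).sub
      (((hg r hr).mul (hh r hr)).const_mul κ)
    refine (h1.mul h2).congr_deriv ?_
    norm_num
  have hmono : MonotoneOn (fun r => r ^ (-ν) * E r) (Set.Ioc 0 r1) := by
    refine monotoneOn_of_deriv_nonneg (convex_Ioc 0 r1) ?_ ?_ ?_
    · intro r hr
      exact (hEd r hr).continuousAt.continuousWithinAt
    · intro r hr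
      rw [interior_Ioc] at hr
      exact (hEd r ⟨hr.1, hr.2.le⟩).differentiableAt.differentiableWithinAt
    · intro r hr
      rw [interior_Ioc] at hr
      have hr' : r ∈ Set.Ioc 0 r1 := ⟨hr.1, hr.2.le⟩
      have hr0 := hr.1
      rw [(hEd r hr').deriv]
      have hkey : ν * E r ≤ (2 * a - r ^ 2 - κ) * h r ^ 2 + κ * b * g r ^ 2
          - κ * (a - r ^ 2 / 2) * (g r * h r) + 2 * h r * e r - κ * (g r * e r) := by
        have hr2 : r ^ 2 ≤ a / 4 := (pow_le_pow_left₀ hr0.le hr.2.le 2).trans hr1a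
        have hr2' : 0 ≤ r ^ 2 := sq_nonneg r
        have hee := he r hr'
        set G := g r
        set Hh := h r
        have hab : |G| ^ 2 = G ^ 2 := sq_abs G
        have hab2 : |Hh| ^ 2 = Hh ^ 2 := sq_abs Hh
        have i1 : κ * (a - r ^ 2 / 2) * (G * Hh) ≤ κ * b / 4 * G ^ 2 + a / 2 * Hh ^ 2 := by
          have j1 : (a - r ^ 2 / 2) * (G * Hh) ≤ a * (|G| * |Hh|) := by
            rw [← abs_mul]
            have : 0 ≤ a - r ^ 2 / 2 := by linarith
            calc (a - r ^ 2 / 2) * (G * Hh) ≤ (a - r ^ 2 / 2) * |G * Hh| :=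
                    mul_le_mul_of_nonneg_left (le_abs_self _) this
                _ ≤ a * |G * Hh| := mul_le_mul_of_nonneg_right (by linarith) (abs_nonneg _)
          have j2 : a * (|G| * |Hh|) ≤ b / 4 * G ^ 2 + a ^ 2 / b * Hh ^ 2 := by
            rw [← hab, ← hab2]
            have : b / 4 * |G| ^ 2 + a ^ 2 / b * |Hh| ^ 2 - a * (|G| * |Hh|)
                = (b / 2 * |G| - a * |Hh|) ^ 2 / b := by
              field_simp
              ring
            have h3 : 0 ≤ (b / 2 * |G| - a * |Hh|) ^ 2 / b := by positivity
            linarith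
          have j3 : κ * (a ^ 2 / b) ≤ a / 2 := by
            rw [← mul_div_assoc, div_le_iff₀ hb]
            nlinarith
          have j4 : κ * ((a - r ^ 2 / 2) * (G * Hh)) ≤ κ * (b / 4 * G ^ 2 + a ^ 2 / b * Hh ^ 2) :=
            mul_le_mul_of_nonneg_left (j1.trans j2) hκ.le
          have j5 : κ * (a ^ 2 / b) * Hh ^ 2 ≤ a / 2 * Hh ^ 2 :=
            mul_le_mul_of_nonneg_right j3 (sq_nonneg _)
          linarith
        have i2 : -(2 * Hh * e r) ≤ ε * (G ^ 2 + Hh ^ 2) := by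
          have j1 : -(2 * Hh * e r) ≤ 2 * |Hh| * (ε * |G|) := by
            have : |2 * Hh * e r| ≤ 2 * |Hh| * (ε * |G|) := by
              rw [abs_mul, abs_mul, abs_two]
              gcongr
            exact (neg_le_abs _).trans this
          have j2 : 2 * |Hh| * |G| ≤ G ^ 2 + Hh ^ 2 := by
            rw [← hab, ← hab2]
            nlinarith [sq_nonneg (|Hh| - |G|)]
          have j3 := mul_le_mul_of_nonneg_left j2 hε.le
          linarith
        have i3 : κ * (G * e r) ≤ κ * ε * G ^ 2 := by
          have : |G * e r| ≤ |G| * (ε * |G|) := by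
            rw [abs_mul]
            gcongr
          have j2 := (le_abs_self _).trans this
          have j3 := mul_le_mul_of_nonneg_left j2 hκ.le
          rw [← hab]
          linarith
        have i4 : ν * E r ≤ a / 2 * Hh ^ 2 + κ * b / 2 * G ^ 2 := by
          have j1 : E r ≤ (1 + κ / 2) * Hh ^ 2 + (b + κ / 2) * G ^ 2 := by
            simp only [hE]
            nlinarith [sq_nonneg (G + Hh)]
          have j2 := mul_le_mul_of_nonneg_left j1 hν.le
          have j3 := mul_le_mul_of_nonneg_right hν1 (sq_nonneg Hh)
          have j4 := mul_le_mul_of_nonneg_right hν2 (sq_nonneg G)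
          linarith
        have i5 := mul_le_mul_of_nonneg_right hε1 (sq_nonneg Hh)
        have i6 := mul_le_mul_of_nonneg_right hε2 (sq_nonneg G)
        have i7 : (2 * a - a / 4 - a / 2) * Hh ^ 2 ≤ (2 * a - r ^ 2 - κ) * Hh ^ 2 :=
          mul_le_mul_of_nonneg_right (by linarith) (sq_nonneg Hh)
        nlinarith
      have e1 : r ^ (-ν - 1) = r ^ (-ν) / r := Real.rpow_sub_one hr0.ne' _
      have : -ν * r ^ (-ν - 1) * E r + r ^ (-ν) *
        (2 * h r * (((a - r ^ 2 / 2) * h r - b * g r + e r) / r) + b * (2 * g r * (h r / r))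
          - κ * (h r / r * h r + g r * (((a - r ^ 2 / 2) * h r - b * g r + e r) / r)))
          = r ^ (-ν) / r * (((2 * a - r ^ 2 - κ) * h r ^ 2 + κ * b * g r ^ 2
          - κ * (a - r ^ 2 / 2) * (g r * h r) + 2 * h r * e r - κ * (g r * e r)) - ν * E r) := by
        rw [e1]
        field_simp
        ring
      rw [this]
      exact mul_nonneg (by positivity) (by linarith)
  set E1 := r1 ^ (-ν) * E r1 with hE1
  have hE10 : 0 ≤ E1 := mul_nonneg (by positivity) ((by positivity : 0 ≤ b / 2 * g r1 ^ 2).trans (hElow r1))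
  refine ⟨Real.sqrt (2 / b * E1), by positivity, ?_⟩
  intro r hr
  have hr0 := hr.1
  have h1 : r ^ (-ν) * E r ≤ E1 := hmono hr ⟨hr1, le_rfl⟩ hr.2
  have h2 : E r ≤ E1 * r ^ ν := by
    rw [Real.rpow_neg hr0.le] at h1
    have h3 : 0 < r ^ ν := Real.rpow_pos_of_pos hr0 _
    rwa [inv_mul_le_iff₀ h3, mul_comm] at h1
  have h3 : g r ^ 2 ≤ 2 / b * E1 * r ^ ν := by
    have := (hElow r).trans h2
    have h4 : g r ^ 2 = 2 / b * (b / 2 * g r ^ 2) := by field_simp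
    rw [h4, mul_assoc]
    gcongr
  have h4 := Real.abs_le_sqrt h3
  rw [Real.sqrt_mul (by positivity), Real.sqrt_eq_rpow (r ^ ν), ← Real.rpow_mul hr0.le] at h4
  convert h4 using 3
  ring

lemma rate {N : ℕ} {α β p B : ℝ} (hα : 0 < α) (hp : p = 2 / α) (hβ : β = p * ((N : ℝ) - 2 - p))
    (hβ0 : 0 < β) (hpn : (N : ℝ) - 2 < 2 * p) (hB : B = β ^ (1 / α))
    {f : ℝ → ℝ} (hfC2 : ContDiffOn ℝ 2 f (Set.Ioi 0))
    (hfode : ∀ r : ℝ, 0 < r →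
      deriv (deriv f) r + (((N : ℝ) - 1) / r + r / 2) * deriv f r + f r / α
        + |f r| ^ α * f r = 0)
    (hfsing : Tendsto (fun r : ℝ => r ^ p * f r) (nhdsWithin 0 (Set.Ioi 0)) (nhds B)) :
    ∃ ν : ℝ, 0 < ν ∧ ∃ r1 : ℝ, 0 < r1 ∧ ∃ K : ℝ, 0 ≤ K ∧ ∀ r ∈ Set.Ioc 0 r1, |r ^ p * f r - B| ≤ K * r ^ ν := by
  have hB0 : 0 < B := by rw [hB]; positivity
  have hBα : B ^ α = β := by
    rw [hB, ← Real.rpow_mul hβ0.le, one_div, inv_mul_cancel₀ hα.ne', Real.rpow_one]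
  have hpα : p * α = 2 := by rw [hp]; field_simp
  set a := 2 * p - ((N : ℝ) - 2) with ha
  have ha0 : 0 < a := by linarith
  set b := α * β with hb
  have hb0 : 0 < b := by positivity
  obtain ⟨κ, hκ, hκ1, hκ2, hκ3⟩ : ∃ κ > 0, κ ≤ a / 2 ∧ κ * (2 * a) ≤ b ∧ κ ^ 2 ≤ 2 * b := by
    refine ⟨min (a / 2) (min (b / (2 * a)) (Real.sqrt (2 * b))), by positivity, min_le_left _ _, ?_, ?_⟩
    · rw [← le_div_iff₀ (by positivity)]
      exact (min_le_right _ _).trans (min_le_left _ _)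
    · refine (pow_le_pow_left₀ (by positivity) ((min_le_right _ _).trans (min_le_right _ _)) 2).trans ?_
      rw [Real.sq_sqrt (by positivity)]
  obtain ⟨ε, hε, hε1, hε2⟩ : ∃ ε > 0, ε ≤ a / 4 ∧ ε * (1 + κ) ≤ κ * b / 4 := by
    refine ⟨min (a / 4) (κ * b / 4 / (1 + κ)), by positivity, min_le_left _ _, ?_⟩
    rw [← le_div_iff₀ (by positivity)]
    exact min_le_right _ _
  obtain ⟨ν, hν, hν1, hν2⟩ : ∃ ν > 0, ν * (1 + κ / 2) ≤ a / 2 ∧ ν * (b + κ / 2) ≤ κ * b / 2 := by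
    refine ⟨min (a / 2 / (1 + κ / 2)) (κ * b / 2 / (b + κ / 2)), by positivity, ?_, ?_⟩
    · rw [← le_div_iff₀ (by positivity)]
      exact min_le_left _ _
    · rw [← le_div_iff₀ (by positivity)]
      exact min_le_right _ _
  -- linearisation of the nonlinearity
  have hlin := (hasDerivAt_Fnl_pos (α := α) hB0).isLittleO.def hε
  have hev := hfsing.eventually hlin
  obtain ⟨r2, hr2, hr2'⟩ := mem_nhdsGT_iff_exists_Ioc_subset.1 hev
  set r1 := min r2 (Real.sqrt (a / 4)) with hr1
  have hr10 : 0 < r1 := lt_min hr2 (by positivity)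
  have hr1a : r1 ^ 2 ≤ a / 4 := by
    refine (pow_le_pow_left₀ hr10.le (min_le_right _ _) 2).trans ?_
    rw [Real.sq_sqrt (by positivity)]
  have hf1 : ∀ r : ℝ, 0 < r → HasDerivAt f (deriv f r) r := fun r hr =>
    ((hfC2.differentiableOn (by norm_num)).differentiableAt (Ioi_mem_nhds hr)).hasDerivAt
  have hf2 : ∀ r : ℝ, 0 < r → HasDerivAt (deriv f) (deriv (deriv f) r) r := by
    intro r hr
    have h1 : ContDiffOn ℝ 1 (deriv f) (Set.Ioi 0) :=
      ((contDiffOn_succ_iff_deriv_of_isOpen (n := 1) isOpen_Ioi).1 hfC2).2.2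
    exact ((h1.differentiableOn (by norm_num)).differentiableAt (Ioi_mem_nhds hr)).hasDerivAt
  set g : ℝ → ℝ := fun r => r ^ p * f r - B with hg
  set h : ℝ → ℝ := fun r => p * (r ^ p * f r) + r ^ (p + 1) * deriv f r with hh
  set e : ℝ → ℝ := fun r => -(Fnl α (r ^ p * f r) - Fnl α B - (r ^ p * f r - B) * ((α + 1) * B ^ α))
    with he
  suffices hs : ∃ K : ℝ, 0 ≤ K ∧ ∀ r ∈ Set.Ioc 0 r1, |g r| ≤ K * r ^ (ν / 2) by
    exact ⟨ν / 2, by positivity, r1, hr10, hs⟩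
  refine rate_aux (g := g) (h := h) (e := e) hr10 ha0 hb0 hκ hκ1 hκ2 hκ3 hε hε1 hε2
    hν1 hν2 hν hr1a ?_ ?_ ?_
  · intro r hr
    have hr0 := hr.1
    have h1 := (Real.hasDerivAt_rpow_const (x := r) (p := p) (Or.inl hr0.ne')).mul (hf1 r hr0)
    refine (h1.sub_const B).congr_deriv ?_
    simp only [hh]
    rw [Real.rpow_sub_one hr0.ne', Real.rpow_add_one hr0.ne']
    field_simp
  · intro r hr
    have hr0 := hr.1
    have h1 := (Real.hasDerivAt_rpow_const (x := r) (p := p) (Or.inl hr0.ne')).mul (hf1 r hr0)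
    have h2 := (Real.hasDerivAt_rpow_const (x := r) (p := p + 1) (Or.inl hr0.ne')).mul (hf2 r hr0)
    refine ((h1.const_mul p).add h2).congr_deriv ?_
    have hFB : Fnl α B = β * B := by rw [Fnl, abs_of_pos hB0, hBα]
    simp only [hh, hg, he]
    rw [Fnl_scale hpα hr0, hFB, hBα]
    have hode := hfode r hr0
    have hd2 : deriv (deriv f) r = -(((N : ℝ) - 1) / r + r / 2) * deriv f r - f r * (p / 2)
        - |f r| ^ α * f r := by
      have : f r / α = f r * (p / 2) := by rw [hp]; field_simp
      rw [this] at hode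
      linarith
    rw [hd2, Real.rpow_sub_one hr0.ne', add_sub_cancel_right, Real.rpow_add_one hr0.ne',
      Real.rpow_add hr0, Real.rpow_two, hb, ha, hβ]
    generalize |f r| ^ α * f r = y
    field_simp
    ring
  · intro r hr
    have := hr2' ⟨hr.1, hr.2.trans (min_le_left _ _)⟩
    simp only [he, abs_neg]
    simpa using this



lemma Fnl_neg (α z : ℝ) : Fnl α (-z) = -Fnl α z := by simp [Fnl]

lemma hasDerivAt_Fnl {α : ℝ} (hα : 0 < α) (z : ℝ) :
    HasDerivAt (Fnl α) ((α + 1) * |z| ^ α) z := by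
  rcases lt_trichotomy z 0 with h | h | h
  · have h1 := hasDerivAt_Fnl_pos (α := α) (neg_pos.2 h)
    have h2 : HasDerivAt (fun y => -Fnl α (-y)) (-((α + 1) * (-z) ^ α * -1)) z :=
      (h1.comp z (hasDerivAt_neg z)).neg
    rw [abs_of_neg h]
    simp only [Fnl_neg, neg_neg] at h2
    exact h2.congr_deriv (by ring)
  · subst h
    rw [abs_zero, Real.zero_rpow hα.ne', mul_zero, hasDerivAt_iff_tendsto_slope_zero]
    have h1 : Tendsto (fun t : ℝ => |t| ^ α) (nhdsWithin 0 {0}ᶜ) (nhds 0) := by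
      have : ContinuousAt (fun t : ℝ => |t| ^ α) 0 :=
        ContinuousAt.rpow_const (by fun_prop) (Or.inr hα.le)
      have h2 := this.tendsto
      simp only [abs_zero, Real.zero_rpow hα.ne'] at h2
      exact h2.mono_left nhdsWithin_le_nhds
    refine h1.congr' ?_
    filter_upwards [self_mem_nhdsWithin] with t ht
    have ht' : t ≠ 0 := ht
    simp only [Fnl, zero_add, abs_zero, mul_zero, sub_zero, smul_eq_mul]
    field_simp
  · rw [abs_of_pos h]
    exact hasDerivAt_Fnl_pos h

lemma Fnl_continuous {α : ℝ} (hα : 0 < α) : Continuous (Fnl α) :=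
  continuous_iff_continuousAt.2 fun z => (hasDerivAt_Fnl hα z).continuousAt

lemma Fnl_lip {α : ℝ} (hα : 0 < α) {a b m : ℝ} (ha : |a| ≤ m) (hb : |b| ≤ m) :
    |Fnl α a - Fnl α b| ≤ (α + 1) * m ^ α * |a - b| := by
  have h := (convex_Icc (-m) m).norm_image_sub_le_of_norm_hasDerivWithin_le (f := Fnl α)
    (f' := fun z => (α + 1) * |z| ^ α) (C := (α + 1) * m ^ α)
    (fun z _ => (hasDerivAt_Fnl hα z).hasDerivWithinAt) ?_ (abs_le.1 hb) (abs_le.1 ha)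
  · exact h
  · intro z hz
    have hz' : |z| ≤ m := abs_le.2 hz
    rw [Real.norm_of_nonneg (by positivity)]
    gcongr

lemma Fnl_abs {α z : ℝ} (hα : 0 < α) : |Fnl α z| = |z| ^ (α + 1) := by
  rw [Fnl, abs_mul, abs_of_nonneg (by positivity)]
  rcases eq_or_ne z 0 with h | h
  · subst h; simp [Real.zero_rpow (by positivity : α + 1 ≠ 0)]
  · rw [Real.rpow_add_one (abs_ne_zero.2 h)]

lemma profile_bdd {p B μ : ℝ} {f : ℝ → ℝ} (hfc : ContinuousOn f (Set.Ioi 0))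
    (hfsing : Tendsto (fun r : ℝ => r ^ p * f r) (nhdsWithin 0 (Set.Ioi 0)) (nhds B))
    (hμ : Tendsto (fun r : ℝ => r ^ p * f r) atTop (nhds μ)) :
    ∃ K : ℝ, 0 ≤ K ∧ ∀ r : ℝ, 0 < r → |r ^ p * f r| ≤ K := by
  have h1 : ∀ᶠ r in nhdsWithin (0 : ℝ) (Set.Ioi 0), |r ^ p * f r| < |B| + 1 :=
    hfsing.abs.eventually (gt_mem_nhds (by linarith))
  have h2 : ∀ᶠ r in atTop, |r ^ p * f r| < |μ| + 1 :=
    hμ.abs.eventually (gt_mem_nhds (by linarith))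
  obtain ⟨r1, hr1, hr1'⟩ := mem_nhdsGT_iff_exists_Ioc_subset.1 h1
  obtain ⟨r2, hr2⟩ := eventually_atTop.1 h2
  have hr10 : (0 : ℝ) < r1 := hr1
  have hc : ContinuousOn (fun r : ℝ => r ^ p * f r) (Set.Icc r1 r2) := by
    intro r hr
    have hr0 : 0 < r := hr10.trans_le hr.1
    refine ContinuousWithinAt.mul ?_ ?_
    · exact (Real.continuousAt_rpow_const r p (Or.inl hr0.ne')).continuousWithinAt
    · exact ((hfc r hr0).continuousAt (Ioi_mem_nhds hr0)).continuousWithinAt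
  obtain ⟨K, hK⟩ := isCompact_Icc.exists_bound_of_continuousOn hc
  refine ⟨max K (max (|B| + 1) (|μ| + 1)), by positivity, ?_⟩
  intro r hr
  rcases le_or_gt r r1 with h | h
  · exact (le_of_lt (hr1' ⟨hr, h⟩)).trans ((le_max_left _ _).trans (le_max_right _ _))
  · rcases le_or_gt r r2 with h' | h'
    · exact (hK r ⟨h.le, h'⟩).trans (le_max_left _ _)
    · exact (hr2 r h'.le).le.trans ((le_max_right _ _).trans (le_max_right _ _))

lemma rate_global {p B Kf ν0 r1 K0 : ℝ} {f : ℝ → ℝ} (hKf : ∀ r : ℝ, 0 < r → |r ^ p * f r| ≤ Kf)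
    (hr1 : 0 < r1) (hK0 : 0 ≤ K0) (h : ∀ r ∈ Set.Ioc 0 r1, |r ^ p * f r - B| ≤ K0 * r ^ ν0)
    {ν : ℝ} (hν : 0 < ν) (hν0 : ν ≤ ν0) :
    ∃ K : ℝ, 0 ≤ K ∧ ∀ r : ℝ, 0 < r → |r ^ p * f r - B| ≤ K * r ^ ν := by
  have hKf0 : 0 ≤ Kf := (abs_nonneg _).trans (hKf 1 one_pos)
  refine ⟨K0 * r1 ^ (ν0 - ν) + (Kf + |B|) * r1 ^ (-ν), by positivity, ?_⟩
  intro r hr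
  rcases le_or_gt r r1 with h1 | h1
  · refine (h r ⟨hr, h1⟩).trans ?_
    have e1 : r ^ ν0 = r ^ (ν0 - ν) * r ^ ν := by rw [← Real.rpow_add hr]; ring_nf
    have e2 : r ^ (ν0 - ν) ≤ r1 ^ (ν0 - ν) := Real.rpow_le_rpow hr.le h1 (by linarith)
    rw [e1, ← mul_assoc]
    refine mul_le_mul_of_nonneg_right ?_ (by positivity)
    have := mul_le_mul_of_nonneg_left e2 hK0
    have h3 : 0 ≤ (Kf + |B|) * r1 ^ (-ν) := by positivity
    linarith
  · have e1 : |r ^ p * f r - B| ≤ Kf + |B| := (abs_sub _ _).trans (by linarith [hKf r hr])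
    refine e1.trans ?_
    have e2 : 1 ≤ r1 ^ (-ν) * r ^ ν := by
      rw [Real.rpow_neg hr1.le, ← div_eq_inv_mul, one_le_div (by positivity)]
      exact Real.rpow_le_rpow hr1.le h1.le hν.le
    have e3 : (Kf + |B|) * 1 ≤ (Kf + |B|) * (r1 ^ (-ν) * r ^ ν) := by gcongr
    have e4 : 0 ≤ K0 * r1 ^ (ν0 - ν) * r ^ ν := by positivity
    linarith

/-- Elementary facts on the exponents. -/
lemma exponents {N : ℕ} (hN : 3 ≤ N) {α α₀ β η : ℝ}
    (hα₀ : α₀ = 4 / ((N : ℝ) - 4 + 2 * Real.sqrt ((N : ℝ) - 1)))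
    (hα1 : 2 / ((N : ℝ) - 2) < α) (hα2 : α < α₀)
    (hβ : β = 2 / α * ((N : ℝ) - 2 - 2 / α))
    (hη : η = ((N : ℝ) - 2) / 2 - Real.sqrt (((N : ℝ) - 2) ^ 2 / 4 - β * (α + 1))) :
    0 < α ∧ 2 / α < (N : ℝ) - 2 ∧ (N : ℝ) - 2 < 2 * (2 / α) ∧ 0 < β ∧ 0 < η ∧
      2 * η < (N : ℝ) - 2 ∧ η * ((N : ℝ) - 2 - η) = β * (α + 1) := by
  have hN' : (3 : ℝ) ≤ N := by exact_mod_cast hN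
  set n : ℝ := (N : ℝ) - 2 with hn
  have hn1 : 1 ≤ n := by linarith
  have hα : 0 < α := lt_trans (by positivity) hα1
  set p := 2 / α with hp
  have hp0 : 0 < p := by positivity
  have hpα : p * α = 2 := by rw [hp]; field_simp
  have hpn : p < n := by
    rw [hp, div_lt_iff₀ hα]
    rw [div_lt_iff₀ (by linarith)] at hα1
    linarith
  set s := Real.sqrt ((N : ℝ) - 1) with hs
  have hs2 : s ^ 2 = (N : ℝ) - 1 := Real.sq_sqrt (by linarith)
  have hs0 : 0 ≤ s := Real.sqrt_nonneg _
  have hs1 : 1 < s := by nlinarith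
  have hden : 0 < (N : ℝ) - 4 + 2 * s := by nlinarith
  have hpq : n / 2 - 1 + s < p := by
    rw [hα₀, lt_div_iff₀ hden] at hα2
    have h1 : (N : ℝ) - 4 + 2 * s = 2 * (n / 2 - 1 + s) := by rw [hn]; ring
    rw [h1] at hα2
    rw [hp, lt_div_iff₀ hα]
    linarith
  have hpn2 : n < 2 * p := by linarith
  have hβ0 : 0 < β := by rw [hβ]; exact mul_pos hp0 (by linarith)
  have hc : β * (α + 1) = (n - p) * (p + 2) := by rw [hβ]; linear_combination (n - p) * hpα
  have hD : 0 < n ^ 2 / 4 - β * (α + 1) := by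
    rw [hc]
    have h2 : s < p - n / 2 + 1 := by linarith
    have h3 : s ^ 2 < (p - n / 2 + 1) ^ 2 := pow_lt_pow_left₀ h2 hs0 (by norm_num)
    rw [hs2] at h3
    nlinarith
  have hsq := Real.sq_sqrt hD.le
  have hsp := Real.sqrt_pos.2 hD
  set d := Real.sqrt (n ^ 2 / 4 - β * (α + 1))
  have hc0 : 0 < β * (α + 1) := by positivity
  refine ⟨hα, hpn, hpn2, hβ0, ?_, by linarith, ?_⟩
  · have : d < n / 2 := by
      refine lt_of_pow_lt_pow_left₀ 2 (by positivity) ?_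
      rw [hsq]
      nlinarith
    linarith
  · rw [hη]
    nlinarith



instance instHaarProd {N : ℕ} : (volume : Measure (ℝ × Euc N)).IsAddHaarMeasure := by
  rw [Measure.volume_eq_prod]
  infer_instance

/-- The Duhamel integral of `G` at `q` converges and is at most `b`. -/
def DLe {N : ℕ} (G : ℝ × Euc N → ℝ) (q : ℝ × Euc N) (b : ℝ) : Prop :=
  IntegrableOn (fun p : ℝ × Euc N => hk (q - p) * G p) (PosT N) ∧ Dop G q ≤ b

lemma DLe.add {N : ℕ} {G G' : ℝ × Euc N → ℝ} {q : ℝ × Euc N} {b b' : ℝ} (h : DLe G q b)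
    (h' : DLe G' q b') : DLe (fun p => G p + G' p) q (b + b') := by
  have e : (fun p : ℝ × Euc N => hk (q - p) * (G p + G' p))
      = fun p => hk (q - p) * G p + hk (q - p) * G' p := by
    ext p; ring
  refine ⟨?_, ?_⟩
  · rw [e]; exact h.1.add h'.1
  · unfold Dop
    rw [e, integral_add h.1 h'.1]
    exact add_le_add h.2 h'.2

lemma DLe.const_mul {N : ℕ} {G : ℝ × Euc N → ℝ} {q : ℝ × Euc N} {b : ℝ} (h : DLe G q b) {a : ℝ}
    (ha : 0 ≤ a) : DLe (fun p => a * G p) q (a * b) := by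
  have e : (fun p : ℝ × Euc N => hk (q - p) * (a * G p)) = fun p => a * (hk (q - p) * G p) := by
    ext p; ring
  refine ⟨?_, ?_⟩
  · rw [e]; exact h.1.const_mul a
  · unfold Dop
    rw [e, integral_const_mul]
    exact mul_le_mul_of_nonneg_left h.2 ha

lemma DLe.le {N : ℕ} {G : ℝ × Euc N → ℝ} {q : ℝ × Euc N} {b b' : ℝ} (h : DLe G q b)
    (hb : b ≤ b') : DLe G q b' := ⟨h.1, h.2.trans hb⟩

lemma ae_snd_ne {N : ℕ} (hN : 3 ≤ N) : ∀ᵐ p : ℝ × Euc N, p.2 ≠ 0 := by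
  have : Nonempty (Fin N) := ⟨⟨0, by omega⟩⟩
  have h : {p : ℝ × Euc N | ¬ p.2 ≠ 0} = Set.univ ×ˢ {0} := by
    ext p; simp
  rw [ae_iff, h, Measure.volume_eq_prod, Measure.prod_prod]
  simp

lemma DLe.mono {N : ℕ} (hN : 3 ≤ N) {g G : ℝ × Euc N → ℝ} {q : ℝ × Euc N} {b : ℝ} (h : DLe G q b)
    (hg : AEStronglyMeasurable g (volume.restrict (PosT N)))
    (hle : ∀ p : ℝ × Euc N, 0 < p.1 → p.1 < q.1 → p.2 ≠ 0 → |g p| ≤ G p) :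
    IntegrableOn (fun p : ℝ × Euc N => hk (q - p) * g p) (PosT N) ∧ |Dop g q| ≤ b := by
  have hkm := hk_measurable (N := N)
  have hae : ∀ᵐ p ∂(volume.restrict (PosT N)), ‖hk (q - p) * g p‖ ≤ hk (q - p) * G p := by
    filter_upwards [ae_restrict_mem measurableSet_PosT, ae_restrict_of_ae (ae_snd_ne hN)] with p hp hp2
    rw [norm_mul, Real.norm_of_nonneg (hk_nonneg _)]
    rcases lt_or_ge p.1 q.1 with h1 | h1
    · exact mul_le_mul_of_nonneg_left (hle p hp.1 h1 hp2) (hk_nonneg _)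
    · have : hk (q - p) = 0 := hk_nonpos (t := q.1 - p.1) (by linarith) (q.2 - p.2)
      simp [this]
  have hi : IntegrableOn (fun p : ℝ × Euc N => hk (q - p) * g p) (PosT N) := by
    refine Integrable.mono' h.1 ?_ hae
    refine AEStronglyMeasurable.mul ?_ hg
    refine Measurable.aestronglyMeasurable ?_
    fun_prop
  refine ⟨hi, le_trans ?_ h.2⟩
  unfold Dop
  rw [← Real.norm_eq_abs]
  exact norm_integral_le_of_norm_le h.1 hae

lemma DLe.mono' {N : ℕ} (hN : 3 ≤ N) {g G : ℝ × Euc N → ℝ} {q : ℝ × Euc N} {b : ℝ} (h : DLe G q b)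
    (hg : AEStronglyMeasurable g (volume.restrict (PosT N)))
    (hle : ∀ p : ℝ × Euc N, 0 < p.1 → p.1 < q.1 → p.2 ≠ 0 → |g p| ≤ G p) : DLe g q b := by
  have := h.mono hN hg hle
  exact ⟨this.1, (le_abs_self _).trans this.2⟩

lemma Dop_sub {N : ℕ} {g g' : ℝ × Euc N → ℝ} {q : ℝ × Euc N}
    (h : IntegrableOn (fun p : ℝ × Euc N => hk (q - p) * g p) (PosT N))
    (h' : IntegrableOn (fun p : ℝ × Euc N => hk (q - p) * g' p) (PosT N)) :
    Dop (fun p => g p - g' p) q = Dop g q - Dop g' q := by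
  unfold Dop
  rw [← integral_sub h h']
  congr 1
  ext p
  ring

/-- uniform bound on the heat kernel away from the origin -/
lemma hk_bdd_far {N : ℕ} {d : ℝ} (hd : 0 < d) :
    ∃ C : ℝ, 0 ≤ C ∧ ∀ (t : ℝ) (z : Euc N), d ≤ ‖z‖ → hk (t, z) ≤ C := by
  have hp := Real.pi_pos
  refine ⟨(4 * Real.pi) ^ (-((N : ℝ) / 2)) * (N.factorial * (4 / d ^ 2) ^ N + 1), by positivity, ?_⟩
  intro t z hz
  rcases le_or_gt t 0 with ht | ht
  · rw [hk_nonpos ht]; positivity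
  rw [hk_pos_eq ht, Real.mul_rpow (by positivity) ht.le, mul_assoc]
  gcongr
  have h5 := Real.pow_div_factorial_le_exp (d ^ 2 / (4 * t)) (by positivity) N
  have h6 : 0 < (d ^ 2 / (4 * t)) ^ N / N.factorial := by positivity
  have h7 : Real.exp (-(1 / (4 * t)) * ‖z‖ ^ 2) ≤ Real.exp (-(d ^ 2 / (4 * t))) := by
    apply Real.exp_le_exp.2
    have : d ^ 2 / (4 * t) ≤ ‖z‖ ^ 2 / (4 * t) := by gcongr
    have e : -(1 / (4 * t)) * ‖z‖ ^ 2 = -(‖z‖ ^ 2 / (4 * t)) := by ring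
    rw [e]; linarith
  have h8 : Real.exp (-(d ^ 2 / (4 * t))) ≤ N.factorial * (4 / d ^ 2) ^ N * t ^ N := by
    rw [Real.exp_neg]
    refine (inv_anti₀ h6 h5).trans (le_of_eq ?_)
    have : d ^ 2 / (4 * t) = (4 / d ^ 2 * t)⁻¹ := by field_simp
    rw [this, inv_pow, inv_div, div_inv_eq_mul, mul_pow]
    ring
  rcases le_or_gt t 1 with h | h
  · calc t ^ (-((N : ℝ) / 2)) * Real.exp (-(1 / (4 * t)) * ‖z‖ ^ 2)
        ≤ t ^ (-((N : ℝ) / 2)) * (N.factorial * (4 / d ^ 2) ^ N * t ^ N) := by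
          gcongr; exact h7.trans h8
      _ = N.factorial * (4 / d ^ 2) ^ N * (t ^ (-((N : ℝ) / 2)) * t ^ N) := by ring
      _ ≤ N.factorial * (4 / d ^ 2) ^ N * 1 := by
          gcongr
          rw [← Real.rpow_natCast, ← Real.rpow_add ht]
          refine Real.rpow_le_one ht.le h ?_
          have : (0 : ℝ) ≤ N := by positivity
          linarith
      _ ≤ _ := by linarith
  · calc t ^ (-((N : ℝ) / 2)) * Real.exp (-(1 / (4 * t)) * ‖z‖ ^ 2) ≤ 1 * 1 := by
          gcongr
          · refine Real.rpow_le_one_of_one_le_of_nonpos h.le ?_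
            have : (0 : ℝ) ≤ N := by positivity
            linarith
          · apply Real.exp_le_one_iff.2
            have : 0 ≤ (1 / (4 * t)) * ‖z‖ ^ 2 := by positivity
            linarith
      _ ≤ _ := by
        have : 0 ≤ N.factorial * (4 / d ^ 2) ^ N := by positivity
        linarith

lemma hk_integrable_strip {N : ℕ} (R : ℝ) :
    Integrable ((Set.Iio R ×ˢ (Set.univ : Set (Euc N))).indicator hk) := by
  have hkm := hk_measurable (N := N)
  rcases le_or_gt R 0 with hR | hR
  · have : (Set.Iio R ×ˢ (Set.univ : Set (Euc N))).indicator hk = fun _ => 0 := by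
      ext p
      by_cases h : p ∈ (Set.Iio R ×ˢ (Set.univ : Set (Euc N)))
      · rw [Set.indicator_of_mem h]
        have h1 : p.1 < R := h.1
        exact hk_nonpos (by linarith) p.2
      · rw [Set.indicator_of_notMem h]
    rw [this]
    exact integrable_zero _ _ _
  · have h1 := (Dop_one (N := N) hR 0).1
    simp only [mul_one] at h1
    have h2 : Integrable ((PosT N).indicator (fun p : ℝ × Euc N => hk ((R, 0) - p))) :=
      h1.integrable_indicator measurableSet_PosT
    have h3 := (flip_mp (N := N) R).integrable_comp_of_integrable h2
    refine h3.congr (Eventually.of_forall fun p => ?_)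
    simp only [Function.comp]
    by_cases h : p.1 < R
    · rw [Set.indicator_of_mem (show (R - p.1, p.2) ∈ PosT N from ⟨by simpa using h, trivial⟩),
        Set.indicator_of_mem (show p ∈ Set.Iio R ×ˢ (Set.univ : Set (Euc N)) from ⟨h, trivial⟩)]
      have : ((R, 0) : ℝ × Euc N) - (R - p.1, p.2) = (p.1, 0 - p.2) := by ext <;> simp
      rw [this, zero_sub, hk_symm]
    · rw [Set.indicator_of_notMem (fun h' => h (by simpa using h'.1)),
        Set.indicator_of_notMem (fun h' => h h'.1)]

lemma Dop_cont_bdd {N : ℕ} {g : ℝ × Euc N → ℝ} (hgm : Measurable g) {C : ℝ} (hC : ∀ p, |g p| ≤ C)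
    (hc : ∀ᵐ p, ContinuousAt ((PosT N).indicator g) p) (q0 : ℝ × Euc N) :
    ContinuousAt (Dop g) q0 := by
  have hkm := hk_measurable (N := N)
  have hC0 : 0 ≤ C := (abs_nonneg _).trans (hC 0)
  set G := (PosT N).indicator g with hG
  have hGm : Measurable G := hgm.indicator measurableSet_PosT
  have e : Dop g = fun q => ∫ p, hk p * G (q - p) := by
    ext q
    unfold Dop
    rw [← integral_indicator measurableSet_PosT,
      ← integral_sub_left_eq_self (fun p => hk p * G (q - p)) volume q]
    congr 1
    ext p
    rw [sub_sub_cancel, hG]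
    by_cases h : p ∈ PosT N
    · simp [Set.indicator_of_mem h]
    · simp [Set.indicator_of_notMem h]
  rw [e]
  refine continuousAt_of_dominated (bound := fun p =>
    (Set.Iio (q0.1 + 1) ×ˢ (Set.univ : Set (Euc N))).indicator hk p * C) ?_ ?_ ?_ ?_
  · exact Eventually.of_forall fun q => Measurable.aestronglyMeasurable (by fun_prop)
  · have h1 : ∀ᶠ q : ℝ × Euc N in nhds q0, q.1 < q0.1 + 1 :=
      (isOpen_lt continuous_fst continuous_const).mem_nhds (by simp)
    filter_upwards [h1] with q hq
    refine Eventually.of_forall fun p => ?_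
    rw [norm_mul, Real.norm_of_nonneg (hk_nonneg _)]
    by_cases h : p.1 < q0.1 + 1
    · rw [Set.indicator_of_mem (show p ∈ Set.Iio (q0.1 + 1) ×ˢ (Set.univ : Set (Euc N)) from
        ⟨h, trivial⟩)]
      refine mul_le_mul_of_nonneg_left ?_ (hk_nonneg _)
      refine (norm_indicator_le_norm_self _ _).trans (hC _)
    · have h2 : q - p ∉ PosT N := by
        intro h3
        have h4 : 0 < q.1 - p.1 := h3.1
        linarith
      rw [Set.indicator_of_notMem (fun h' => h h'.1), hG, Set.indicator_of_notMem h2]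
      simp
  · exact (hk_integrable_strip _).mul_const C
  · have h := (Measure.measurePreserving_sub_left (volume : Measure (ℝ × Euc N)) q0).quasiMeasurePreserving.ae hc
    filter_upwards [h] with p hp
    refine continuousAt_const.mul ?_
    exact ContinuousAt.comp (f := fun q => q - p) (g := G) hp (by fun_prop)

lemma Dop_cont_far {N : ℕ} {g : ℝ × Euc N → ℝ} (hgi : IntegrableOn g (PosT N)) {r : ℝ} (hr : 0 < r)
    (hg : ∀ p, r ≤ ‖p.2‖ → g p = 0) {q0 : ℝ × Euc N} (hq0 : 2 * r < ‖q0.2‖) :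
    (∀ᶠ q in nhds q0, IntegrableOn (fun p : ℝ × Euc N => hk (q - p) * g p) (PosT N)) ∧
    ContinuousAt (Dop g) q0 := by
  have hkm := hk_measurable (N := N)
  obtain ⟨C, hC0, hC⟩ := hk_bdd_far (N := N) hr
  have h1 : ∀ᶠ q : ℝ × Euc N in nhds q0, 2 * r < ‖q.2‖ :=
    (isOpen_lt continuous_const (continuous_snd.norm)).mem_nhds hq0
  have hm : ∀ q : ℝ × Euc N, AEStronglyMeasurable (fun p : ℝ × Euc N => hk (q - p) * g p)
      (volume.restrict (PosT N)) := by
    intro q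
    refine AEStronglyMeasurable.mul ?_ hgi.aestronglyMeasurable
    exact Measurable.aestronglyMeasurable (by fun_prop)
  have hb : ∀ᶠ q : ℝ × Euc N in nhds q0, ∀ p, ‖hk (q - p) * g p‖ ≤ C * ‖g p‖ := by
    filter_upwards [h1] with q hq p
    rw [norm_mul, Real.norm_of_nonneg (hk_nonneg _)]
    rcases lt_or_ge ‖p.2‖ r with h | h
    · refine mul_le_mul_of_nonneg_right (hC (q.1 - p.1) (q.2 - p.2) ?_) (norm_nonneg _)
      have := norm_sub_norm_le q.2 p.2
      linarith
    · rw [hg p h]; simp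
  refine ⟨?_, ?_⟩
  · filter_upwards [hb] with q hq
    exact Integrable.mono' (hgi.norm.const_mul C) (hm q) (Eventually.of_forall hq)
  · refine continuousAt_of_dominated (bound := fun p => C * ‖g p‖) ?_ ?_ ?_ ?_
    · exact Eventually.of_forall hm
    · filter_upwards [hb] with q hq using Eventually.of_forall hq
    · exact hgi.norm.const_mul C
    · have h2 : ∀ᵐ p : ℝ × Euc N, p.1 ≠ q0.1 := by
        have h : {p : ℝ × Euc N | ¬ p.1 ≠ q0.1} = {q0.1} ×ˢ Set.univ := by
          ext p; simp
        rw [ae_iff, h, Measure.volume_eq_prod, Measure.prod_prod]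
        simp
      filter_upwards [ae_restrict_of_ae h2] with p hp
      refine ContinuousAt.mul ?_ continuousAt_const
      refine ContinuousAt.comp (f := fun q => q - p) (g := hk) (hk_continuousAt ?_) (by fun_prop)
      exact sub_ne_zero.2 (Ne.symm hp)

/-- The space-time cylinder with the axis removed. -/
abbrev Om (N : ℕ) (T : ℝ) : Set (ℝ × Euc N) := Set.Ioo 0 T ×ˢ {x : Euc N | x ≠ 0}

lemma isOpen_Om {N : ℕ} {T : ℝ} : IsOpen (Om N T) := isOpen_Ioo.prod isOpen_ne

lemma integrableOn_strip {N : ℕ} {s : ℝ} (hsN : s < N) (hN : 3 ≤ N) (a b R : ℝ) :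
    IntegrableOn (fun p : ℝ × Euc N => ‖p.2‖ ^ (-s)) (Set.Ioo a b ×ˢ Metric.ball 0 R) := by
  have : Nonempty (Fin N) := ⟨⟨0, by omega⟩⟩
  have h1 : IntegrableOn (fun y : Euc N => ‖y‖ ^ (-s)) (Metric.ball 0 R) := by
    refine integrableOn_ball_of_norm_le_rpow (C := 1) (α := s) ?_ ?_ ?_ ?_
    · simp; omega
    · simpa using hsN
    · refine Eventually.of_forall fun y => ?_
      rw [one_mul, Real.norm_of_nonneg (by positivity)]
    · exact Measurable.aestronglyMeasurable (by fun_prop)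
  have h2 : IntegrableOn (fun _ : ℝ => (1 : ℝ)) (Set.Ioo a b) := integrableOn_const (by simp)
  have := Integrable.mul_prod (f := fun _ : ℝ => (1 : ℝ)) (g := fun y : Euc N => ‖y‖ ^ (-s)) h2 h1
  rw [IntegrableOn, Measure.volume_eq_prod, ← Measure.prod_restrict]
  simpa using this

lemma Dop_continuousAt {N : ℕ} (hN : 3 ≤ N) {T s C : ℝ} (hs : 0 < s) (hsN : s < N)
    {g : ℝ × Euc N → ℝ} (hgm : Measurable g) (hg0 : ∀ p, p ∉ Om N T → g p = 0)
    (hgc : ContinuousOn g (Om N T)) (hgb : ∀ p ∈ Om N T, |g p| ≤ C * (‖p.2‖ ^ (-s) + 1))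
    {q0 : ℝ × Euc N} (hq1 : 0 < q0.1) (hq2 : q0.2 ≠ 0) : ContinuousAt (Dop g) q0 := by
  have hN' : Nonempty (Fin N) := ⟨⟨0, by omega⟩⟩
  have hnq : 0 < ‖q0.2‖ := norm_pos_iff.2 hq2
  set r := ‖q0.2‖ / 3 with hr
  have hr0 : 0 < r := by positivity
  set A : Set (ℝ × Euc N) := {p | r ≤ ‖p.2‖} with hA
  have hAm : MeasurableSet A := measurableSet_le measurable_const (by fun_prop)
  have hC0 : 0 ≤ |C| := abs_nonneg C
  have hgb' : ∀ p, |g p| ≤ |C| * (‖p.2‖ ^ (-s) + 1) := by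
    intro p
    by_cases h : p ∈ Om N T
    · refine (hgb p h).trans (mul_le_mul_of_nonneg_right (le_abs_self C) (by positivity))
    · rw [hg0 p h, abs_zero]; positivity
  set g1 := A.indicator g with hg1
  set g2 := Aᶜ.indicator g with hg2
  have hg1b : ∀ p, |g1 p| ≤ |C| * (r ^ (-s) + 1) := by
    intro p
    by_cases h : p ∈ A
    · rw [hg1, Set.indicator_of_mem h]
      refine (hgb' p).trans ?_
      have h' : r ≤ ‖p.2‖ := h
      have := Real.rpow_le_rpow_of_nonpos hr0 h' (by linarith : -s ≤ 0)
      gcongr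
    · rw [hg1, Set.indicator_of_notMem h, abs_zero]; positivity
  have hg1m : Measurable g1 := hgm.indicator hAm
  have hg2m : Measurable g2 := hgm.indicator hAm.compl
  have hsum : g = fun p => g1 p + g2 p := by
    ext p
    exact (congrFun (Set.indicator_self_add_compl A g) p).symm
  have hg2i : IntegrableOn g2 (PosT N) := by
    have h1 : IntegrableOn g2 (Set.Ioo 0 T ×ˢ Metric.ball 0 r) := by
      have h2 : IntegrableOn (fun p : ℝ × Euc N => |C| * (‖p.2‖ ^ (-s) + 1))
          (Set.Ioo 0 T ×ˢ Metric.ball 0 r) := by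
        refine Integrable.const_mul (Integrable.add (integrableOn_strip hsN hN 0 T r) ?_) _
        have := integrableOn_strip (N := N) (s := 0) (by positivity) hN 0 T r
        simp only [neg_zero, Real.rpow_zero] at this
        exact this
      refine Integrable.mono' h2 hg2m.aestronglyMeasurable (Eventually.of_forall fun p => ?_)
      exact (norm_indicator_le_norm_self _ _).trans (hgb' p)
    refine (integrableOn_iff_integrable_of_support_subset ?_).2
      ((integrableOn_iff_integrable_of_support_subset ?_).1 h1)
    · intro p hp
      have h3 : p ∈ Om N T := by
        by_contra h
        exact hp (by rw [hg2, Set.indicator_apply_eq_zero]; exact fun _ => hg0 p h)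
      exact ⟨h3.1.1, trivial⟩
    · intro p hp
      have h3 : p ∈ Om N T := by
        by_contra h
        exact hp (by rw [hg2, Set.indicator_apply_eq_zero]; exact fun _ => hg0 p h)
      refine ⟨h3.1, ?_⟩
      have h4 : p ∈ Aᶜ := by
        by_contra h
        exact hp (by rw [hg2, Set.indicator_of_notMem h])
      simpa [hA] using h4
  have hc2 := Dop_cont_far hg2i hr0 (fun p hp => by
    rw [hg2, Set.indicator_of_notMem (show p ∉ Aᶜ from fun h => h hp)]) (q0 := q0) (by rw [hr]; linarith)
  have hc1 : ContinuousAt (Dop g1) q0 := by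
    refine Dop_cont_bdd hg1m hg1b ?_ q0
    have a1 : ∀ᵐ p : ℝ × Euc N, p.1 ≠ 0 ∧ p.1 ≠ T := by
      have h : {p : ℝ × Euc N | ¬ (p.1 ≠ 0 ∧ p.1 ≠ T)} = ({0, T} : Set ℝ) ×ˢ Set.univ := by
        ext p; simp; tauto
      rw [ae_iff, h, Measure.volume_eq_prod, Measure.prod_prod,
        (Set.toFinite ({0, T} : Set ℝ)).measure_zero]
      simp
    have a2 : ∀ᵐ p : ℝ × Euc N, ‖p.2‖ ≠ r := by
      have h : {p : ℝ × Euc N | ¬ (‖p.2‖ ≠ r)} = Set.univ ×ˢ Metric.sphere 0 r := by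
        ext p; simp
      rw [ae_iff, h, Measure.volume_eq_prod, Measure.prod_prod, Measure.addHaar_sphere]
      simp
    filter_upwards [a1, a2, ae_snd_ne hN] with p h1 h2 h3
    have hzero : (∀ᶠ p' in nhds p, g1 p' = 0) → ContinuousAt ((PosT N).indicator g1) p := by
      intro h
      refine (continuousAt_const (y := (0 : ℝ))).congr ?_
      filter_upwards [h] with p' hp'
      rw [eq_comm, Set.indicator_apply_eq_zero]
      exact fun _ => hp'
    have hzt : ∀ p' : ℝ × Euc N, p' ∉ Om N T → g1 p' = 0 := fun p' h => by
      rw [hg1, Set.indicator_apply_eq_zero]; exact fun _ => hg0 p' h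
    rcases lt_or_gt_of_ne h1.1 with h4 | h4
    · apply hzero
      filter_upwards [(isOpen_lt continuous_fst continuous_const).mem_nhds h4] with p' hp'
      exact hzt p' (fun h => absurd h.1.1 (not_lt.2 (le_of_lt hp')))
    rcases lt_or_gt_of_ne h1.2 with h5 | h5
    swap
    · apply hzero
      filter_upwards [(isOpen_lt continuous_const continuous_fst).mem_nhds h5] with p' hp'
      exact hzt p' (fun h => absurd h.1.2 (not_lt.2 (le_of_lt hp')))
    rcases lt_or_gt_of_ne h2 with h6 | h6
    · apply hzero
      filter_upwards [(isOpen_lt continuous_snd.norm continuous_const).mem_nhds h6] with p' hp'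
      rw [hg1, Set.indicator_of_notMem (show p' ∉ A from fun h => absurd hp' (not_lt.2 h))]
    · have hp : p ∈ Om N T := ⟨⟨h4, h5⟩, h3⟩
      refine (hgc.continuousAt (isOpen_Om.mem_nhds hp)).congr ?_
      filter_upwards [isOpen_Om.mem_nhds hp,
        (isOpen_lt continuous_const continuous_snd.norm).mem_nhds h6] with p' hp' hp''
      rw [Set.indicator_of_mem (show p' ∈ PosT N from ⟨hp'.1.1, trivial⟩), hg1,
        Set.indicator_of_mem (show p' ∈ A from le_of_lt hp'')]
  refine (hc1.add hc2.2).congr ?_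
  have hpos : ∀ᶠ q : ℝ × Euc N in nhds q0, 0 < q.1 :=
    (isOpen_lt continuous_const continuous_fst).mem_nhds hq1
  filter_upwards [hc2.1, hpos] with q hq hq0
  have hi1 : IntegrableOn (fun p : ℝ × Euc N => hk (q - p) * g1 p) (PosT N) := by
    have h1 : DLe (fun _ => 1) q _ := Dop_one hq0 q.2
    exact ((h1.const_mul (a := |C| * (r ^ (-s) + 1)) (by positivity)).mono hN
      hg1m.aestronglyMeasurable (fun p _ _ _ => by simpa using hg1b p)).1
  rw [hsum]
  simp only [Dop, mul_add]
  rw [integral_add hi1 hq]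
  rfl



/-- The difference of nonlinearities. -/
def gw {N : ℕ} (α T : ℝ) (U v : ℝ × Euc N → ℝ) : ℝ × Euc N → ℝ :=
  (Om N T).indicator (fun p => Fnl α (U p + v p) - Fnl α (U p))

lemma measurableSet_Om {N : ℕ} {T : ℝ} : MeasurableSet (Om N T) := isOpen_Om.measurableSet

lemma measurable_indicator_of_continuousOn {N : ℕ} {T : ℝ} {h : ℝ × Euc N → ℝ}
    (hh : ContinuousOn h (Om N T)) : Measurable ((Om N T).indicator h) := by
  classical
  have := ContinuousOn.measurable_piecewise hh (continuousOn_const (c := (0 : ℝ)) (s := (Om N T)ᶜ))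
    measurableSet_Om
  convert this using 1
  ext p
  simp [Set.indicator, Set.piecewise]

lemma gw_measurable {N : ℕ} {α T : ℝ} (hα : 0 < α) {U v : ℝ × Euc N → ℝ}
    (hU : ContinuousOn U (Om N T)) (hv : ContinuousOn v (Om N T)) :
    ContinuousOn (fun p => Fnl α (U p + v p) - Fnl α (U p)) (Om N T) ∧ Measurable (gw α T U v) := by
  have h : ContinuousOn (fun p => Fnl α (U p + v p) - Fnl α (U p)) (Om N T) :=
    ((Fnl_continuous hα).comp_continuousOn (hU.add hv)).sub ((Fnl_continuous hα).comp_continuousOn hU)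
  exact ⟨h, measurable_indicator_of_continuousOn h⟩

lemma gw_of_mem {N : ℕ} {α T : ℝ} {U v : ℝ × Euc N → ℝ} {p : ℝ × Euc N} (hp : p ∈ Om N T) :
    gw α T U v p = Fnl α (U p + v p) - Fnl α (U p) := by
  rw [gw, Set.indicator_of_mem hp]

lemma gw_of_notMem {N : ℕ} {α T : ℝ} {U v : ℝ × Euc N → ℝ} {p : ℝ × Euc N} (hp : p ∉ Om N T) :
    gw α T U v p = 0 := by
  rw [gw, Set.indicator_of_notMem hp]

lemma gw_sub_le {N : ℕ} {α T : ℝ} (hα : 0 < α) {U v v' V : ℝ × Euc N → ℝ} {p : ℝ × Euc N}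
    (hp : p ∈ Om N T) (h : |v p| ≤ V p) (h' : |v' p| ≤ V p) :
    |gw α T U v p - gw α T U v' p| ≤ (α + 1) * (|U p| + V p) ^ α * |v p - v' p| := by
  rw [gw_of_mem hp, gw_of_mem hp]
  have := Fnl_lip hα (a := U p + v p) (b := U p + v' p) (m := |U p| + V p)
    ((abs_add_le _ _).trans (by linarith)) ((abs_add_le _ _).trans (by linarith))
  convert this using 2 <;> ring_nf

lemma gw_le {N : ℕ} {α T : ℝ} (hα : 0 < α) {U v V : ℝ × Euc N → ℝ} {p : ℝ × Euc N}
    (hp : p ∈ Om N T) (h : |v p| ≤ V p) :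
    |gw α T U v p| ≤ (α + 1) * (|U p| + V p) ^ α * |v p| := by
  have := gw_sub_le hα (U := U) (v' := fun _ => 0) hp h (by simpa using (abs_nonneg _).trans h)
  have h0 : gw α T U (fun _ => 0) p = 0 := by rw [gw_of_mem hp]; simp
  simpa [h0] using this

theorem picard {N : ℕ} (hN : 3 ≤ N) {α T θ M s C : ℝ} (hα : 0 < α)
    (hθ0 : 0 ≤ θ) (hθ1 : θ < 1) (hM : M = 1 / (1 - θ)) (hs : 0 < s) (hsN : s < N)
    {U H W P : ℝ × Euc N → ℝ} (hU : ContinuousOn U (Om N T)) (hH : ContinuousOn H (Om N T))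
    (hW : ContinuousOn W (Om N T)) (hHW : ∀ p ∈ Om N T, |H p| ≤ W p)
    (hD : ∀ q ∈ Om N T, DLe ((Om N T).indicator
      (fun p => (α + 1) * (|U p| + M * W p) ^ α * W p)) q (θ * W q))
    (hC : ∀ p ∈ Om N T, (α + 1) * (|U p| + M * W p) ^ α * (M * W p) ≤ C * (‖p.2‖ ^ (-s) + 1))
    (hP0 : ∀ p ∈ Om N T, 0 ≤ P p)
    (hP : ∀ v : ℝ × Euc N → ℝ, ContinuousOn v (Om N T) → (∀ p ∈ Om N T, |v p| ≤ M * W p) →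
      (∀ p ∈ Om N T, |v p| ≤ P p) → ∀ p ∈ Om N T, |H p + Dop (gw α T U v) p| ≤ P p) :
    ∃ w : ℝ × Euc N → ℝ, ContinuousOn w (Om N T) ∧ (∀ p ∈ Om N T, |w p| ≤ M * W p) ∧
      (∀ p ∈ Om N T, |w p| ≤ P p) ∧ ∀ p ∈ Om N T, w p = H p + Dop (gw α T U w) p := by
  have h1θ : 0 < 1 - θ := by linarith
  have hM0 : 0 < M := by rw [hM]; positivity
  have hW0 : ∀ p ∈ Om N T, 0 ≤ W p := fun p hp => (abs_nonneg _).trans (hHW p hp)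
  set Φ : (ℝ × Euc N → ℝ) → (ℝ × Euc N → ℝ) := fun v q => H q + Dop (gw α T U v) q with hΦ
  -- contraction
  have hIntg : ∀ v, ContinuousOn v (Om N T) → (∀ p ∈ Om N T, |v p| ≤ M * W p) → ∀ q ∈ Om N T,
      IntegrableOn (fun p : ℝ × Euc N => hk (q - p) * gw α T U v p) (PosT N) := by
    intro v hv hvW q hq
    refine (((hD q hq).const_mul hM0.le).mono hN (gw_measurable hα hU hv).2.aestronglyMeasurable ?_).1
    intro p hp1 hp2 hp3
    have hp : p ∈ Om N T := ⟨⟨hp1, hp2.trans hq.1.2⟩, hp3⟩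
    rw [Set.indicator_of_mem hp]
    refine (gw_le hα (V := fun p => M * W p) hp (hvW p hp)).trans ?_
    have h2 : 0 ≤ (α + 1) * (|U p| + M * W p) ^ α := by
      have := hW0 p hp
      positivity
    calc _ ≤ (α + 1) * (|U p| + M * W p) ^ α * (M * W p) :=
          mul_le_mul_of_nonneg_left (hvW p hp) h2
      _ = _ := by ring
  have hcontr : ∀ v v' (a : ℝ), 0 ≤ a → ContinuousOn v (Om N T) → ContinuousOn v' (Om N T) →
      (∀ p ∈ Om N T, |v p| ≤ M * W p) → (∀ p ∈ Om N T, |v' p| ≤ M * W p) →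
      (∀ p ∈ Om N T, |v p - v' p| ≤ a * W p) → ∀ q ∈ Om N T, |Φ v q - Φ v' q| ≤ a * θ * W q := by
    intro v v' a ha hv hv' hvW hvW' hvv q hq
    have e : Φ v q - Φ v' q = Dop (fun p => gw α T U v p - gw α T U v' p) q := by
      rw [Dop_sub (hIntg v hv hvW q hq) (hIntg v' hv' hvW' q hq)]
      simp only [hΦ]
      ring
    rw [e, mul_assoc]
    refine (((hD q hq).const_mul ha).mono hN
      ((gw_measurable hα hU hv).2.sub (gw_measurable hα hU hv').2).aestronglyMeasurable ?_).2
    intro p hp1 hp2 hp3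
    have hp : p ∈ Om N T := ⟨⟨hp1, hp2.trans hq.1.2⟩, hp3⟩
    rw [Set.indicator_of_mem hp]
    refine (gw_sub_le hα (V := fun p => M * W p) hp (hvW p hp) (hvW' p hp)).trans ?_
    have h2 : 0 ≤ (α + 1) * (|U p| + M * W p) ^ α := by
      have := hW0 p hp
      positivity
    calc _ ≤ (α + 1) * (|U p| + M * W p) ^ α * (a * W p) :=
          mul_le_mul_of_nonneg_left (hvv p hp) h2
      _ = _ := by ring
  have hΦc : ∀ v, ContinuousOn v (Om N T) → (∀ p ∈ Om N T, |v p| ≤ M * W p) →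
      ContinuousOn (Φ v) (Om N T) := by
    intro v hv hvW
    refine hH.add fun q hq => ContinuousAt.continuousWithinAt ?_
    refine Dop_continuousAt hN hs hsN (C := C) (T := T) (gw_measurable hα hU hv).2
      (fun p hp => gw_of_notMem hp) ?_ ?_ hq.1.1 hq.2
    · exact (gw_measurable hα hU hv).1.congr fun p hp => gw_of_mem hp
    · intro p hp
      refine ((gw_le hα (V := fun p => M * W p) hp (hvW p hp)).trans ?_).trans (hC p hp)
      have h2 : 0 ≤ (α + 1) * (|U p| + M * W p) ^ α := by
        have := hW0 p hp
        positivity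
      exact mul_le_mul_of_nonneg_left (hvW p hp) h2
  set w : ℕ → ℝ × Euc N → ℝ := fun k => Φ^[k] (fun _ => 0) with hw
  have hw0 : w 0 = fun _ => 0 := rfl
  have hws : ∀ k, w (k + 1) = Φ (w k) := fun k => Function.iterate_succ_apply' Φ k _
  have hgeo : ∀ k : ℕ, ∑ i ∈ Finset.range k, θ ^ i ≤ M := by
    intro k
    rw [hM, one_div, ← tsum_geometric_of_lt_one hθ0 hθ1]
    exact (summable_geometric_of_lt_one hθ0 hθ1).sum_le_tsum _ (fun i _ => by positivity)
  -- the invariants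
  have inv : ∀ k : ℕ, ContinuousOn (w k) (Om N T) ∧ ContinuousOn (w (k + 1)) (Om N T) ∧
      (∀ p ∈ Om N T, |w k p| ≤ (∑ i ∈ Finset.range k, θ ^ i) * W p) ∧
      (∀ p ∈ Om N T, |w (k + 1) p - w k p| ≤ θ ^ k * W p) ∧ (∀ p ∈ Om N T, |w k p| ≤ P p) := by
    have up : ∀ k : ℕ, (∀ p ∈ Om N T, |w k p| ≤ (∑ i ∈ Finset.range k, θ ^ i) * W p) →
        ∀ p ∈ Om N T, |w k p| ≤ M * W p := fun k h p hp =>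
      (h p hp).trans (mul_le_mul_of_nonneg_right (hgeo k) (hW0 p hp))
    intro k
    induction k with
    | zero =>
      have c0 : ContinuousOn (w 0) (Om N T) := by rw [hw0]; exact continuousOn_const
      have b0 : ∀ p ∈ Om N T, |w 0 p| ≤ (∑ i ∈ Finset.range 0, θ ^ i) * W p := by
        intro p hp; rw [hw0]; simp
      refine ⟨c0, ?_, b0, ?_, ?_⟩
      · rw [hws]; exact hΦc _ c0 (up 0 b0)
      · intro p hp
        rw [hws, hw0]
        have h0 : gw α T U (fun _ => 0) = fun _ => 0 := by
          ext p
          by_cases hp : p ∈ Om N T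
          · rw [gw_of_mem hp]; simp
          · rw [gw_of_notMem hp]
        simp only [hΦ, h0, Dop, mul_zero, integral_zero, add_zero, sub_zero, pow_zero, one_mul]
        exact hHW p hp
      · intro p hp; rw [hw0]; simpa using hP0 p hp
    | succ k ih =>
      obtain ⟨c0, c1, b0, b1, bP⟩ := ih
      have b0' : ∀ p ∈ Om N T, |w (k + 1) p| ≤ (∑ i ∈ Finset.range (k + 1), θ ^ i) * W p := by
        intro p hp
        rw [Finset.sum_range_succ, add_mul]
        have := abs_add_le (w k p) (w (k + 1) p - w k p)
        rw [add_sub_cancel] at this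
        exact this.trans (add_le_add (b0 p hp) (b1 p hp))
      refine ⟨c1, ?_, b0', ?_, ?_⟩
      · rw [hws]; exact hΦc _ c1 (up _ b0')
      · intro p hp
        have := hcontr _ _ (θ ^ k) (by positivity) c1 c0 (up _ b0') (up _ b0) b1 p hp
        rw [hws (k + 1), hws k, pow_succ]
        rwa [← hws k] at this ⊢
      · rw [hws]; exact hP _ c0 (up _ b0) bP
  have bM : ∀ k, ∀ p ∈ Om N T, |w k p| ≤ M * W p := fun k p hp =>
    ((inv k).2.2.1 p hp).trans (mul_le_mul_of_nonneg_right (hgeo k) (hW0 p hp))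
  have hd : ∀ p ∈ Om N T, ∀ k : ℕ, dist (w k p) (w (k + 1) p) ≤ W p * θ ^ k := by
    intro p hp k
    rw [dist_comm, Real.dist_eq, mul_comm]
    exact (inv k).2.2.2.1 p hp
  have hlim : ∀ p ∈ Om N T, ∃ l, Tendsto (fun k => w k p) atTop (nhds l) := fun p hp =>
    cauchySeq_tendsto_of_complete (cauchySeq_of_le_geometric θ (W p) hθ1 (hd p hp))
  set wl : ℝ × Euc N → ℝ := fun p => limUnder atTop (fun k => w k p) with hwl
  have hwlt : ∀ p ∈ Om N T, Tendsto (fun k => w k p) atTop (nhds (wl p)) := fun p hp =>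
    tendsto_nhds_limUnder (hlim p hp)
  have hrate : ∀ p ∈ Om N T, ∀ k, |w k p - wl p| ≤ M * θ ^ k * W p := by
    intro p hp k
    have := dist_le_of_le_geometric_of_tendsto θ (W p) hθ1 (hd p hp) (hwlt p hp) k
    rw [Real.dist_eq] at this
    refine this.trans (le_of_eq ?_)
    rw [hM]
    field_simp
  have hMW : ∀ p ∈ Om N T, |wl p| ≤ M * W p := fun p hp =>
    le_of_tendsto (hwlt p hp).abs (Eventually.of_forall fun k => bM k p hp)
  have hpow : Tendsto (fun k : ℕ => θ ^ k) atTop (nhds 0) :=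
    tendsto_pow_atTop_nhds_zero_of_lt_one hθ0 hθ1
  have hwc : ContinuousOn wl (Om N T) := by
    have hu : TendstoLocallyUniformlyOn w wl atTop (Om N T) := by
      rw [Metric.tendstoLocallyUniformlyOn_iff]
      intro ε hε q hq
      refine ⟨{p | W p < W q + 1} ∩ Om N T, ?_, ?_⟩
      · refine inter_mem ?_ self_mem_nhdsWithin
        exact (hW q hq).eventually (gt_mem_nhds (by linarith))
      · have h1 : Tendsto (fun k : ℕ => M * θ ^ k * (W q + 1)) atTop (nhds (M * 0 * (W q + 1))) :=
          (hpow.const_mul M).mul_const _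
        rw [mul_zero, zero_mul] at h1
        filter_upwards [h1.eventually (gt_mem_nhds hε)] with k hk p hp
        rw [dist_comm, Real.dist_eq]
        refine lt_of_le_of_lt ((hrate p hp.2 k).trans ?_) hk
        exact mul_le_mul_of_nonneg_left (le_of_lt hp.1) (by positivity)
    exact hu.continuousOn (Eventually.of_forall fun k => (inv k).1).frequently
  refine ⟨wl, hwc, hMW, ?_, ?_⟩
  · exact fun p hp => le_of_tendsto (hwlt p hp).abs (Eventually.of_forall fun k => (inv k).2.2.2.2 p hp)
  · intro p hp
    have h1 : Tendsto (fun k => w (k + 1) p) atTop (nhds (wl p)) :=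
      (hwlt p hp).comp (tendsto_add_atTop_nat 1)
    have h2 : Tendsto (fun k => w (k + 1) p) atTop (nhds (Φ wl p)) := by
      rw [tendsto_iff_dist_tendsto_zero]
      have h3 : Tendsto (fun k : ℕ => M * θ ^ k * θ * W p) atTop (nhds (M * 0 * θ * W p)) :=
        ((hpow.const_mul M).mul_const _).mul_const _
      rw [mul_zero, zero_mul, zero_mul] at h3
      refine squeeze_zero (fun _ => dist_nonneg) (fun k => ?_) h3
      rw [Real.dist_eq, hws]
      exact hcontr _ _ (M * θ ^ k) (by positivity) (inv k).1 hwc (bM k) hMW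
        (fun p hp => hrate p hp k) p hp
    exact tendsto_nhds_unique h1 h2



lemma bound_LA {α σ Kf M0 M : ℝ} (hα : 0 < α) (hσ0 : 0 ≤ σ) (hσ : σ ≤ 2 / α) (hKf : 0 ≤ Kf)
    (hM0 : 0 ≤ M0) (hM : 0 ≤ M) :
    ∃ K : ℝ, 0 ≤ K ∧ ∀ X u Z a : ℝ, 0 < X → |u| ≤ Kf * X ^ (-(2 / α)) → 0 ≤ a → a ≤ 1 →
      0 ≤ Z → Z ≤ M0 →
      (α + 1) * (|u| + M * (a * X ^ (-σ) + Z)) ^ α ≤ K * (X ^ (-2 : ℝ) + 1) := by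
  set K2 := Kf + M * (1 + M0) with hK2
  have hK20 : 0 ≤ K2 := by positivity
  refine ⟨(α + 1) * (2 * K2) ^ α, by positivity, ?_⟩
  intro X u Z a hX hu ha ha1 hZ hZM
  have hXp : 0 < X ^ (-(2 / α)) := by positivity
  have hXs : X ^ (-σ) ≤ X ^ (-(2 / α)) + 1 := by
    rcases le_total X 1 with h | h
    · have := Real.rpow_le_rpow_of_exponent_ge hX h (show -(2 / α) ≤ -σ by linarith)
      linarith
    · have := Real.rpow_le_one_of_one_le_of_nonpos h (show -σ ≤ 0 by linarith)
      linarith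
  have hXs0 : 0 < X ^ (-σ) := by positivity
  have h1 : |u| + M * (a * X ^ (-σ) + Z) ≤ K2 * (X ^ (-(2 / α)) + 1) := by
    have h2 : a * X ^ (-σ) ≤ X ^ (-(2 / α)) + 1 :=
      (mul_le_of_le_one_left hXs0.le ha1).trans hXs
    have h3 : M * (a * X ^ (-σ) + Z) ≤ M * ((X ^ (-(2 / α)) + 1) + M0) :=
      mul_le_mul_of_nonneg_left (by linarith) hM
    have h4 : M * M0 ≤ M * M0 * (X ^ (-(2 / α)) + 1) :=
      le_mul_of_one_le_right (by positivity) (by linarith)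
    rw [hK2]
    nlinarith
  have h5 : K2 * (X ^ (-(2 / α)) + 1) ≤ 2 * K2 * max (X ^ (-(2 / α))) 1 := by
    have := le_max_left (X ^ (-(2 / α))) 1
    have := le_max_right (X ^ (-(2 / α))) 1
    nlinarith
  have h6 : (|u| + M * (a * X ^ (-σ) + Z)) ^ α ≤ (2 * K2) ^ α * (X ^ (-2 : ℝ) + 1) := by
    refine (Real.rpow_le_rpow (by positivity) (h1.trans h5) hα.le).trans ?_
    rw [Real.mul_rpow (by positivity) (by positivity)]
    refine mul_le_mul_of_nonneg_left ?_ (by positivity)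
    rcases max_cases (X ^ (-(2 / α))) 1 with h | h
    · rw [h.1, ← Real.rpow_mul hX.le, show -(2 / α) * α = -2 by field_simp]
      linarith
    · rw [h.1, Real.one_rpow]
      have : 0 < X ^ (-2 : ℝ) := by positivity
      linarith
  calc _ ≤ (α + 1) * ((2 * K2) ^ α * (X ^ (-2 : ℝ) + 1)) :=
        mul_le_mul_of_nonneg_left h6 (by positivity)
    _ = _ := by ring

lemma rpow_add_le {α B L : ℝ} (hα : 0 < α) (hB : 0 < B) (_hL : 0 ≤ L) :
    ∃ K : ℝ, 0 ≤ K ∧ ∀ z, 0 ≤ z → z ≤ L → (B + z) ^ α ≤ B ^ α + K * z := by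
  refine ⟨B ^ α * (α / B * Real.exp (α * (L / B))), by positivity, ?_⟩
  intro z hz hzL
  have e : B + z = B * (1 + z / B) := by field_simp
  rw [e, Real.mul_rpow hB.le (by positivity)]
  have h1 : (1 + z / B) ^ α ≤ Real.exp (α * (z / B)) := by
    rw [mul_comm, Real.exp_mul]
    refine Real.rpow_le_rpow (by positivity) ?_ hα.le
    rw [add_comm]
    exact Real.add_one_le_exp _
  have h2 : ∀ y : ℝ, 0 ≤ y → Real.exp y ≤ 1 + y * Real.exp y := by
    intro y hy
    have := Real.add_one_le_exp (-y)
    rw [Real.exp_neg] at this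
    have h3 := Real.exp_pos y
    have h4 : (-y + 1) * Real.exp y ≤ 1 := by
      calc _ ≤ (Real.exp y)⁻¹ * Real.exp y := mul_le_mul_of_nonneg_right this h3.le
        _ = 1 := by field_simp
    linarith
  have h3 := h2 (α * (z / B)) (by positivity)
  have h4 : Real.exp (α * (z / B)) ≤ Real.exp (α * (L / B)) := by
    apply Real.exp_le_exp.2
    gcongr
  have h5 : α * (z / B) * Real.exp (α * (z / B)) ≤ α * (z / B) * Real.exp (α * (L / B)) := by
    gcongr
  have h6 : (1 + z / B) ^ α ≤ 1 + α * (z / B) * Real.exp (α * (L / B)) := by linarith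
  calc _ ≤ B ^ α * (1 + α * (z / B) * Real.exp (α * (L / B))) := by gcongr
    _ = _ := by ring

lemma bound_LB {α σ ν B β Kf M0 M : ℝ} (hα : 0 < α) (hσ0 : 0 ≤ σ) (hν : 0 < ν)
    (hσ : σ + ν ≤ 2 / α) (hB : 0 < B) (hBβ : B ^ α = β) (hKf : 0 ≤ Kf)
    (hM0 : 0 ≤ M0) (hM : 0 ≤ M) :
    ∃ K : ℝ, 0 ≤ K ∧ ∀ t X u Z a : ℝ, 0 < t → t ≤ 1 → 0 < X → |u| ≤ Kf * X ^ (-(2 / α)) →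
      |X ^ (2 / α) * u - B| ≤ Kf * (X / √t) ^ ν → 0 ≤ a → a ≤ 1 → 0 ≤ Z → Z ≤ M0 →
      (α + 1) * (|u| + M * (a * X ^ (-σ) + Z)) ^ α
        ≤ β * (α + 1) * X ^ (-2 : ℝ) + K * (X ^ (-2 : ℝ) * (X / √t) ^ ν) + K := by
  obtain ⟨K3, hK3, hLA⟩ := bound_LA (M := M) hα hσ0 (show σ ≤ 2 / α by linarith) hKf hM0 hM
  set K1 := Kf + M * (1 + M0) with hK1
  have hK10 : 0 ≤ K1 := by positivity
  obtain ⟨K4, hK4, hadd⟩ := rpow_add_le hα hB hK10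
  have hβ : 0 < β := by rw [← hBβ]; positivity
  refine ⟨K3 + (α + 1) * (K4 * K1), by positivity, ?_⟩
  intro t X u Z a ht ht1 hX hu hu2 ha ha1 hZ hZM
  have hst : 0 < √t := Real.sqrt_pos.2 ht
  have hst1 : √t ≤ 1 := Real.sqrt_le_iff.2 ⟨by norm_num, by simpa using ht1⟩
  have hX2 : 0 < X ^ (-2 : ℝ) := by positivity
  rcases le_total (X / √t) 1 with hr | hr
  · have hXt : X ≤ √t := by rwa [div_le_one hst] at hr
    have hX1 : X ≤ 1 := hXt.trans hst1
    have hXr : X ≤ X / √t := by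
      rw [le_div_iff₀ hst]; exact mul_le_of_le_one_right hX.le hst1
    set r := X / √t with hrdef
    have hr0 : 0 < r := by positivity
    have hXν : X ^ ν ≤ r ^ ν := Real.rpow_le_rpow hX.le hXr hν.le
    have a1 : X ^ (2 / α) ≤ r ^ ν :=
      (Real.rpow_le_rpow_of_exponent_ge hX hX1 (by linarith)).trans hXν
    have a2 : X ^ (2 / α) * X ^ (-σ) ≤ r ^ ν := by
      rw [← Real.rpow_add hX]
      exact (Real.rpow_le_rpow_of_exponent_ge hX hX1 (by linarith)).trans hXν
    have a3 : X ^ (2 / α) * |u| ≤ B + Kf * r ^ ν := by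
      have h := abs_sub_abs_le_abs_sub (X ^ (2 / α) * u) B
      rw [abs_mul, abs_of_pos (show 0 < X ^ (2 / α) by positivity), abs_of_pos hB] at h
      linarith
    have hrν : 0 < r ^ ν := by positivity
    have hrν1 : r ^ ν ≤ 1 := Real.rpow_le_one hr0.le hr hν.le
    have hp0 : 0 < X ^ (2 / α) := by positivity
    have a4 : X ^ (2 / α) * (|u| + M * (a * X ^ (-σ) + Z)) ≤ B + K1 * r ^ ν := by
      have h1 : X ^ (2 / α) * Z ≤ M0 * r ^ ν := by
        calc _ ≤ r ^ ν * M0 := mul_le_mul a1 hZM hZ hrν.le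
          _ = _ := mul_comm _ _
      have h2 : X ^ (2 / α) * (a * X ^ (-σ)) ≤ r ^ ν := by
        calc _ = a * (X ^ (2 / α) * X ^ (-σ)) := by ring
          _ ≤ 1 * (X ^ (2 / α) * X ^ (-σ)) := mul_le_mul_of_nonneg_right ha1 (by positivity)
          _ ≤ _ := by rw [one_mul]; exact a2
      have h3 : M * (X ^ (2 / α) * (a * X ^ (-σ)) + X ^ (2 / α) * Z) ≤ M * (r ^ ν + M0 * r ^ ν) :=
        mul_le_mul_of_nonneg_left (by linarith) hM
      rw [hK1]
      nlinarith
    set V := |u| + M * (a * X ^ (-σ) + Z) with hV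
    have hV0 : 0 ≤ V := by positivity
    have a5 : V ^ α = X ^ (-2 : ℝ) * (X ^ (2 / α) * V) ^ α := by
      rw [Real.mul_rpow hp0.le hV0, ← Real.rpow_mul hX.le, show 2 / α * α = 2 by field_simp,
        ← mul_assoc, ← Real.rpow_add hX]
      norm_num
    have a6 : (X ^ (2 / α) * V) ^ α ≤ β + K4 * (K1 * r ^ ν) := by
      refine (Real.rpow_le_rpow (by positivity) a4 hα.le).trans ?_
      rw [← hBβ]
      exact hadd _ (by positivity) (mul_le_of_le_one_right hK10 hrν1)
    rw [a5]
    calc (α + 1) * (X ^ (-2 : ℝ) * (X ^ (2 / α) * V) ^ α)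
        ≤ (α + 1) * (X ^ (-2 : ℝ) * (β + K4 * (K1 * r ^ ν))) := by gcongr
      _ = β * (α + 1) * X ^ (-2 : ℝ) + ((α + 1) * (K4 * K1)) * (X ^ (-2 : ℝ) * r ^ ν) := by ring
      _ ≤ _ := by
        have : 0 ≤ K3 * (X ^ (-2 : ℝ) * r ^ ν) := by positivity
        have : 0 ≤ K3 + (α + 1) * (K4 * K1) := by positivity
        nlinarith
  · have h := hLA X u Z a hX hu ha ha1 hZ hZM
    have h1 : 1 ≤ (X / √t) ^ ν := Real.one_le_rpow hr hν.le
    have h2 : X ^ (-2 : ℝ) ≤ X ^ (-2 : ℝ) * (X / √t) ^ ν := le_mul_of_one_le_right hX2.le h1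
    have h3 : 0 ≤ (α + 1) * (K4 * K1) := by positivity
    have h4 : 0 ≤ (α + 1) * (K4 * K1) * (X ^ (-2 : ℝ) * (X / √t) ^ ν) := by positivity
    have h5 : 0 ≤ β * (α + 1) * X ^ (-2 : ℝ) := by positivity
    nlinarith

/-- `K X^{-2} (X/√t)^ν ≤ ε X^{-2} + K'/t`. -/
lemma bound_LC {ν K e : ℝ} (hν : 0 < ν) (hν2 : ν ≤ 2) (hK : 0 ≤ K) (he : 0 < e) :
    ∃ K' : ℝ, 0 ≤ K' ∧ ∀ t X : ℝ, 0 < t → 0 < X →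
      K * (X ^ (-2 : ℝ) * (X / √t) ^ ν) ≤ e * X ^ (-2 : ℝ) + K' / t := by
  set r1 := (e / (K + 1)) ^ (1 / ν) with hr1
  have hr10 : 0 < r1 := by positivity
  refine ⟨K * r1 ^ (ν - 2), by positivity, ?_⟩
  intro t X ht hX
  have hst : 0 < √t := Real.sqrt_pos.2 ht
  set r := X / √t with hr
  have hr0 : 0 < r := by positivity
  have hX2 : 0 < X ^ (-2 : ℝ) := by positivity
  rcases le_total r r1 with h | h
  · have h1 : r ^ ν ≤ e / (K + 1) := by
      have := Real.rpow_le_rpow hr0.le h hν.le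
      rwa [hr1, ← Real.rpow_mul (by positivity), one_div_mul_cancel hν.ne', Real.rpow_one] at this
    have h2 : K * r ^ ν ≤ e := by
      rw [le_div_iff₀ (by positivity)] at h1
      have : 0 < r ^ ν := by positivity
      nlinarith
    have h3 : 0 ≤ K * r1 ^ (ν - 2) / t := by positivity
    nlinarith
  · have h1 : X ^ (-2 : ℝ) * r ^ ν = r ^ (ν - 2) / t := by
      have e1 : X = r * √t := by rw [hr]; field_simp
      rw [e1, Real.mul_rpow hr0.le hst.le, Real.rpow_neg hst.le 2, Real.rpow_two, Real.sq_sqrt ht.le,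
        sub_eq_add_neg, Real.rpow_add hr0]
      field_simp
    rw [h1]
    have h2 : r ^ (ν - 2) ≤ r1 ^ (ν - 2) :=
      Real.rpow_le_rpow_of_nonpos hr10 h (by linarith)
    have h3 : K * (r ^ (ν - 2) / t) ≤ K * r1 ^ (ν - 2) / t := by
      rw [mul_div_assoc]; gcongr
    have : 0 ≤ e * X ^ (-2 : ℝ) := by positivity
    linarith



/-- The standing assumptions of the fixed point argument. -/
structure Stp (N : ℕ) (α β η ν B Kf M0 δ : ℝ) (U : ℝ × Euc N → ℝ) (φ : Euc N → ℝ) : Prop where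
  hN : 3 ≤ N
  hα : 0 < α
  hB : 0 < B
  hBβ : B ^ α = β
  hη0 : 0 < η
  hη : η * ((N : ℝ) - 2 - η) = β * (α + 1)
  hν : 0 < ν
  hν2 : ν ≤ 2
  hσn : 2 * (η + ν / 2) < (N : ℝ) - 2
  hνp : η + ν / 2 + ν ≤ 2 / α
  hpn : 2 / α < (N : ℝ) - 2
  hνη : ν / 2 < η
  hKf : 0 ≤ Kf
  hδ : 0 < δ
  hU1 : ∀ p : ℝ × Euc N, 0 < p.1 → p.2 ≠ 0 → |U p| ≤ Kf * ‖p.2‖ ^ (-(2 / α))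
  hU2 : ∀ p : ℝ × Euc N, 0 < p.1 → p.2 ≠ 0 →
    |‖p.2‖ ^ (2 / α) * U p - B| ≤ Kf * (‖p.2‖ / √p.1) ^ ν
  hUc : ∀ T : ℝ, ContinuousOn U (Om N T)
  hφ : Measurable φ
  hφM : ∀ y, |φ y| ≤ M0
  hφ0 : ∀ y, ‖y‖ < δ → φ y = 0

/-- The evolution of the absolute value of the bounded part. -/
def Zf {N : ℕ} (φ : Euc N → ℝ) (p : ℝ × Euc N) : ℝ := Hop (fun y => |φ y|) p

/-- The weight. -/
def Wf {N : ℕ} (k : ℕ) (σ : ℝ) (φ : Euc N → ℝ) (p : ℝ × Euc N) : ℝ :=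
  p.1 ^ (k + 1) * ‖p.2‖ ^ (-σ) + Zf φ p

section
variable {N : ℕ} {α β η ν B Kf M0 δ : ℝ} {U : ℝ × Euc N → ℝ} {φ : Euc N → ℝ}

lemma Stp.M0nn (S : Stp N α β η ν B Kf M0 δ U φ) : 0 ≤ M0 := (abs_nonneg _).trans (S.hφM 0)

lemma Stp.Z0 (_S : Stp N α β η ν B Kf M0 δ U φ) (p : ℝ × Euc N) : 0 ≤ Zf φ p :=
  Hop_nonneg (fun _ => abs_nonneg _) p

lemma Stp.ZM (S : Stp N α β η ν B Kf M0 δ U φ) (p : ℝ × Euc N) (hp : 0 < p.1) : Zf φ p ≤ M0 :=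
  Hop_le (φ := fun y => |φ y|) S.hφ.abs (fun y => by rw [abs_abs]; exact S.hφM y) hp p.2

lemma Stp.Zsmall (S : Stp N α β η ν B Kf M0 δ U φ) (k : ℕ) :
    ∃ C : ℝ, 0 ≤ C ∧ ∀ p : ℝ × Euc N, 0 < p.1 → ‖p.2‖ < δ / 2 → Zf φ p ≤ C * p.1 ^ k := by
  obtain ⟨C, hC, h⟩ := Hop_small (φ := fun y => |φ y|) S.hφ.abs
    (fun y => by rw [abs_abs]; exact S.hφM y) (fun _ => abs_nonneg _) S.hδ
    (fun y hy => by simp [S.hφ0 y hy]) k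
  exact ⟨C, hC, fun p hp hp2 => h p.1 p.2 hp hp2⟩

lemma Stp.Zc (S : Stp N α β η ν B Kf M0 δ U φ) (T : ℝ) : ContinuousOn (Zf φ) (Om N T) :=
  fun _ hq => (Hop_continuousAt (φ := fun y => |φ y|) S.hφ.abs
    (fun y => by rw [abs_abs]; exact S.hφM y) hq.1.1).continuousWithinAt

lemma Stp.Wc (S : Stp N α β η ν B Kf M0 δ U φ) (T : ℝ) (k : ℕ) (σ : ℝ) :
    ContinuousOn (Wf k σ φ) (Om N T) := by
  refine ContinuousOn.add (ContinuousOn.mul (by fun_prop) ?_) (S.Zc T)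
  exact ContinuousOn.rpow_const (by fun_prop) fun p hp => Or.inl (norm_ne_zero_iff.2 hp.2)

set_option maxHeartbeats 1000000 in
lemma Stp.exists_weights (S : Stp N α β η ν B Kf M0 δ U φ) :
    ∃ θ M : ℝ, 0 ≤ θ ∧ θ < 1 ∧ M = 1 / (1 - θ) ∧ ∃ k : ℕ, ∃ T : ℝ, 0 < T ∧ T ≤ 1 ∧ ∃ KZ : ℝ,
      0 ≤ KZ ∧ KZ * T ≤ θ ∧ ∀ q ∈ Om N T, DLe ((Om N T).indicator
        (fun p => (α + 1) * (|U p| + M * Wf k (η + ν / 2) φ p) ^ α * Wf k (η + ν / 2) φ p)) q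
        (θ * (q.1 ^ (k + 1) * ‖q.2‖ ^ (-(η + ν / 2))) + KZ * q.1 * Zf φ q) := by
  have hα := S.hα
  have hη0 := S.hη0
  have hν := S.hν
  have hσn := S.hσn
  have hM00 := S.M0nn
  set σ := η + ν / 2 with hσ
  have hσ0 : 0 < σ := by positivity
  set n := (N : ℝ) - 2 with hn
  have hβ : 0 < β := by rw [← S.hBβ]; have := S.hB; positivity
  set c := β * (α + 1) with hc
  have hc0 : 0 < c := by positivity
  set d := σ * (n - σ) with hd
  have hcd : c < d := by
    have h1 := S.hη
    rw [← hc] at h1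
    rw [← h1, hd, hσ]
    nlinarith
  have hd0 : 0 < d := hc0.trans hcd
  -- contraction constants
  set θ1 := (c + d) / (2 * d) with hθ1
  have hθ11 : θ1 < 1 := by rw [hθ1, div_lt_one (by positivity)]; linarith
  have hθ10 : 0 < θ1 := by positivity
  set θ := (1 + θ1) / 2 with hθ
  have hθ0 : 0 ≤ θ := by positivity
  have hθlt : θ < 1 := by rw [hθ]; linarith
  set M := 1 / (1 - θ) with hM
  have hM0 : 0 ≤ M := by rw [hM]; have : 0 < 1 - θ := by linarith
                         positivity
  obtain ⟨K3, hK3, hLA⟩ := bound_LA (M := M) hα hσ0.le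
    (show σ ≤ 2 / α by have := S.hνp; linarith) S.hKf hM00 hM0
  obtain ⟨K5, hK5, hLB⟩ := bound_LB (M := M) hα hσ0.le hν S.hνp S.hB S.hBβ S.hKf hM00 hM0
  obtain ⟨K6, hK6, hLC⟩ := bound_LC hν S.hν2 hK5 (show 0 < (d - c) / 2 by linarith)
  set K7 := K6 + K5 with hK7
  have hK70 : 0 ≤ K7 := by positivity
  obtain ⟨k, hk⟩ := exists_nat_ge (K7 / ((1 - θ1) / 4))
  have hk' : K7 / ((k : ℝ) + 1) ≤ (1 - θ1) / 4 := by
    have h1 : 0 < (1 - θ1) / 4 := by linarith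
    rw [div_le_iff₀ h1] at hk
    rw [div_le_iff₀ (by positivity)]
    linarith
  obtain ⟨C1, hC1, hZs⟩ := S.Zsmall (k + 2)
  set r0 := min 1 (δ / 2) with hr0
  have hr00 : 0 < r0 := lt_min one_pos (half_pos S.hδ)
  set K8 := K3 * (r0 ^ (-2 : ℝ) + 1) with hK8
  have hK80 : 0 ≤ K8 := by positivity
  set K9 := K3 * C1 with hK9
  have hK90 : 0 ≤ K9 := by positivity
  set T := min 1 (min (θ / (K8 + 1)) ((1 - θ1) / 4 * d / (K9 + 1))) with hT
  have hθpos : 0 < θ := by positivity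
  have hTpos : 0 < T := by
    have : 0 < 1 - θ1 := by linarith
    exact lt_min one_pos (lt_min (by positivity) (by positivity))
  have hT1 : T ≤ 1 := min_le_left _ _
  have hT8 : K8 * T ≤ θ := by
    have : T ≤ θ / (K8 + 1) := (min_le_right _ _).trans (min_le_left _ _)
    rw [le_div_iff₀ (by positivity)] at this
    linarith
  have hT9 : K9 * T / d ≤ (1 - θ1) / 4 := by
    have : T ≤ (1 - θ1) / 4 * d / (K9 + 1) := (min_le_right _ _).trans (min_le_right _ _)
    rw [le_div_iff₀ (by positivity)] at this
    rw [div_le_iff₀ hd0]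
    linarith
  refine ⟨θ, M, hθ0, hθlt, rfl, k, T, hTpos, hT1, K8, hK80, hT8, ?_⟩
  intro q hq
  obtain ⟨⟨hq1, hqT⟩, hq2⟩ := hq
  have D1 := Dop_pow hσ0 (show σ < (N : ℝ) - 2 by linarith) (k + 1) hq1 hq2
  have D2 := Dop_pow2 hσ0 (show σ < (N : ℝ) - 2 by linarith) k hq1 hq2
  have D3 := Dop_Hop (φ := fun y => |φ y|) S.hφ.abs
    (fun y => by rw [abs_abs]; exact S.hφM y) (fun _ => abs_nonneg _) hq1 q.2
  have D4 := Dop_pow hσ0 (show σ < (N : ℝ) - 2 by linarith) (k + 2) hq1 hq2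
  have D := (((DLe.const_mul (a := (c + d) / 2) D1 (by positivity)).add
    (DLe.const_mul (a := K7) D2 hK70)).add (DLe.const_mul (a := K8) D3 hK80)).add
    (DLe.const_mul (a := K9) D4 hK90)
  refine DLe.le (DLe.mono' S.hN D ?_ ?_) ?_
  · refine (measurable_indicator_of_continuousOn ?_).aestronglyMeasurable
    have hW := S.Wc T k σ
    refine (continuousOn_const.mul (ContinuousOn.rpow_const ?_ fun p hp => Or.inr hα.le)).mul hW
    exact (S.hUc T).abs.add (continuousOn_const.mul hW)
  · intro p hp1 hpq hp2
    have hpO : p ∈ Om N T := ⟨⟨hp1, hpq.trans hqT⟩, hp2⟩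
    have hpT : p.1 ≤ 1 := (hpq.trans hqT).le.trans hT1
    rw [Set.indicator_of_mem hpO]
    have hX : 0 < ‖p.2‖ := norm_pos_iff.2 hp2
    have hZ0 := S.Z0 p
    have hW0 : 0 ≤ Wf k σ φ p := by unfold Wf; positivity
    rw [abs_of_nonneg (by positivity)]
    have hm1 : p.1 ^ (k + 1) ≤ 1 := pow_le_one₀ hp1.le hpT
    have A := hLA ‖p.2‖ (U p) (Zf φ p) (p.1 ^ (k + 1)) hX (S.hU1 p hp1 hp2) (by positivity) hm1 hZ0
      (S.ZM p hp1)
    have B := hLB p.1 ‖p.2‖ (U p) (Zf φ p) (p.1 ^ (k + 1)) hp1 hpT hX (S.hU1 p hp1 hp2)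
      (S.hU2 p hp1 hp2) (by positivity) hm1 hZ0 (S.ZM p hp1)
    have Cc := hLC p.1 ‖p.2‖ hp1 hX
    change (α + 1) * (|U p| + M * Wf k σ φ p) ^ α ≤ _ at A B
    set L := (α + 1) * (|U p| + M * Wf k σ φ p) ^ α with hL
    have h5t : K5 ≤ K5 / p.1 := by
      rw [le_div_iff₀ hp1]; exact mul_le_of_le_one_right hK5 hpT
    have hL1 : L ≤ (c + d) / 2 * ‖p.2‖ ^ (-2 : ℝ) + K7 / p.1 := by
      have : K7 / p.1 = K6 / p.1 + K5 / p.1 := by rw [hK7, add_div]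
      rw [this]
      linarith
    have e1 : ‖p.2‖ ^ (-(σ + 2)) = ‖p.2‖ ^ (-2 : ℝ) * ‖p.2‖ ^ (-σ) := by
      rw [← Real.rpow_add hX]; ring_nf
    have hXs : 0 < ‖p.2‖ ^ (-σ) := by positivity
    have hX2 : 0 < ‖p.2‖ ^ (-2 : ℝ) := by positivity
    have P1 : L * (p.1 ^ (k + 1) * ‖p.2‖ ^ (-σ)) ≤
        (c + d) / 2 * (p.1 ^ (k + 1) * ‖p.2‖ ^ (-(σ + 2))) + K7 * (p.1 ^ k * ‖p.2‖ ^ (-σ)) := by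
      refine (mul_le_mul_of_nonneg_right hL1 (by positivity)).trans (le_of_eq ?_)
      have h7 : K7 / p.1 * p.1 = K7 := div_mul_cancel₀ _ hp1.ne'
      rw [e1]
      linear_combination (p.1 ^ k * ‖p.2‖ ^ (-σ)) * h7
    have P2 : L * Zf φ p ≤ K8 * Zf φ p + K9 * (p.1 ^ (k + 2) * ‖p.2‖ ^ (-(σ + 2))) := by
      refine (mul_le_mul_of_nonneg_right A hZ0).trans ?_
      rcases lt_or_ge ‖p.2‖ r0 with h | h
      · have hX1 : ‖p.2‖ ≤ 1 := h.le.trans (min_le_left _ _)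
        have h1 := hZs p hp1 (h.trans_le (min_le_right _ _))
        have h2 : (1 : ℝ) ≤ ‖p.2‖ ^ (-σ) := Real.one_le_rpow_of_pos_of_le_one_of_nonpos hX hX1 (by linarith)
        have h3 : ‖p.2‖ ^ (-2 : ℝ) * Zf φ p ≤ C1 * (p.1 ^ (k + 2) * ‖p.2‖ ^ (-(σ + 2))) := by
          rw [e1]
          calc _ ≤ ‖p.2‖ ^ (-2 : ℝ) * (C1 * p.1 ^ (k + 2)) := by gcongr
            _ ≤ ‖p.2‖ ^ (-2 : ℝ) * (C1 * p.1 ^ (k + 2)) * ‖p.2‖ ^ (-σ) :=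
              le_mul_of_one_le_right (by positivity) h2
            _ = _ := by ring
        have h4 : K3 * Zf φ p ≤ K8 * Zf φ p := by
          refine mul_le_mul_of_nonneg_right ?_ hZ0
          rw [hK8]
          have : 0 ≤ K3 * r0 ^ (-2 : ℝ) := by positivity
          linarith
        have h5 := mul_le_mul_of_nonneg_left h3 hK3
        have h6 : K3 * (‖p.2‖ ^ (-2 : ℝ) + 1) * Zf φ p = K3 * (‖p.2‖ ^ (-2 : ℝ) * Zf φ p) + K3 * Zf φ p := by
          ring
        rw [hK9, h6, mul_assoc K3 C1]
        linarith
      · have h1 : ‖p.2‖ ^ (-2 : ℝ) ≤ r0 ^ (-2 : ℝ) :=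
          Real.rpow_le_rpow_of_nonpos hr00 h (by norm_num)
        have h2 : K3 * (‖p.2‖ ^ (-2 : ℝ) + 1) * Zf φ p ≤ K8 * Zf φ p := by
          rw [hK8]; gcongr
        have : 0 ≤ K9 * (p.1 ^ (k + 2) * ‖p.2‖ ^ (-(σ + 2))) := by positivity
        linarith
    have : L * Wf k σ φ p = L * (p.1 ^ (k + 1) * ‖p.2‖ ^ (-σ)) + L * Zf φ p := by
      unfold Wf; ring
    rw [this]
    unfold Zf at P2 ⊢
    linarith
  · have hXs : 0 < ‖q.2‖ ^ (-σ) := by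
      have : 0 < ‖q.2‖ := norm_pos_iff.2 hq2
      positivity
    set X := ‖q.2‖ ^ (-σ)
    have h1 : (c + d) / 2 * (q.1 ^ (k + 1) * (X / d)) = θ1 * (q.1 ^ (k + 1) * X) := by
      rw [hθ1]; field_simp
    have h2 : K7 * (q.1 ^ (k + 1) / (k + 1) * X) ≤ (1 - θ1) / 4 * (q.1 ^ (k + 1) * X) := by
      calc _ = K7 / (k + 1) * (q.1 ^ (k + 1) * X) := by ring
        _ ≤ _ := by gcongr
    have h3 : K9 * (q.1 ^ (k + 2) * (X / d)) ≤ (1 - θ1) / 4 * (q.1 ^ (k + 1) * X) := by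
      calc _ = K9 * q.1 / d * (q.1 ^ (k + 1) * X) := by ring
        _ ≤ K9 * T / d * (q.1 ^ (k + 1) * X) := by gcongr
        _ ≤ _ := by gcongr
    have h4 : θ * (q.1 ^ (k + 1) * X) = θ1 * (q.1 ^ (k + 1) * X) + (1 - θ1) / 4 * (q.1 ^ (k + 1) * X)
        + (1 - θ1) / 4 * (q.1 ^ (k + 1) * X) := by rw [hθ]; ring
    rw [h1, h4]
    change _ ≤ _ + K8 * q.1 * Hop (fun y => |φ y|) q
    change _ + K8 * (q.1 * Hop (fun y => |φ y|) q) + _ ≤ _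
    linarith

end



lemma hk_rpow' {N : ℕ} {s : ℝ} (hs0 : 0 < s) (hs : s < (N : ℝ) - 2) {q : ℝ × Euc N} (hq : q.2 ≠ 0) :
    Integrable (fun p : ℝ × Euc N => hk (q - p) * ‖p.2‖ ^ (-(s + 2))) ∧
    ∫ p : ℝ × Euc N, hk (q - p) * ‖p.2‖ ^ (-(s + 2))
      = ‖q.2‖ ^ (-s) / (s * ((N : ℝ) - 2 - s)) := by
  obtain ⟨h1, h2⟩ := hk_rpow hs0 hs hq
  refine ⟨(flip_mp q.1).integrable_comp_of_integrable h1, ?_⟩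
  rw [← h2]
  exact (flip_mp q.1).integral_comp (flip_me q.1)
    (fun p : ℝ × Euc N => hk (p.1, q.2 - p.2) * ‖p.2‖ ^ (-(s + 2)))

lemma DLe_full {N : ℕ} (hN : 3 ≤ N) {G : ℝ × Euc N → ℝ} {q : ℝ × Euc N} {b : ℝ}
    (hG : ∀ p : ℝ × Euc N, p.2 ≠ 0 → 0 ≤ G p)
    (hi : Integrable (fun p => hk (q - p) * G p)) (h : ∫ p, hk (q - p) * G p ≤ b) : DLe G q b := by
  refine ⟨hi.integrableOn, le_trans (setIntegral_le_integral hi ?_) h⟩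
  filter_upwards [ae_snd_ne hN] with p hp
  exact mul_nonneg (hk_nonneg _) (hG p hp)

/-- Algebra of the barrier. -/
lemma barrier_alg {M0 C1 C2 c c' A κ X Xg Xt C3 : ℝ} (hc' : 0 < c') (hc : 0 < c)
    (hXg : 1 ≤ Xg) (hM0 : 0 ≤ M0) (hC2 : 0 ≤ C2) (hκ0 : 0 ≤ κ)
    (hκ : M0 + C2 + C1 / c' ≤ κ * ((c / c' - 1) / 2)) (h3 : C3 * Xt ≤ (c / c' - 1) / 2 * Xg) :
    M0 + (c * A * (X / c) + (C1 - c * κ) * (Xg / c') + κ * (C3 * Xt) + C2) ≤ A * X - κ * Xg := by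
  have e1 : c * A * (X / c) = A * X := by field_simp
  have e2 : (C1 - c * κ) * (Xg / c') = C1 / c' * Xg - κ * (c / c') * Xg := by field_simp
  have h4 : M0 ≤ M0 * Xg := le_mul_of_one_le_right hM0 hXg
  have h5 : C2 ≤ C2 * Xg := le_mul_of_one_le_right hC2 hXg
  have h6 := mul_le_mul_of_nonneg_right hκ (show 0 ≤ Xg by linarith)
  have h7 := mul_le_mul_of_nonneg_left h3 hκ0
  rw [e1, e2]
  linarith

section
variable {N : ℕ} {α β η ν B Kf M0 δ : ℝ} {U : ℝ × Euc N → ℝ} {φ : Euc N → ℝ}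

lemma Stp.HM (S : Stp N α β η ν B Kf M0 δ U φ) (p : ℝ × Euc N) (hp : 0 < p.1) :
    |Hop φ p| ≤ M0 := (Hop_abs_le φ p).trans (S.ZM p hp)

/-- Pointwise bounds on the difference of the nonlinearities. -/
lemma Stp.gw_bounds (S : Stp N α β η ν B Kf M0 δ U φ) {M T : ℝ} (hM : 0 ≤ M) (k : ℕ)
    (hT1 : T ≤ 1) :
    ∃ C : ℝ, 0 ≤ C ∧ (∀ p ∈ Om N T,
      (α + 1) * (|U p| + M * Wf k (η + ν / 2) φ p) ^ α ≤ C * (‖p.2‖ ^ (-2 : ℝ) + 1)) ∧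
      (∀ p ∈ Om N T, ‖p.2‖ < min 1 (δ / 2) →
      ∀ z : ℝ, 0 ≤ z → z ≤ M * Wf k (η + ν / 2) φ p →
      (α + 1) * (|U p| + M * Wf k (η + ν / 2) φ p) ^ α * z
        ≤ β * (α + 1) * (‖p.2‖ ^ (-2 : ℝ) * z) + C * ‖p.2‖ ^ (-(η - ν / 2 + 2))) := by
  have hα := S.hα
  have hη0 := S.hη0
  have hν := S.hν
  have hM00 := S.M0nn
  set σ := η + ν / 2 with hσ
  have hσ0 : 0 < σ := by positivity
  obtain ⟨K3, hK3, hLA⟩ := bound_LA (M := M) hα hσ0.le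
    (show σ ≤ 2 / α by have := S.hνp; linarith) S.hKf hM00 hM
  obtain ⟨K5, hK5, hLB⟩ := bound_LB (M := M) hα hσ0.le hν S.hνp S.hB S.hBβ S.hKf hM00 hM
  obtain ⟨C1, hC1, hZs⟩ := S.Zsmall 1
  refine ⟨max K3 (2 * (K5 * (M * (1 + C1)))), hK3.trans (le_max_left _ _), ?_, ?_⟩
  · intro p hp
    obtain ⟨⟨hp1, hpT⟩, hp2⟩ := hp
    have hpT : p.1 ≤ 1 := hpT.le.trans hT1
    have hX : 0 < ‖p.2‖ := norm_pos_iff.2 hp2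
    have A := hLA ‖p.2‖ (U p) (Zf φ p) (p.1 ^ (k + 1)) hX (S.hU1 p hp1 hp2) (by positivity)
      (pow_le_one₀ hp1.le hpT) (S.Z0 p) (S.ZM p hp1)
    refine le_trans A ?_
    gcongr
    exact le_max_left _ _
  · intro p hp hr z hz hzM
    obtain ⟨⟨hp1, hpT⟩, hp2⟩ := hp
    have hpT : p.1 ≤ 1 := hpT.le.trans hT1
    have hX : 0 < ‖p.2‖ := norm_pos_iff.2 hp2
    have hX1 : ‖p.2‖ ≤ 1 := hr.le.trans (min_le_left _ _)
    have B := hLB p.1 ‖p.2‖ (U p) (Zf φ p) (p.1 ^ (k + 1)) hp1 hpT hX (S.hU1 p hp1 hp2)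
      (S.hU2 p hp1 hp2) (by positivity) (pow_le_one₀ hp1.le hpT) (S.Z0 p) (S.ZM p hp1)
    change (α + 1) * (|U p| + M * Wf k σ φ p) ^ α ≤ _ at B
    have hXs : (1 : ℝ) ≤ ‖p.2‖ ^ (-σ) :=
      Real.one_le_rpow_of_pos_of_le_one_of_nonpos hX hX1 (by linarith)
    have hZ1 := hZs p hp1 (hr.trans_le (min_le_right _ _))
    rw [pow_one] at hZ1
    have hW : Wf k σ φ p ≤ (1 + C1) * p.1 * ‖p.2‖ ^ (-σ) := by
      have h1 : p.1 ^ (k + 1) ≤ p.1 := pow_le_of_le_one hp1.le hpT (by omega)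
      have h2 : p.1 ^ (k + 1) * ‖p.2‖ ^ (-σ) ≤ p.1 * ‖p.2‖ ^ (-σ) := by gcongr
      have h3 : C1 * p.1 ≤ C1 * p.1 * ‖p.2‖ ^ (-σ) := le_mul_of_one_le_right (by positivity) hXs
      unfold Wf
      linarith
    have hz1 : z ≤ M * (1 + C1) * (p.1 * ‖p.2‖ ^ (-σ)) := by
      calc z ≤ _ := hzM
        _ ≤ M * ((1 + C1) * p.1 * ‖p.2‖ ^ (-σ)) := by gcongr
        _ = _ := by ring
    -- the two error terms
    have hst : 0 < √p.1 := Real.sqrt_pos.2 hp1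
    have e1 : ‖p.2‖ ^ (-2 : ℝ) * (‖p.2‖ / √p.1) ^ ν * (p.1 * ‖p.2‖ ^ (-σ))
        ≤ ‖p.2‖ ^ (-(η - ν / 2 + 2)) := by
      have h1 : p.1 ≤ (√p.1) ^ ν := by
        have : (√p.1) ^ (2 : ℝ) ≤ (√p.1) ^ ν :=
          Real.rpow_le_rpow_of_exponent_ge hst (Real.sqrt_le_iff.2 ⟨by norm_num, by simpa using hpT⟩)
            S.hν2
        rwa [Real.rpow_two, Real.sq_sqrt hp1.le] at this
      have h2 : ‖p.2‖ ^ (-(η - ν / 2 + 2)) = ‖p.2‖ ^ (-2 : ℝ) * ‖p.2‖ ^ ν * ‖p.2‖ ^ (-σ) := by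
        rw [← Real.rpow_add hX, ← Real.rpow_add hX, hσ]; congr 1; ring
      rw [h2, Real.div_rpow hX.le hst.le]
      have h3 : p.1 / (√p.1) ^ ν ≤ 1 := by rw [div_le_one (by positivity)]; exact h1
      calc _ = (‖p.2‖ ^ (-2 : ℝ) * ‖p.2‖ ^ ν * ‖p.2‖ ^ (-σ)) * (p.1 / (√p.1) ^ ν) := by ring
        _ ≤ _ := mul_le_of_le_one_right (by positivity) h3
    have e2 : p.1 * ‖p.2‖ ^ (-σ) ≤ ‖p.2‖ ^ (-(η - ν / 2 + 2)) := by
      refine (mul_le_of_le_one_left (by positivity) hpT).trans ?_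
      refine Real.rpow_le_rpow_of_exponent_ge hX hX1 ?_
      rw [hσ]; have := S.hν2; linarith
    have hX2 : 0 < ‖p.2‖ ^ (-2 : ℝ) := by positivity
    set R := ‖p.2‖ ^ (-2 : ℝ) * (‖p.2‖ / √p.1) ^ ν with hR
    have hR0 : 0 ≤ R := by positivity
    have e3 : R * z ≤ M * (1 + C1) * ‖p.2‖ ^ (-(η - ν / 2 + 2)) := by
      calc R * z ≤ R * (M * (1 + C1) * (p.1 * ‖p.2‖ ^ (-σ))) := by gcongr
        _ = M * (1 + C1) * (R * (p.1 * ‖p.2‖ ^ (-σ))) := by ring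
        _ ≤ _ := by gcongr
    have e4 : z ≤ M * (1 + C1) * ‖p.2‖ ^ (-(η - ν / 2 + 2)) := hz1.trans (by gcongr)
    have h5 := mul_le_mul_of_nonneg_right B hz
    have h6 := mul_le_mul_of_nonneg_left e3 hK5
    have h7 := mul_le_mul_of_nonneg_left e4 hK5
    have h8 : 2 * (K5 * (M * (1 + C1))) * ‖p.2‖ ^ (-(η - ν / 2 + 2))
        ≤ max K3 (2 * (K5 * (M * (1 + C1)))) * ‖p.2‖ ^ (-(η - ν / 2 + 2)) := by
      gcongr
      exact le_max_right _ _
    have h9 : (β * (α + 1) * ‖p.2‖ ^ (-2 : ℝ) + K5 * R + K5) * z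
      = β * (α + 1) * (‖p.2‖ ^ (-2 : ℝ) * z) + K5 * (R * z) + K5 * z := by ring
    linarith

set_option maxHeartbeats 1000000 in
lemma Stp.barrier (S : Stp N α β η ν B Kf M0 δ U φ) {M T : ℝ} (hM : 0 ≤ M) (k : ℕ) (hT1 : T ≤ 1) :
    ∃ r0 ρ κ : ℝ, 0 < ρ ∧ ρ ≤ r0 ∧ r0 ≤ 1 ∧ 0 ≤ κ ∧ ∀ A, κ ≤ A → ∀ v : ℝ × Euc N → ℝ,
      ContinuousOn v (Om N T) → (∀ p ∈ Om N T, |v p| ≤ M * Wf k (η + ν / 2) φ p) →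
      (∀ p ∈ Om N T, ‖p.2‖ < r0 → |v p| ≤ A * ‖p.2‖ ^ (-η) - κ * ‖p.2‖ ^ (-(η - ν / 2))) →
      ∀ q ∈ Om N T, ‖q.2‖ < ρ → |Hop φ q + Dop (gw α T U v) q|
        ≤ A * ‖q.2‖ ^ (-η) - κ * ‖q.2‖ ^ (-(η - ν / 2)) := by
  have hα := S.hα
  have hη0 := S.hη0
  have hν := S.hν
  have hνη := S.hνη
  have hσn := S.hσn
  have hM00 := S.M0nn
  obtain ⟨C1, hC1, hb1, hb2⟩ := S.gw_bounds hM k hT1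
  have hβ : 0 < β := by rw [← S.hBβ]; have := S.hB; positivity
  set c := β * (α + 1) with hc
  have hc0 : 0 < c := by positivity
  set σ := η + ν / 2 with hσ
  have hσ0 : 0 < σ := by positivity
  set γ := η - ν / 2 with hγ
  have hγ0 : 0 < γ := by linarith
  set c' := γ * ((N : ℝ) - 2 - γ) with hc'
  have hc'0 : 0 < c' := mul_pos hγ0 (by linarith)
  have hcc : c' < c := by
    have h1 := S.hη
    rw [← hc] at h1
    rw [← h1, hc']
    nlinarith
  set τ := γ / 2 with hτ
  have hτ0 : 0 < τ := by positivity
  set r0 := min 1 (δ / 2) with hr0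
  have hr00 : 0 < r0 := lt_min one_pos (half_pos S.hδ)
  have hr01 : r0 ≤ 1 := min_le_left _ _
  set C2 := C1 * (r0 ^ (-2 : ℝ) + 1) * (M * (r0 ^ (-σ) + M0)) with hC2
  have hC20 : 0 ≤ C2 := by positivity
  set b := c * r0 ^ (-(γ - τ)) with hb
  have hb0 : 0 < b := by positivity
  have hτn : 0 < τ * ((N : ℝ) - 2 - τ) := mul_pos hτ0 (by linarith)
  set C3 := b / (τ * ((N : ℝ) - 2 - τ)) with hC3
  have hC30 : 0 < C3 := by positivity
  set d := (c / c' - 1) / 2 with hd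
  have hd0 : 0 < d := by
    have : 1 < c / c' := by rwa [one_lt_div hc'0]
    rw [hd]; linarith
  set κ := (M0 + C2 + C1 / c') / d with hκ
  have hκ0 : 0 ≤ κ := by positivity
  set ρ := min r0 ((d / C3) ^ (1 / (γ - τ))) with hρ
  have hγτ : 0 < γ - τ := by rw [hτ]; linarith
  refine ⟨r0, ρ, κ, lt_min hr00 (by positivity), min_le_left _ _, hr01, hκ0, ?_⟩
  intro A hA v hvc hvM hvA q hq hqρ
  obtain ⟨⟨hq1, hqT⟩, hq2⟩ := hq
  have hA0 : 0 ≤ A := hκ0.trans hA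
  have I1 := hk_rpow' (q := q) hη0 (show η < (N : ℝ) - 2 by linarith) hq2
  have I2 := hk_rpow' (q := q) hγ0 (show γ < (N : ℝ) - 2 by linarith) hq2
  have I3 := hk_rpow' (q := q) hτ0 (show τ < (N : ℝ) - 2 by linarith) hq2
  rw [S.hη, ← hc] at I1
  set G1 : ℝ × Euc N → ℝ := fun p => c * A * ‖p.2‖ ^ (-(η + 2)) + (C1 - c * κ) * ‖p.2‖ ^ (-(γ + 2))
    + κ * b * ‖p.2‖ ^ (-(τ + 2)) with hG1
  have eG : (fun p : ℝ × Euc N => hk (q - p) * G1 p) = fun p =>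
      c * A * (hk (q - p) * ‖p.2‖ ^ (-(η + 2))) + (C1 - c * κ) * (hk (q - p) * ‖p.2‖ ^ (-(γ + 2)))
      + κ * b * (hk (q - p) * ‖p.2‖ ^ (-(τ + 2))) := by
    ext p; rw [hG1]; ring
  -- splitting of powers
  have split : ∀ (X s : ℝ), 0 < X → X ^ (-(s + 2)) = X ^ (-2 : ℝ) * X ^ (-s) := by
    intro X s hX
    rw [← Real.rpow_add hX]; congr 1; ring
  have hG1s : ∀ p : ℝ × Euc N, p.2 ≠ 0 → G1 p = ‖p.2‖ ^ (-2 : ℝ) * (c * (A * ‖p.2‖ ^ (-η)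
      - κ * ‖p.2‖ ^ (-γ)) + C1 * ‖p.2‖ ^ (-γ) + κ * b * ‖p.2‖ ^ (-τ)) := by
    intro p hp
    have hX : 0 < ‖p.2‖ := norm_pos_iff.2 hp
    simp only [hG1, split _ _ hX]
    ring
  have hbig : ∀ p : ℝ × Euc N, p.2 ≠ 0 → r0 ≤ ‖p.2‖ → 0 ≤ G1 p := by
    intro p hp hpr
    have hX : 0 < ‖p.2‖ := norm_pos_iff.2 hp
    rw [hG1s p hp]
    refine mul_nonneg (by positivity) ?_
    have h1 : ‖p.2‖ ^ (-γ) ≤ r0 ^ (-(γ - τ)) * ‖p.2‖ ^ (-τ) := by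
      have : ‖p.2‖ ^ (-γ) = ‖p.2‖ ^ (-(γ - τ)) * ‖p.2‖ ^ (-τ) := by
        rw [← Real.rpow_add hX]; congr 1; ring
      rw [this]
      refine mul_le_mul_of_nonneg_right ?_ (by positivity)
      exact Real.rpow_le_rpow_of_nonpos hr00 hpr (by linarith)
    have h2 := mul_le_mul_of_nonneg_left h1 (show 0 ≤ c * κ by positivity)
    have h3 : 0 ≤ c * (A * ‖p.2‖ ^ (-η)) := by positivity
    have h4 : 0 ≤ C1 * ‖p.2‖ ^ (-γ) := by positivity
    have h5 : κ * b * ‖p.2‖ ^ (-τ) = c * κ * (r0 ^ (-(γ - τ)) * ‖p.2‖ ^ (-τ)) := by rw [hb]; ring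
    rw [h5]
    linarith
  have hG1n : ∀ p : ℝ × Euc N, p.2 ≠ 0 → 0 ≤ G1 p := by
    intro p hp
    rcases lt_or_ge ‖p.2‖ r0 with h | h
    · have hX : 0 < ‖p.2‖ := norm_pos_iff.2 hp
      rw [hG1s p hp]
      refine mul_nonneg (by positivity) ?_
      have h1 : ‖p.2‖ ^ (-γ) ≤ ‖p.2‖ ^ (-η) :=
        Real.rpow_le_rpow_of_exponent_ge hX (h.le.trans hr01) (by linarith)
      have h2 : κ * ‖p.2‖ ^ (-γ) ≤ A * ‖p.2‖ ^ (-η) := mul_le_mul hA h1 (by positivity) hA0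
      have h3 : 0 ≤ c * (A * ‖p.2‖ ^ (-η) - κ * ‖p.2‖ ^ (-γ)) := mul_nonneg hc0.le (by linarith)
      positivity
    · exact hbig p hp h
  have D1 : DLe G1 q (c * A * (‖q.2‖ ^ (-η) / c) + (C1 - c * κ) * (‖q.2‖ ^ (-γ) / c')
      + κ * b * (‖q.2‖ ^ (-τ) / (τ * ((N : ℝ) - 2 - τ)))) := by
    refine DLe_full S.hN hG1n ?_ ?_
    · rw [eG]
      exact ((I1.1.const_mul _).add (I2.1.const_mul _)).add (I3.1.const_mul _)
    · rw [eG]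
      have i12 : Integrable (fun p : ℝ × Euc N => c * A * (hk (q - p) * ‖p.2‖ ^ (-(η + 2)))
          + (C1 - c * κ) * (hk (q - p) * ‖p.2‖ ^ (-(γ + 2)))) :=
        (I1.1.const_mul _).add (I2.1.const_mul _)
      rw [integral_add i12 (I3.1.const_mul _),
        integral_add (I1.1.const_mul _) (I2.1.const_mul _), integral_const_mul, integral_const_mul,
        integral_const_mul, I1.2, I2.2, I3.2]
  have D2 : DLe (fun _ : ℝ × Euc N => C2 * 1) q (C2 * q.1) :=
    DLe.const_mul (G := fun _ => 1) (Dop_one hq1 q.2) hC20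
  have D := (D1.add D2).mono S.hN (g := gw α T U v)
    (gw_measurable hα (S.hUc T) hvc).2.aestronglyMeasurable (by
      intro p hp1 hpq hp2
      have hpO : p ∈ Om N T := ⟨⟨hp1, hpq.trans hqT⟩, hp2⟩
      have hX : 0 < ‖p.2‖ := norm_pos_iff.2 hp2
      have hg := gw_le hα (U := U) (v := v) (V := fun p => M * Wf k σ φ p) hpO (hvM p hpO)
      refine hg.trans ?_
      rcases lt_or_ge ‖p.2‖ r0 with h | h
      · refine (hb2 p hpO h _ (abs_nonneg _) (hvM p hpO)).trans ?_
        rw [hG1s p hp2, split _ _ hX]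
        have h1 := mul_le_mul_of_nonneg_left (hvA p hpO h)
          (show 0 ≤ c * ‖p.2‖ ^ (-2 : ℝ) by positivity)
        have h2 : 0 ≤ ‖p.2‖ ^ (-2 : ℝ) * (κ * b * ‖p.2‖ ^ (-τ)) := by positivity
        linarith
      · have h1 := hbig p hp2 h
        have h2 : ‖p.2‖ ^ (-2 : ℝ) ≤ r0 ^ (-2 : ℝ) :=
          Real.rpow_le_rpow_of_nonpos hr00 h (by norm_num)
        have h3 : ‖p.2‖ ^ (-σ) ≤ r0 ^ (-σ) :=
          Real.rpow_le_rpow_of_nonpos hr00 h (by linarith)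
        have hp11 : p.1 ≤ 1 := (hpq.trans hqT).le.trans hT1
        have h4 : Wf k σ φ p ≤ r0 ^ (-σ) + M0 := by
          unfold Wf
          refine add_le_add ?_ (S.ZM p hp1)
          exact (mul_le_of_le_one_left (by positivity) (pow_le_one₀ hp1.le hp11)).trans h3
        have h5 : (α + 1) * (|U p| + M * Wf k σ φ p) ^ α * |v p| ≤ C2 := by
          rw [hC2]
          refine mul_le_mul ((hb1 p hpO).trans (by gcongr)) ((hvM p hpO).trans (by gcongr))
            (abs_nonneg _) (by positivity)
        linarith)
  have hX : 0 < ‖q.2‖ := norm_pos_iff.2 hq2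
  have hqr : ‖q.2‖ ≤ 1 := (hqρ.trans_le (min_le_left _ _)).le.trans hr01
  refine (abs_add_le _ _).trans ((add_le_add (S.HM q hq1) D.2).trans ?_)
  have hq11 : q.1 ≤ 1 := hqT.le.trans hT1
  have hXg1 : (1 : ℝ) ≤ ‖q.2‖ ^ (-γ) :=
    Real.one_le_rpow_of_pos_of_le_one_of_nonpos hX hqr (by linarith)
  have h3 : C3 * ‖q.2‖ ^ (-τ) ≤ (c / c' - 1) / 2 * ‖q.2‖ ^ (-γ) := by
    have h1 : ‖q.2‖ ^ (γ - τ) ≤ d / C3 := by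
      have := Real.rpow_le_rpow hX.le (hqρ.le.trans (min_le_right _ _)) hγτ.le
      rwa [← Real.rpow_mul (by positivity), one_div_mul_cancel hγτ.ne', Real.rpow_one] at this
    have h2 : ‖q.2‖ ^ (-τ) = ‖q.2‖ ^ (γ - τ) * ‖q.2‖ ^ (-γ) := by
      rw [← Real.rpow_add hX]; congr 1; ring
    rw [le_div_iff₀ hC30] at h1
    rw [h2, ← hd]
    calc _ = ‖q.2‖ ^ (γ - τ) * C3 * ‖q.2‖ ^ (-γ) := by ring
      _ ≤ _ := by gcongr
  have hfin := barrier_alg (A := A) (X := ‖q.2‖ ^ (-η)) (C1 := C1) hc'0 hc0 hXg1 hM00 hC20 hκ0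
    (by rw [hκ, ← hd, div_mul_cancel₀ _ hd0.ne']) h3
  refine le_trans ?_ hfin
  have h4 : κ * b * (‖q.2‖ ^ (-τ) / (τ * ((N : ℝ) - 2 - τ))) = κ * (C3 * ‖q.2‖ ^ (-τ)) := by
    rw [hC3]; ring
  have h5 : C2 * q.1 ≤ C2 := mul_le_of_le_one_right hC20 hq11
  rw [h4]
  linarith

end



section
variable {N : ℕ} {α β η ν B Kf M0 δ : ℝ} {U : ℝ × Euc N → ℝ} {φ : Euc N → ℝ}

lemma prod_pow_le {X σ M0 : ℝ} (hX : 0 < X) (hσ : 0 < σ) (hM0 : 0 ≤ M0) :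
    (X ^ (-2 : ℝ) + 1) * (X ^ (-σ) + M0) ≤ 4 * (1 + M0) * (X ^ (-(σ + 2)) + 1) := by
  have e : X ^ (-(σ + 2)) = X ^ (-2 : ℝ) * X ^ (-σ) := by
    rw [← Real.rpow_add hX]; congr 1; ring
  have h1 : 0 < X ^ (-2 : ℝ) := by positivity
  have h2 : 0 < X ^ (-σ) := by positivity
  rw [e]
  set a := X ^ (-2 : ℝ) with ha
  set b := X ^ (-σ) with hb
  have hbM : b + M0 ≤ (1 + M0) * (b + 1) := by nlinarith
  have h3 : (a + 1) * (b + 1) ≤ 4 * (a * b + 1) := by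
    rcases le_total X 1 with h | h
    · have h4 : 1 ≤ a := Real.one_le_rpow_of_pos_of_le_one_of_nonpos hX h (by norm_num)
      have h5 : 1 ≤ b := Real.one_le_rpow_of_pos_of_le_one_of_nonpos hX h (by linarith)
      nlinarith
    · have h4 : a ≤ 1 := Real.rpow_le_one_of_one_le_of_nonpos h (by norm_num)
      have h5 : b ≤ 1 := Real.rpow_le_one_of_one_le_of_nonpos h (by linarith)
      nlinarith
  calc (a + 1) * (b + M0) ≤ (a + 1) * ((1 + M0) * (b + 1)) := by gcongr
    _ = (1 + M0) * ((a + 1) * (b + 1)) := by ring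
    _ ≤ (1 + M0) * (4 * (a * b + 1)) := by gcongr
    _ = _ := by ring

set_option maxHeartbeats 1000000 in
theorem Stp.solve (S : Stp N α β η ν B Kf M0 δ U φ) :
    ∃ T : ℝ, 0 < T ∧ T ≤ 1 ∧ ∃ C : ℝ, 0 ≤ C ∧ ∃ w : ℝ × Euc N → ℝ, ContinuousOn w (Om N T) ∧
      (∀ p ∈ Om N T, w p = Hop φ p + Dop (gw α T U w) p) ∧
      (∀ p ∈ Om N T, |w p| ≤ C * (1 + ‖p.2‖ ^ (-η))) ∧
      (∀ p ∈ Om N T, |Dop (gw α T U w) p| ≤ C * p.1 * (1 + ‖p.2‖ ^ (-(η + ν / 2)))) ∧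
      (∀ p ∈ Om N T, |gw α T U w p| ≤ C * (‖p.2‖ ^ (-(η + ν / 2 + 2)) + 1)) := by
  obtain ⟨θ, M, hθ0, hθ1, hM, k, T, hT0, hT1, KZ, hKZ, hKZT, hD⟩ := S.exists_weights
  have hα := S.hα
  have hη0 := S.hη0
  have hν := S.hν
  have hνη := S.hνη
  have hσn := S.hσn
  have hM00 := S.M0nn
  have hMpos : 0 < M := by rw [hM]; have : 0 < 1 - θ := by linarith
                           positivity
  have hMθ : 1 + M * θ = M := by
    rw [hM]; have : 1 - θ ≠ 0 := by linarith
    field_simp; ring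
  obtain ⟨C1, hC1, hb1, -⟩ := S.gw_bounds hMpos.le k hT1
  obtain ⟨r0, ρ, κ, hρ0, hρr, hr01, hκ0, hbar⟩ := S.barrier hMpos.le k hT1
  set σ := η + ν / 2 with hσ
  have hσ0 : 0 < σ := by positivity
  have hr00 : 0 < r0 := hρ0.trans_le hρr
  have hWle : ∀ p ∈ Om N T, Wf k σ φ p ≤ ‖p.2‖ ^ (-σ) + M0 := by
    intro p hp
    refine add_le_add ?_ (S.ZM p hp.1.1)
    exact mul_le_of_le_one_left (by positivity) (pow_le_one₀ hp.1.1.le (hp.1.2.le.trans hT1))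
  have hW0 : ∀ p ∈ Om N T, 0 ≤ Wf k σ φ p := by
    intro p hp
    have := S.Z0 p
    have := hp.1.1
    unfold Wf; positivity
  have hHc : ContinuousOn (Hop φ) (Om N T) := fun q hq =>
    (Hop_continuousAt S.hφ S.hφM hq.1.1).continuousWithinAt
  have hHW : ∀ p ∈ Om N T, |Hop φ p| ≤ Wf k σ φ p := by
    intro p hp
    refine (Hop_abs_le φ p).trans ?_
    have := hp.1.1
    have h : 0 ≤ p.1 ^ (k + 1) * ‖p.2‖ ^ (-σ) := by positivity
    unfold Wf Zf
    linarith
  have hD' : ∀ q ∈ Om N T, DLe ((Om N T).indicator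
      (fun p => (α + 1) * (|U p| + M * Wf k σ φ p) ^ α * Wf k σ φ p)) q (θ * Wf k σ φ q) := by
    intro q hq
    refine (hD q hq).le ?_
    have h1 : KZ * q.1 ≤ θ := (mul_le_mul_of_nonneg_left hq.1.2.le hKZ).trans hKZT
    have h2 := mul_le_mul_of_nonneg_right h1 (S.Z0 q)
    unfold Wf
    linarith
  set Cg := C1 * (M * (4 * (1 + M0))) with hCg
  have hCg0 : 0 ≤ Cg := by positivity
  have hC : ∀ p ∈ Om N T, (α + 1) * (|U p| + M * Wf k σ φ p) ^ α * (M * Wf k σ φ p)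
      ≤ Cg * (‖p.2‖ ^ (-(σ + 2)) + 1) := by
    intro p hp
    have hX : 0 < ‖p.2‖ := norm_pos_iff.2 hp.2
    calc _ ≤ C1 * (‖p.2‖ ^ (-2 : ℝ) + 1) * (M * (‖p.2‖ ^ (-σ) + M0)) := by
          have := hW0 p hp
          have := hWle p hp
          have := hb1 p hp
          gcongr
      _ = C1 * M * ((‖p.2‖ ^ (-2 : ℝ) + 1) * (‖p.2‖ ^ (-σ) + M0)) := by ring
      _ ≤ C1 * M * (4 * (1 + M0) * (‖p.2‖ ^ (-(σ + 2)) + 1)) := by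
          have := prod_pow_le hX hσ0 hM00
          gcongr
      _ = _ := by rw [hCg]; ring
  -- the basic estimate of the Duhamel term
  have hDop : ∀ v : ℝ × Euc N → ℝ, ContinuousOn v (Om N T) → (∀ p ∈ Om N T, |v p| ≤ M * Wf k σ φ p) →
      ∀ q ∈ Om N T, ∀ b, DLe ((Om N T).indicator
      (fun p => (α + 1) * (|U p| + M * Wf k σ φ p) ^ α * Wf k σ φ p)) q b →
      |Dop (gw α T U v) q| ≤ M * b := by
    intro v hv hvM q hq b hb
    refine ((hb.const_mul hMpos.le).mono S.hN
      (gw_measurable hα (S.hUc T) hv).2.aestronglyMeasurable ?_).2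
    intro p hp1 hp2 hp3
    have hp : p ∈ Om N T := ⟨⟨hp1, hp2.trans hq.1.2⟩, hp3⟩
    rw [Set.indicator_of_mem hp]
    refine (gw_le hα (V := fun p => M * Wf k σ φ p) hp (hvM p hp)).trans ?_
    have h2 : 0 ≤ (α + 1) * (|U p| + M * Wf k σ φ p) ^ α := by
      have := hW0 p hp
      positivity
    calc _ ≤ (α + 1) * (|U p| + M * Wf k σ φ p) ^ α * (M * Wf k σ φ p) :=
          mul_le_mul_of_nonneg_left (hvM p hp) h2
      _ = _ := by ring
  set A := κ + M * (ρ ^ (-σ) + M0) with hA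
  have hA0 : κ ≤ A := by
    have : 0 ≤ M * (ρ ^ (-σ) + M0) := by positivity
    linarith
  classical
  set P : ℝ × Euc N → ℝ := fun p => if ‖p.2‖ < r0 then
    A * ‖p.2‖ ^ (-η) - κ * ‖p.2‖ ^ (-(η - ν / 2)) else M * Wf k σ φ p with hP
  have hPlow : ∀ p ∈ Om N T, ‖p.2‖ < r0 →
      A - κ ≤ A * ‖p.2‖ ^ (-η) - κ * ‖p.2‖ ^ (-(η - ν / 2)) := by
    intro p hp hpr
    have hX : 0 < ‖p.2‖ := norm_pos_iff.2 hp.2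
    have h1 : ‖p.2‖ ^ (-(η - ν / 2)) ≤ ‖p.2‖ ^ (-η) :=
      Real.rpow_le_rpow_of_exponent_ge hX (hpr.le.trans hr01) (by linarith)
    have h2 : (1 : ℝ) ≤ ‖p.2‖ ^ (-η) :=
      Real.one_le_rpow_of_pos_of_le_one_of_nonpos hX (hpr.le.trans hr01) (by linarith)
    have h3 := mul_le_mul_of_nonneg_left h1 hκ0
    have h4 := mul_le_mul_of_nonneg_left h2 (show 0 ≤ A - κ by linarith)
    linarith
  have hP0 : ∀ p ∈ Om N T, 0 ≤ P p := by
    intro p hp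
    by_cases h : ‖p.2‖ < r0
    · simp only [hP, if_pos h]
      exact le_trans (by linarith) (hPlow p hp h)
    · simp only [hP, if_neg h]
      exact mul_nonneg hMpos.le (hW0 p hp)
  obtain ⟨w, hwc, hwM, hwP, hweq⟩ := picard S.hN (s := σ + 2) hα hθ0 hθ1 hM (by positivity)
    (by linarith) (S.hUc T) hHc (S.Wc T k σ) hHW hD' hC hP0 (by
      intro v hv hvM hvP q hq
      by_cases h : ‖q.2‖ < ρ
      · simp only [hP, if_pos (h.trans_le hρr)]
        refine hbar A hA0 v hv hvM (fun p hp hpr => ?_) q hq h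
        have := hvP p hp
        simpa only [hP, if_pos hpr] using this
      · have h1 : |Hop φ q + Dop (gw α T U v) q| ≤ M * Wf k σ φ q := by
          refine (abs_add_le _ _).trans ((add_le_add (hHW q hq)
            (hDop v hv hvM q hq _ (hD' q hq))).trans (le_of_eq ?_))
          linear_combination (Wf k σ φ q) * hMθ
        refine h1.trans ?_
        by_cases h' : ‖q.2‖ < r0
        · simp only [hP, if_pos h']
          refine le_trans ?_ (hPlow q hq h')
          have h2 : ‖q.2‖ ^ (-σ) ≤ ρ ^ (-σ) :=
            Real.rpow_le_rpow_of_nonpos hρ0 (not_lt.1 h) (by linarith)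
          have h3 := mul_le_mul_of_nonneg_left ((hWle q hq).trans (add_le_add_left h2 M0)) hMpos.le
          rw [hA]; linarith
        · simp only [hP, if_neg h', le_refl])
  set Cw := A + M * (r0 ^ (-σ) + M0) with hCw
  have hAn : 0 ≤ A := hκ0.trans hA0
  have hCw0 : 0 ≤ Cw := by positivity
  set Cd := M * (θ + KZ * M0) with hCd
  have hCd0 : 0 ≤ Cd := by positivity
  refine ⟨T, hT0, hT1, Cw + Cd + Cg, by positivity, w, hwc, hweq, ?_, ?_, ?_⟩
  · intro p hp
    have hX : 0 < ‖p.2‖ := norm_pos_iff.2 hp.2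
    have hXn : 0 < ‖p.2‖ ^ (-η) := by positivity
    have hCC : Cw ≤ Cw + Cd + Cg := by linarith
    suffices h : |w p| ≤ Cw * (1 + ‖p.2‖ ^ (-η)) from h.trans (by gcongr)
    by_cases h : ‖p.2‖ < r0
    · have h1 := hwP p hp
      simp only [hP, if_pos h] at h1
      have h2 : 0 ≤ κ * ‖p.2‖ ^ (-(η - ν / 2)) := by positivity
      have h3 : A * ‖p.2‖ ^ (-η) ≤ Cw * (1 + ‖p.2‖ ^ (-η)) := by
        have hAC : A ≤ Cw := by
          rw [hCw]; have : 0 ≤ M * (r0 ^ (-σ) + M0) := by positivity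
          linarith
        have : ‖p.2‖ ^ (-η) ≤ 1 + ‖p.2‖ ^ (-η) := by linarith
        gcongr
      linarith
    · have h2 : ‖p.2‖ ^ (-σ) ≤ r0 ^ (-σ) :=
        Real.rpow_le_rpow_of_nonpos hr00 (not_lt.1 h) (by linarith)
      have h3 := mul_le_mul_of_nonneg_left ((hWle p hp).trans (add_le_add_left h2 M0)) hMpos.le
      have h4 : Cw ≤ Cw * (1 + ‖p.2‖ ^ (-η)) := le_mul_of_one_le_right hCw0 (by linarith)
      have h5 := hwM p hp
      rw [hCw] at h4 ⊢
      linarith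
  · intro p hp
    have hp1 := hp.1.1
    have hXn : 0 < ‖p.2‖ ^ (-σ) := by have := norm_pos_iff.2 hp.2; positivity
    have hCC : Cd ≤ Cw + Cd + Cg := by linarith
    refine (hDop w hwc hwM p hp _ (hD p hp)).trans ?_
    have h1 : p.1 ^ (k + 1) ≤ p.1 := pow_le_of_le_one hp1.le (hp.1.2.le.trans hT1) (by omega)
    have hZ := S.ZM p hp1
    calc _ ≤ M * (θ * (p.1 * ‖p.2‖ ^ (-σ)) + KZ * p.1 * M0) := by gcongr
      _ ≤ Cd * p.1 * (1 + ‖p.2‖ ^ (-σ)) := by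
        rw [hCd]
        have a1 : 0 ≤ M * θ * p.1 := by positivity
        have a2 : 0 ≤ M * (KZ * M0) * p.1 * ‖p.2‖ ^ (-σ) := by positivity
        linarith
      _ ≤ _ := by gcongr
  · intro p hp
    have hCC : Cg ≤ Cw + Cd + Cg := by linarith
    refine ((gw_le hα (V := fun p => M * Wf k σ φ p) hp (hwM p hp)).trans ?_).trans
      ((hC p hp).trans ?_)
    · refine mul_le_mul_of_nonneg_left (hwM p hp) ?_
      have := hW0 p hp
      positivity
    · gcongr

end


/-- The adjoint heat operator applied to a test function. -/
def Lop {N : ℕ} (ζ : ℝ × Euc N → ℝ) (q : ℝ × Euc N) : ℝ :=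
  -(deriv (fun s => ζ (s, q.2)) q.1) - lapl (fun y => ζ (q.1, y)) q.2

/-- Directional derivative. -/
def pd {N : ℕ} (v : ℝ × Euc N) (ζ : ℝ × Euc N → ℝ) (q : ℝ × Euc N) : ℝ := fderiv ℝ ζ q v

/-- Spatial unit vector in space-time. -/
def ee {N : ℕ} (i : Fin N) : ℝ × Euc N := (0, EuclideanSpace.single i (1 : ℝ))

lemma deriv_slice {N : ℕ} {ζ : ℝ × Euc N → ℝ} {q : ℝ × Euc N} (h : DifferentiableAt ℝ ζ q) :
    deriv (fun s => ζ (s, q.2)) q.1 = pd (1, 0) ζ q := by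
  have h1 : HasDerivAt (fun s : ℝ => (s, q.2)) ((1 : ℝ), (0 : Euc N)) q.1 :=
    (hasDerivAt_id q.1).prodMk (hasDerivAt_const q.1 q.2)
  have h2 : HasFDerivAt ζ (fderiv ℝ ζ q) (q.1, q.2) := h.hasFDerivAt
  exact (h2.comp_hasDerivAt q.1 h1).deriv

lemma fderiv_slice {N : ℕ} {ζ : ℝ × Euc N → ℝ} {t : ℝ} {x : Euc N}
    (h : DifferentiableAt ℝ ζ (t, x)) (v : Euc N) :
    fderiv ℝ (fun y => ζ (t, y)) x v = pd (0, v) ζ (t, x) := by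
  have h1 : HasFDerivAt (fun y : Euc N => (t, y)) (ContinuousLinearMap.inr ℝ ℝ (Euc N)) x :=
    hasFDerivAt_prodMk_right t x
  have h2 : HasFDerivAt ζ (fderiv ℝ ζ (t, x)) (t, x) := h.hasFDerivAt
  have h3 : HasFDerivAt (fun y => ζ (t, y)) _ x := h2.comp x h1
  rw [h3.fderiv]
  simp [pd]

lemma pd_contDiff {N : ℕ} {ζ : ℝ × Euc N → ℝ} {m n : WithTop ℕ∞} (v : ℝ × Euc N)
    (h : ContDiff ℝ n ζ) (hmn : m + 1 ≤ n) : ContDiff ℝ m (pd v ζ) :=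
  (h.fderiv_right hmn).clm_apply contDiff_const

lemma Lop_eq {N : ℕ} {ζ : ℝ × Euc N → ℝ} (h : ContDiff ℝ 2 ζ) (q : ℝ × Euc N) :
    Lop ζ q = -(pd (1, 0) ζ q) - ∑ i : Fin N, pd (ee i) (pd (ee i) ζ) q := by
  have hd : Differentiable ℝ ζ := h.differentiable (by norm_num)
  have hs : ContDiff ℝ 2 (fun y : Euc N => ζ (q.1, y)) := h.comp (contDiff_const.prodMk contDiff_id)
  have hs1 : Differentiable ℝ (fderiv ℝ (fun y : Euc N => ζ (q.1, y))) :=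
    (hs.fderiv_right (m := 1) (by norm_num)).differentiable (by norm_num)
  unfold Lop lapl
  rw [deriv_slice (hd q)]
  congr 1
  refine Finset.sum_congr rfl fun i _ => ?_
  have hp : Differentiable ℝ (pd (ee i) ζ) :=
    (pd_contDiff (m := 1) (ee i) h (by norm_num)).differentiable (by norm_num)
  have e1 : (fun y : Euc N => fderiv ℝ (fun y : Euc N => ζ (q.1, y)) y (EuclideanSpace.single i (1 : ℝ)))
      = fun y => pd (ee i) ζ (q.1, y) := by
    ext y
    exact fderiv_slice (hd _) _
  have e2 := fderiv_slice (hp (q.1, q.2)) (EuclideanSpace.single i (1 : ℝ))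
  rw [← e1, fderiv_clm_apply (hs1 _) (differentiableAt_const _)] at e2
  simpa [ee] using e2

lemma pd_tsupport {N : ℕ} (v : ℝ × Euc N) (ζ : ℝ × Euc N → ℝ) :
    tsupport (pd v ζ) ⊆ tsupport ζ := by
  have : tsupport (pd v ζ) ⊆ tsupport (fderiv ℝ ζ) := by
    apply closure_mono
    intro x hx
    simp only [Function.mem_support, pd] at hx ⊢
    intro h; apply hx; rw [h]; rfl
  exact this.trans (tsupport_fderiv_subset ℝ)

lemma Lop_zero {N : ℕ} {ζ : ℝ × Euc N → ℝ} (h : ContDiff ℝ 2 ζ) {q : ℝ × Euc N}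
    (hq : q ∉ tsupport ζ) : Lop ζ q = 0 := by
  rw [Lop_eq h]
  have h1 : ∀ v, pd v ζ q = 0 := fun v =>
    image_eq_zero_of_notMem_tsupport fun h' => hq (pd_tsupport v ζ h')
  have h2 : ∀ v, pd v (pd v ζ) q = 0 := fun v =>
    image_eq_zero_of_notMem_tsupport fun h' => hq (pd_tsupport v ζ (pd_tsupport _ _ h'))
  simp [h1, h2]

lemma Lop_continuous {N : ℕ} {ζ : ℝ × Euc N → ℝ} (h : ContDiff ℝ 2 ζ) : Continuous (Lop ζ) := by
  have e : Lop ζ = fun q => -(pd (1, 0) ζ q) - ∑ i : Fin N, pd (ee i) (pd (ee i) ζ) q :=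
    funext (Lop_eq h)
  rw [e]
  have h1 : ∀ v, ContDiff ℝ 1 (pd v ζ) := fun v => pd_contDiff v h (by norm_num)
  have h2 : ∀ v, Continuous (pd v (pd v ζ)) := fun v =>
    (pd_contDiff (m := 0) v (h1 v) (by norm_num)).continuous
  exact ((h1 _).continuous.neg).sub (continuous_finsetSum _ fun i _ => h2 _)

lemma Lop_compact {N : ℕ} {ζ : ℝ × Euc N → ℝ} (h : ContDiff ℝ 2 ζ) (hc : HasCompactSupport ζ) :
    HasCompactSupport (Lop ζ) := by
  refine HasCompactSupport.intro hc fun q hq => Lop_zero h hq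

lemma Lop_bdd {N : ℕ} {ζ : ℝ × Euc N → ℝ} (h : ContDiff ℝ 2 ζ) (hc : HasCompactSupport ζ) :
    ∃ K, 0 ≤ K ∧ ∀ q, |Lop ζ q| ≤ K := by
  obtain ⟨K, hK⟩ := (Lop_compact h hc).exists_bound_of_continuous (Lop_continuous h)
  exact ⟨K, (norm_nonneg _).trans (hK 0), hK⟩

/-- Integrability of the first moment of the Gaussian. -/
lemma gauss_moment {N : ℕ} : Integrable (fun z : Euc N => hk (1, z) * ‖z‖) := by
  have hi := (gauss_integrable (N := N) (b := 1 / 8) (by norm_num)).const_mul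
    ((4 * Real.pi * 1) ^ (-((N : ℝ) / 2)) * 4)
  have hc : Continuous (fun z : Euc N => hk (1, z)) := by
    have : (fun z : Euc N => hk (1, z)) = fun z => (4 * Real.pi * 1) ^ (-((N : ℝ) / 2)) *
        Real.exp (-(1 / (4 * 1)) * ‖z‖ ^ 2) := funext fun z => hk_pos_eq (one_pos : (0:ℝ) < 1) z
    rw [this]; fun_prop
  refine hi.mono' (hc.mul continuous_norm).aestronglyMeasurable (ae_of_all _ fun z => ?_)
  rw [Real.norm_eq_abs, abs_of_nonneg (mul_nonneg (hk_nonneg _) (norm_nonneg _)),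
    hk_pos_eq (one_pos : (0:ℝ) < 1)]
  suffices hs : Real.exp (-(1 / (4 * 1)) * ‖z‖ ^ 2) * ‖z‖ ≤ 4 * Real.exp (-(1 / 8) * ‖z‖ ^ 2) by
    have hA : 0 ≤ (4 * Real.pi * 1) ^ (-((N : ℝ) / 2)) := by positivity
    have := mul_le_mul_of_nonneg_left hs hA
    linarith
  have h1 : ‖z‖ ≤ 4 * Real.exp (1 / 8 * ‖z‖ ^ 2) := by
    have := Real.add_one_le_exp (1 / 8 * ‖z‖ ^ 2)
    nlinarith [sq_nonneg (‖z‖ - 1), norm_nonneg z]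
  calc Real.exp (-(1 / (4 * 1)) * ‖z‖ ^ 2) * ‖z‖
      ≤ Real.exp (-(1 / (4 * 1)) * ‖z‖ ^ 2) * (4 * Real.exp (1 / 8 * ‖z‖ ^ 2)) :=
        mul_le_mul_of_nonneg_left h1 (Real.exp_nonneg _)
    _ = 4 * (Real.exp (-(1 / (4 * 1)) * ‖z‖ ^ 2) * Real.exp (1 / 8 * ‖z‖ ^ 2)) := by ring
    _ = 4 * Real.exp (-(1 / 8) * ‖z‖ ^ 2) := by
        rw [← Real.exp_add]; congr 2; ring

lemma hk1_hasFDerivAt {N : ℕ} (z : Euc N) :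
    HasFDerivAt (fun z : Euc N => hk (1, z)) (-(hk (1, z) / 2) • innerSL ℝ z) z := by
  have e : (fun z : Euc N => hk (1, z)) = fun z => (4 * Real.pi * 1) ^ (-((N : ℝ) / 2)) *
        Real.exp (-(1 / (4 * 1)) * ‖z‖ ^ 2) := funext fun z => hk_pos_eq (one_pos : (0:ℝ) < 1) z
  have h := (((hasStrictFDerivAt_norm_sq z).hasFDerivAt.const_mul (-(1 / (4 * 1) : ℝ))).exp).const_mul
    ((4 * Real.pi * 1) ^ (-((N : ℝ) / 2)))
  rw [e]
  refine h.congr_fderiv ?_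
  rw [hk_pos_eq (one_pos : (0:ℝ) < 1)]
  ext v
  simp
  ring

/-- Gaussian integration by parts. -/
lemma gauss_ibp {N : ℕ} {h : Euc N → ℝ} (hh : ContDiff ℝ 1 h) (hc : HasCompactSupport h)
    (i : Fin N) :
    ∫ z, hk (1, z) * (z i * h z)
      = 2 * ∫ z, hk (1, z) * fderiv ℝ h z (EuclideanSpace.single i (1 : ℝ)) := by
  have hcg : Continuous (fun z : Euc N => hk (1, z)) :=
    continuous_iff_continuousAt.2 fun z => (hk1_hasFDerivAt z).continuousAt
  have hd : ∀ z : Euc N, fderiv ℝ (fun z : Euc N => hk (1, z)) z (EuclideanSpace.single i (1 : ℝ))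
      = -(hk (1, z) / 2) * z i := by
    intro z
    rw [(hk1_hasFDerivAt z).fderiv]
    have : inner ℝ z (EuclideanSpace.single i (1 : ℝ)) = z i := by
      rw [EuclideanSpace.inner_single_right]; simp
    simp [this]
  have hpc : Continuous (fun z => fderiv ℝ h z (EuclideanSpace.single i (1 : ℝ))) :=
    (hh.continuous_fderiv (by norm_num)).clm_apply continuous_const
  have hps : HasCompactSupport (fun z => fderiv ℝ h z (EuclideanSpace.single i (1 : ℝ))) :=
    hc.fderiv_apply ℝ _
  have key := integral_mul_fderiv_eq_neg_fderiv_mul_of_integrable (μ := (volume : Measure (Euc N)))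
    (f := fun z : Euc N => hk (1, z)) (g := h) (v := EuclideanSpace.single i (1 : ℝ)) ?_ ?_ ?_ ?_ ?_
  · rw [key]
    have : ∀ z : Euc N, fderiv ℝ (fun z : Euc N => hk (1, z)) z (EuclideanSpace.single i (1 : ℝ)) * h z
        = -(1 / 2) * (hk (1, z) * (z i * h z)) := by
      intro z; rw [hd]; ring
    simp only [this]
    rw [integral_const_mul]
    ring
  · simp only [hd]
    exact Continuous.integrable_of_hasCompactSupport (by fun_prop) (hc.mul_left)
  · exact Continuous.integrable_of_hasCompactSupport (hcg.mul hpc) (hps.mul_left)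
  · exact Continuous.integrable_of_hasCompactSupport (hcg.mul hh.continuous) (hc.mul_left)
  · exact fun x _ => (hk1_hasFDerivAt x).differentiableAt
  · exact fun x _ => hh.differentiable (by norm_num) x


lemma hk_scale_integral {N : ℕ} {τ : ℝ} (hτ : 0 < τ) (F : Euc N → ℝ) :
    ∫ y, hk (τ, y) * F y = ∫ z, hk (1, z) * F (Real.sqrt τ • z) := by
  have hs : 0 < Real.sqrt τ := Real.sqrt_pos.2 hτ
  have h := Measure.integral_comp_smul (volume : Measure (Euc N)) (fun y => hk (τ, y) * F y)
    (Real.sqrt τ)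
  have e : ∀ z : Euc N, hk (τ, Real.sqrt τ • z)
      = ((Real.sqrt τ) ^ N)⁻¹ * hk (1, z) := by
    intro z
    rw [hk_pos_eq hτ, hk_pos_eq (one_pos : (0:ℝ) < 1), norm_smul, Real.norm_eq_abs, abs_of_pos hs,
      mul_pow, Real.sq_sqrt hτ.le, Real.mul_rpow (by positivity) hτ.le, mul_one]
    have e1 : τ ^ (-((N : ℝ) / 2)) = ((Real.sqrt τ) ^ N)⁻¹ := by
      rw [Real.sqrt_eq_rpow, ← Real.rpow_natCast, ← Real.rpow_mul hτ.le,
        ← Real.rpow_neg hτ.le]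
      congr 1; ring
    rw [e1]
    have e2 : -(1 / (4 * τ)) * (τ * ‖z‖ ^ 2) = -(1 / (4 * 1)) * ‖z‖ ^ 2 := by
      field_simp
    rw [e2]; simp only [mul_one]; ring
  simp only [e, finrank_euclideanSpace, Fintype.card_fin, smul_eq_mul, mul_assoc] at h
  rw [integral_const_mul, abs_of_pos (by positivity)] at h
  have hne : ((Real.sqrt τ) ^ N)⁻¹ ≠ 0 := by positivity
  exact (mul_left_cancel₀ hne h).symm

lemma vec_decomp {N : ℕ} (c : ℝ) (z : Euc N) :
    ((1 : ℝ), c • z) = (1, 0) + ∑ i : Fin N, (c * z i) • (ee i : ℝ × Euc N) := by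
  ext j
  · simp [ee, Prod.fst_sum]
  · simp [ee, Prod.snd_sum, Finset.sum_apply, Pi.single_apply]

lemma exists_radius {N : ℕ} {ζ : ℝ × Euc N → ℝ} (hc : HasCompactSupport ζ) :
    ∃ R : ℝ, 0 < R ∧ ∀ t x, ζ (t, x) ≠ 0 → |t| ≤ R ∧ ‖x‖ ≤ R := by
  obtain ⟨R, hR⟩ := hc.isBounded.exists_norm_le
  refine ⟨max R 1, by positivity, fun t x h => ?_⟩
  have := hR (t, x) (subset_tsupport _ h)
  rw [Prod.norm_def] at this
  simp only [sup_le_iff, Real.norm_eq_abs] at this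
  exact ⟨this.1.trans (le_max_left _ _), this.2.trans (le_max_left _ _)⟩

lemma slice_compact {N : ℕ} {ζ : ℝ × Euc N → ℝ} (hc : HasCompactSupport ζ) (τ : ℝ) {c : ℝ}
    (hcc : 0 < c) : HasCompactSupport (fun z : Euc N => ζ (τ, c • z)) := by
  obtain ⟨R, hR, h⟩ := exists_radius hc
  refine HasCompactSupport.intro (isCompact_closedBall (0 : Euc N) (R / c)) fun z hz => ?_
  by_contra hne
  have := (h _ _ hne).2
  rw [norm_smul, Real.norm_eq_abs, abs_of_pos hcc] at this
  apply hz
  rw [mem_closedBall_zero_iff, le_div_iff₀ hcc]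
  linarith

/-- Gaussian average along parabolic scaling. -/
def Psi {N : ℕ} (ζ : ℝ × Euc N → ℝ) (τ : ℝ) : ℝ := ∫ z, hk (1, z) * ζ (τ, Real.sqrt τ • z)

lemma hk1_continuous {N : ℕ} : Continuous (fun z : Euc N => hk (1, z)) :=
  continuous_iff_continuousAt.2 fun z => (hk1_hasFDerivAt z).continuousAt

lemma hk1_integrable {N : ℕ} : Integrable (fun z : Euc N => hk (1, z)) := by
  have := hk_integrable (N := N) 1 0
  simp only [zero_sub, hk_symm] at this
  exact this

lemma hk1_mass {N : ℕ} : ∫ z : Euc N, hk (1, z) = 1 := by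
  have := hk_mass (N := N) one_pos 0
  simp only [zero_sub, hk_symm] at this
  exact this

lemma Psi_continuous {N : ℕ} {ζ : ℝ × Euc N → ℝ} (hζ : Continuous ζ) (hc : HasCompactSupport ζ) :
    Continuous (Psi ζ) := by
  obtain ⟨K, hK⟩ := hc.exists_bound_of_continuous hζ
  refine continuous_of_dominated (bound := fun z => hk (1, z) * K) ?_ ?_ ?_ ?_
  · intro τ
    exact (hk1_continuous.mul (by fun_prop)).aestronglyMeasurable
  · intro τ
    refine ae_of_all _ fun z => ?_
    rw [norm_mul, Real.norm_of_nonneg (hk_nonneg _)]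
    exact mul_le_mul_of_nonneg_left (hK _) (hk_nonneg _)
  · exact hk1_integrable.mul_const K
  · refine ae_of_all _ fun z => ?_
    exact continuous_const.mul (hζ.comp (continuous_id.prodMk
      (Real.continuous_sqrt.smul continuous_const)))

lemma Psi_hasDerivAt {N : ℕ} {ζ : ℝ × Euc N → ℝ} (hζ : ContDiff ℝ 2 ζ) (hc : HasCompactSupport ζ)
    {τ : ℝ} (hτ : 0 < τ) :
    HasDerivAt (Psi ζ) (∫ z, hk (1, z) * fderiv ℝ ζ (τ, Real.sqrt τ • z)
      ((1 : ℝ), (1 / (2 * Real.sqrt τ)) • z)) τ := by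
  have hcf : Continuous (fderiv ℝ ζ) := hζ.continuous_fderiv (by norm_num)
  obtain ⟨K, hK⟩ := (hc.fderiv ℝ).exists_bound_of_continuous hcf
  obtain ⟨K0, hK0⟩ := hc.exists_bound_of_continuous hζ.continuous
  have hK1 : 0 ≤ K := (norm_nonneg _).trans (hK 0)
  have hs0 : 0 < Real.sqrt (τ / 2) := Real.sqrt_pos.2 (by linarith)
  refine (hasDerivAt_integral_of_dominated_loc_of_deriv_le (s := Set.Ioi (τ / 2))
    (bound := fun z => K * (hk (1, z) + (1 / (2 * Real.sqrt (τ / 2))) * (hk (1, z) * ‖z‖)))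
    (F := fun τ (z : Euc N) => hk (1, z) * ζ (τ, Real.sqrt τ • z))
    (F' := fun τ (z : Euc N) => hk (1, z) * fderiv ℝ ζ (τ, Real.sqrt τ • z)
      ((1 : ℝ), (1 / (2 * Real.sqrt τ)) • z))
    (Ioi_mem_nhds (by linarith)) ?_ ?_ ?_ ?_ ?_ ?_).2
  · refine Eventually.of_forall fun s => ?_
    have := hζ.continuous
    exact (hk1_continuous.mul (by fun_prop)).aestronglyMeasurable
  · refine (hk1_integrable.mul_const K0).mono' ?_ (ae_of_all _ fun z => ?_)
    · have := hζ.continuous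
      exact (hk1_continuous.mul (by fun_prop)).aestronglyMeasurable
    · rw [norm_mul, Real.norm_of_nonneg (hk_nonneg _)]
      exact mul_le_mul_of_nonneg_left (hK0 _) (hk_nonneg _)
  · refine (hk1_continuous.mul (Continuous.clm_apply ?_ ?_)).aestronglyMeasurable
    · exact hcf.comp (by fun_prop)
    · fun_prop
  · refine ae_of_all _ fun z s hs => ?_
    have hs' : τ / 2 < s := hs
    rw [norm_mul, Real.norm_of_nonneg (hk_nonneg _)]
    have h1 : ‖fderiv ℝ ζ (s, Real.sqrt s • z) ((1 : ℝ), (1 / (2 * Real.sqrt s)) • z)‖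
        ≤ K * (1 + (1 / (2 * Real.sqrt (τ / 2))) * ‖z‖) := by
      refine ((fderiv ℝ ζ _).le_opNorm _).trans ?_
      refine mul_le_mul (hK _) ?_ (norm_nonneg _) hK1
      rw [Prod.norm_def]
      have h2 : 1 / (2 * Real.sqrt s) ≤ 1 / (2 * Real.sqrt (τ / 2)) := by
        apply one_div_le_one_div_of_le (by positivity)
        have := Real.sqrt_le_sqrt hs'.le
        linarith
      have h3 : ‖(1 / (2 * Real.sqrt s)) • z‖ ≤ 1 / (2 * Real.sqrt (τ / 2)) * ‖z‖ := by
        rw [norm_smul, Real.norm_of_nonneg (by positivity)]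
        exact mul_le_mul_of_nonneg_right h2 (norm_nonneg _)
      have h4 : 0 ≤ 1 / (2 * Real.sqrt (τ / 2)) * ‖z‖ := by positivity
      simp only [sup_le_iff, norm_one]
      exact ⟨by linarith, by linarith⟩
    refine (mul_le_mul_of_nonneg_left h1 (hk_nonneg _)).trans (le_of_eq ?_)
    ring
  · exact (hk1_integrable.add (gauss_moment.const_mul _)).const_mul K
  · refine ae_of_all _ fun z s hs => ?_
    have hs' : 0 < s := lt_trans (by linarith) (Set.mem_Ioi.1 hs)
    have h1 : HasDerivAt (fun s : ℝ => (s, Real.sqrt s • z))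
        ((1 : ℝ), (1 / (2 * Real.sqrt s)) • z) s :=
      (hasDerivAt_id s).prodMk ((Real.hasDerivAt_sqrt hs'.ne').smul_const z)
    have h2 : HasFDerivAt ζ (fderiv ℝ ζ (s, Real.sqrt s • z)) (s, Real.sqrt s • z) :=
      (hζ.differentiable (by norm_num) _).hasFDerivAt
    exact (h2.comp_hasDerivAt s h1).const_mul _

lemma Psi_deriv_eq {N : ℕ} {ζ : ℝ × Euc N → ℝ} (hζ : ContDiff ℝ 2 ζ) (hc : HasCompactSupport ζ)
    {τ : ℝ} (hτ : 0 < τ) :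
    ∫ z, hk (1, z) * fderiv ℝ ζ (τ, Real.sqrt τ • z) ((1 : ℝ), (1 / (2 * Real.sqrt τ)) • z)
      = - ∫ y, hk (τ, y) * Lop ζ (τ, y) := by
  have hs : 0 < Real.sqrt τ := Real.sqrt_pos.2 hτ
  set c := Real.sqrt τ with hcdef
  have h1 : ∀ v, ContDiff ℝ 1 (pd v ζ) := fun v => pd_contDiff v hζ (by norm_num)
  have h2 : ∀ v, Continuous (pd v (pd v ζ)) := fun v =>
    (pd_contDiff (m := 0) v (h1 v) (by norm_num)).continuous
  have hc1 : ∀ v, HasCompactSupport (pd v ζ) := fun v =>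
    hc.of_isClosed_subset (isClosed_tsupport _) (pd_tsupport v ζ)
  have hc2 : ∀ v, HasCompactSupport (pd v (pd v ζ)) := fun v =>
    (hc1 v).of_isClosed_subset (isClosed_tsupport _) (pd_tsupport v _)
  have hpt : ∀ z : Euc N, hk (1, z) * fderiv ℝ ζ (τ, c • z) ((1 : ℝ), (1 / (2 * c)) • z)
      = hk (1, z) * pd (1, 0) ζ (τ, c • z)
        + ∑ i : Fin N, (1 / (2 * c)) * (hk (1, z) * (z i * pd (ee i) ζ (τ, c • z))) := by
    intro z
    rw [vec_decomp, map_add, map_sum, mul_add, Finset.mul_sum]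
    congr 1
    refine Finset.sum_congr rfl fun i _ => ?_
    rw [map_smul]
    simp only [pd, smul_eq_mul]
    ring
  have i1 : ∀ {g : ℝ × Euc N → ℝ}, Continuous g → HasCompactSupport g →
      Integrable (fun z : Euc N => hk (1, z) * g (τ, c • z)) := by
    intro g hg hgc
    exact Continuous.integrable_of_hasCompactSupport (hk1_continuous.mul (by fun_prop))
      ((slice_compact hgc τ hs).mul_left)
  have i2 : ∀ i : Fin N,
      Integrable (fun z : Euc N => (1 / (2 * c)) * (hk (1, z) * (z i * pd (ee i) ζ (τ, c • z)))) := by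
    intro i
    have := (h1 (ee i)).continuous
    have hcs := slice_compact (hc1 (ee i)) τ hs
    refine Integrable.const_mul ?_ _
    exact Continuous.integrable_of_hasCompactSupport (hk1_continuous.mul (by fun_prop))
      (hcs.mul_left.mul_left)
  simp only [hpt]
  rw [integral_add (i1 (h1 _).continuous (hc1 _)) (integrable_finsetSum _ fun i _ => i2 i),
    integral_finsetSum _ fun i _ => i2 i, hk_scale_integral hτ]
  have hib : ∀ i : Fin N, ∫ z : Euc N, (1 / (2 * c)) * (hk (1, z) * (z i * pd (ee i) ζ (τ, c • z)))
      = ∫ z : Euc N, hk (1, z) * pd (ee i) (pd (ee i) ζ) (τ, c • z) := by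
    intro i
    have hcd : ContDiff ℝ 1 (fun z : Euc N => pd (ee i) ζ (τ, c • z)) :=
      (h1 _).comp (contDiff_const.prodMk (contDiff_const_smul c))
    rw [integral_const_mul, gauss_ibp hcd (slice_compact (hc1 _) τ hs) i]
    have : ∀ z : Euc N, fderiv ℝ (fun z : Euc N => pd (ee i) ζ (τ, c • z)) z
        (EuclideanSpace.single i (1 : ℝ)) = c * pd (ee i) (pd (ee i) ζ) (τ, c • z) := by
      intro z
      have a1 : HasFDerivAt (fun z : Euc N => (τ, c • z))
          ((0 : Euc N →L[ℝ] ℝ).prod (c • ContinuousLinearMap.id ℝ (Euc N))) z :=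
        (hasFDerivAt_const τ z).prodMk ((hasFDerivAt_id z).const_smul c)
      have a2 : HasFDerivAt (pd (ee i) ζ) (fderiv ℝ (pd (ee i) ζ) (τ, c • z)) (τ, c • z) :=
        ((h1 _).differentiable (by norm_num) _).hasFDerivAt
      have a3 : HasFDerivAt (fun z : Euc N => pd (ee i) ζ (τ, c • z))
          ((fderiv ℝ (pd (ee i) ζ) (τ, c • z)).comp
            ((0 : Euc N →L[ℝ] ℝ).prod (c • ContinuousLinearMap.id ℝ (Euc N)))) z :=
        HasFDerivAt.comp (g := pd (ee i) ζ) z a2 a1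
      rw [a3.fderiv]
      have a4 : ((0 : ℝ), c • (EuclideanSpace.single i (1 : ℝ) : Euc N)) = c • (ee i : ℝ × Euc N) := by
        simp [ee]
      simp only [ContinuousLinearMap.comp_apply, ContinuousLinearMap.prod_apply,
        ContinuousLinearMap.zero_apply, ContinuousLinearMap.smul_apply,
        ContinuousLinearMap.id_apply]
      rw [a4, map_smul]
      rfl
    simp only [this]
    have e : ∀ z : Euc N, hk (1, z) * (c * pd (ee i) (pd (ee i) ζ) (τ, c • z))
        = c * (hk (1, z) * pd (ee i) (pd (ee i) ζ) (τ, c • z)) := fun z => by ring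
    simp only [e]
    rw [integral_const_mul]
    field_simp
  simp only [hib]
  rw [← integral_finsetSum _ fun i _ => i1 (h2 _) (hc2 _),
    ← integral_add (i1 (h1 _).continuous (hc1 _))
      (integrable_finsetSum _ fun i _ => i1 (h2 _) (hc2 _)), ← integral_neg]
  refine integral_congr_ae (ae_of_all _ fun z => ?_)
  simp only []
  rw [Lop_eq hζ, ← Finset.mul_sum]
  ring

/-- The heat kernel is a fundamental solution (pole at the origin). -/
lemma fund0 {N : ℕ} {ζ : ℝ × Euc N → ℝ} (hζ : ContDiff ℝ 2 ζ) (hc : HasCompactSupport ζ) :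
    Integrable (fun q => hk q * Lop ζ q) ∧ ∫ q, hk q * Lop ζ q = ζ 0 := by
  obtain ⟨R, hR, hRs⟩ := exists_radius hc
  obtain ⟨K, hK0, hK⟩ := Lop_bdd hζ hc
  obtain ⟨R', hR', hRs'⟩ := exists_radius (Lop_compact hζ hc)
  have hIntg : Integrable (fun q : ℝ × Euc N => hk q * Lop ζ q) := by
    have h1 := (hk_integrable_strip (N := N) (R' + 1)).mul_const K
    refine h1.mono' (hk_measurable.aestronglyMeasurable.mul
      (Lop_continuous hζ).aestronglyMeasurable) (ae_of_all _ fun q => ?_)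
    rw [norm_mul, Real.norm_of_nonneg (hk_nonneg _)]
    by_cases hq : Lop ζ q = 0
    · rw [hq]; simp only [norm_zero, mul_zero]
      refine mul_nonneg (Set.indicator_nonneg (fun _ _ => hk_nonneg _) _) hK0
    · have := (hRs' q.1 q.2 hq).1
      have h2 := (abs_le.1 this).2
      rw [Set.indicator_of_mem (by exact ⟨by simp only [Set.mem_Iio]; linarith, trivial⟩)]
      exact mul_le_mul_of_nonneg_left (hK q) (hk_nonneg _)
  refine ⟨hIntg, ?_⟩
  have hprod : ∫ q, hk q * Lop ζ q = ∫ τ, ∫ y, hk (τ, y) * Lop ζ (τ, y) :=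
    integral_prod _ hIntg
  have hi1 : Integrable (fun τ => ∫ y, hk (τ, y) * Lop ζ (τ, y)) := hIntg.integral_prod_left
  have hz : ∀ τ, τ ∉ Set.Ioi (0:ℝ) → ∫ y, hk (τ, y) * Lop ζ (τ, y) = 0 := by
    intro τ hτ
    have : ∀ y : Euc N, hk (τ, y) = 0 := fun y => hk_nonpos (not_lt.1 hτ) y
    simp [this]
  rw [hprod, ← setIntegral_eq_integral_of_forall_compl_eq_zero hz]
  have hderiv : ∀ τ ∈ Set.Ioi (0:ℝ), HasDerivAt (Psi ζ) (-∫ y, hk (τ, y) * Lop ζ (τ, y)) τ := by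
    intro τ hτ
    rw [← Psi_deriv_eq hζ hc hτ]
    exact Psi_hasDerivAt hζ hc hτ
  have hlim : Tendsto (Psi ζ) atTop (nhds 0) := by
    refine tendsto_const_nhds.congr' ?_
    filter_upwards [eventually_gt_atTop R] with τ hτ
    unfold Psi
    have : ∀ z : Euc N, ζ (τ, Real.sqrt τ • z) = 0 := by
      intro z; by_contra h
      have := (abs_le.1 (hRs _ _ h).1).2
      linarith
    simp [this]
  have := integral_Ioi_of_hasDerivAt_of_tendsto
    (Psi_continuous hζ.continuous hc).continuousWithinAt hderiv hi1.neg.integrableOn hlim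
  rw [integral_neg] at this
  have e0 : Psi ζ 0 = ζ 0 := by
    unfold Psi
    simp only [Real.sqrt_zero, zero_smul]
    rw [integral_mul_const, hk1_mass, one_mul]; rfl
  linarith

lemma fund {N : ℕ} {ζ : ℝ × Euc N → ℝ} (hζ : ContDiff ℝ 2 ζ) (hc : HasCompactSupport ζ)
    (p : ℝ × Euc N) :
    Integrable (fun q => hk (q - p) * Lop ζ q) ∧ ∫ q, hk (q - p) * Lop ζ q = ζ p := by
  have h1 : ContDiff ℝ 2 (fun q => ζ (q + p)) := hζ.comp (contDiff_id.add contDiff_const)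
  have h2 : HasCompactSupport (fun q => ζ (q + p)) := by
    exact hc.comp_homeomorph (Homeomorph.addRight p)
  have hpd : ∀ v (g : ℝ × Euc N → ℝ), pd v (fun q => g (q + p)) = fun q => pd v g (q + p) := by
    intro v g; ext q
    simp only [pd]
    rw [fderiv_comp_add_right]
  have hL : ∀ q, Lop (fun q => ζ (q + p)) q = Lop ζ (q + p) := by
    intro q
    rw [Lop_eq h1, Lop_eq hζ]
    simp only [hpd]
  obtain ⟨h3, h4⟩ := fund0 h1 h2
  simp only [hL, zero_add] at h3 h4
  constructor
  · have := h3.comp_sub_right p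
    simpa using this
  · rw [← h4, ← integral_add_right_eq_self _ p]
    simp


lemma Lop_strip {N : ℕ} {ζ : ℝ × Euc N → ℝ} (hζ : ContDiff ℝ 2 ζ) (hc : HasCompactSupport ζ) :
    ∃ R : ℝ, 0 < R ∧ ∀ q, Lop ζ q ≠ 0 → q ∈ Set.Ioo (-R) R ×ˢ Metric.ball (0 : Euc N) R := by
  obtain ⟨R, hR, h⟩ := exists_radius (Lop_compact hζ hc)
  refine ⟨R + 1, by linarith, fun q hq => ?_⟩
  have := h q.1 q.2 hq
  have h1 := abs_le.1 this.1
  refine ⟨⟨by linarith, by linarith⟩, ?_⟩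
  rw [mem_ball_zero_iff]; linarith [this.2]

lemma weak_Dop {N : ℕ} (hN : 3 ≤ N) {σ C : ℝ} (hσ0 : 0 < σ) (hσ : σ < (N : ℝ) - 2) (hC : 0 ≤ C)
    {g : ℝ × Euc N → ℝ} (hg : Measurable g)
    (hgb : ∀ p : ℝ × Euc N, p.2 ≠ 0 → |g p| ≤ C * (‖p.2‖ ^ (-(σ + 2)) + 1))
    {ζ : ℝ × Euc N → ℝ} (hζ : ContDiff ℝ 2 ζ) (hc : HasCompactSupport ζ)
    (hsupp : tsupport ζ ⊆ PosT N) :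
    Integrable (fun q => Dop g q * Lop ζ q) ∧
      ∫ q, Dop g q * Lop ζ q = ∫ p in PosT N, g p * ζ p := by
  have hkm := hk_measurable (N := N)
  have hLm : Measurable (Lop ζ) := (Lop_continuous hζ).measurable
  obtain ⟨K, hK0, hK⟩ := Lop_bdd hζ hc
  obtain ⟨R, hR, hRs⟩ := Lop_strip hζ hc
  have hpos : ∀ q, Lop ζ q ≠ 0 → 0 < q.1 := fun q hq => by
    by_contra h
    exact hq (Lop_zero hζ fun h' => h (hsupp h').1)
  set c := σ * ((N : ℝ) - 2 - σ) with hcdef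
  have hcpos : 0 < c := mul_pos hσ0 (by linarith)
  have hD : ∀ q : ℝ × Euc N, 0 < q.1 → q.2 ≠ 0 →
      DLe (fun p : ℝ × Euc N => C * (‖p.2‖ ^ (-(σ + 2)) + 1)) q (C * (‖q.2‖ ^ (-σ) / c + q.1)) := by
    intro q h1 h2
    have a := hk_rpow' hσ0 hσ h2
    have a1 : DLe (fun p : ℝ × Euc N => ‖p.2‖ ^ (-(σ + 2))) q (‖q.2‖ ^ (-σ) / c) :=
      DLe_full hN (fun p _ => by positivity) a.1 (le_of_eq a.2)
    have a2 : DLe (fun _ : ℝ × Euc N => 1) q q.1 := Dop_one h1 q.2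
    exact (a1.add a2).const_mul hC
  have hDg : ∀ q : ℝ × Euc N, 0 < q.1 → q.2 ≠ 0 →
      IntegrableOn (fun p => hk (q - p) * g p) (PosT N) ∧
      Dop (fun p => |g p|) q ≤ C * (‖q.2‖ ^ (-σ) / c + q.1) := by
    intro q h1 h2
    refine ⟨((hD q h1 h2).mono hN hg.aestronglyMeasurable fun p _ _ hp => hgb p hp).1, ?_⟩
    refine ((hD q h1 h2).mono' hN (measurable_abs.comp hg).aestronglyMeasurable fun p _ _ hp => ?_).2
    simpa using hgb p hp
  set F : (ℝ × Euc N) × (ℝ × Euc N) → ℝ := fun z => hk (z.1 - z.2) * g z.2 * Lop ζ z.1 with hF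
  have hFm : Measurable F := by
    rw [hF]; fun_prop
  have hFi : Integrable F (volume.prod (volume.restrict (PosT N))) := by
    rw [integrable_prod_iff hFm.aestronglyMeasurable]
    constructor
    · filter_upwards [ae_snd_ne hN] with q hq
      by_cases hL : Lop ζ q = 0
      · simp [hF, hL]
      · exact (hDg q (hpos q hL) hq).1.mul_const (Lop ζ q)
    · have hm : AEStronglyMeasurable (fun q => ∫ p, ‖F (q, p)‖ ∂(volume.restrict (PosT N)))
          (volume : Measure (ℝ × Euc N)) :=
        hFm.norm.stronglyMeasurable.integral_prod_right'.aestronglyMeasurable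
      have hb : Integrable ((Set.Ioo (-R) R ×ˢ Metric.ball (0 : Euc N) R).indicator
          (fun q => C * (‖q.2‖ ^ (-σ) / c + R) * K)) := by
        rw [integrable_indicator_iff (measurableSet_Ioo.prod measurableSet_ball)]
        have h1 := integrableOn_strip (N := N) (s := σ) (by linarith) hN (-R) R R
        have h2 := integrableOn_strip (N := N) (s := 0) (by
          have : (3:ℝ) ≤ N := by exact_mod_cast hN
          linarith) hN (-R) R R
        have h3 : IntegrableOn (fun _ : ℝ × Euc N => R) (Set.Ioo (-R) R ×ˢ Metric.ball (0 : Euc N) R) := by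
          have := h2.mul_const R
          simp only [neg_zero, Real.rpow_zero, one_mul] at this
          exact this
        exact (((h1.div_const c).add h3).const_mul C).mul_const K
      refine hb.mono' hm ?_
      filter_upwards [ae_snd_ne hN] with q hq
      have e : ∫ p, ‖F (q, p)‖ ∂(volume.restrict (PosT N)) = Dop (fun p => |g p|) q * |Lop ζ q| := by
        unfold Dop
        rw [← integral_mul_const]
        congr 1; ext p
        simp only [hF, norm_mul, Real.norm_eq_abs, abs_of_nonneg (hk_nonneg _)]
      rw [e]
      by_cases hL : Lop ζ q = 0
      · rw [hL]; simp only [abs_zero, mul_zero, norm_zero]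
        refine Set.indicator_nonneg (fun p _ => ?_) q
        positivity
      · rw [Set.indicator_of_mem (hRs q hL)]
        have h0 : 0 ≤ Dop (fun p => |g p|) q :=
          integral_nonneg fun p => mul_nonneg (hk_nonneg _) (abs_nonneg _)
        rw [Real.norm_of_nonneg (mul_nonneg h0 (abs_nonneg _))]
        have h1 := (hRs q hL).1.2
        have h2 := (hDg q (hpos q hL) hq).2
        have h3 : C * (‖q.2‖ ^ (-σ) / c + q.1) ≤ C * (‖q.2‖ ^ (-σ) / c + R) :=
          mul_le_mul_of_nonneg_left (by linarith) hC
        exact mul_le_mul (h2.trans h3) (hK q) (abs_nonneg _) (h0.trans (h2.trans h3))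
  have e1 : ∀ q, Dop g q * Lop ζ q = ∫ p, F (q, p) ∂(volume.restrict (PosT N)) := by
    intro q
    unfold Dop
    rw [← integral_mul_const]
  refine ⟨?_, ?_⟩
  · simp only [e1]
    exact hFi.integral_prod_left
  · simp only [e1]
    have := integral_integral_swap (f := fun q p => F (q, p)) hFi
    rw [this]
    refine integral_congr_ae (ae_of_all _ fun p => ?_)
    have h2 := (fund hζ hc p).2
    simp only [hF]
    rw [← h2, ← integral_const_mul]
    congr 1; ext q; ring

lemma weak_Hop {N : ℕ} {M : ℝ} {φ : Euc N → ℝ} (hφ : Measurable φ) (hM : ∀ y, |φ y| ≤ M)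
    {ζ : ℝ × Euc N → ℝ} (hζ : ContDiff ℝ 2 ζ) (hc : HasCompactSupport ζ)
    (hsupp : tsupport ζ ⊆ PosT N) :
    Integrable (fun q => Hop φ q * Lop ζ q) ∧ ∫ q, Hop φ q * Lop ζ q = 0 := by
  have hkm := hk_measurable (N := N)
  have hLm : Measurable (Lop ζ) := (Lop_continuous hζ).measurable
  have hM0 : 0 ≤ M := (abs_nonneg _).trans (hM 0)
  have hpos : ∀ q, Lop ζ q ≠ 0 → 0 < q.1 := fun q hq => by
    by_contra h
    exact hq (Lop_zero hζ fun h' => h (hsupp h').1)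
  set F : (ℝ × Euc N) × Euc N → ℝ := fun z => hk (z.1.1, z.1.2 - z.2) * φ z.2 * Lop ζ z.1 with hF
  have hFm : Measurable F := by
    rw [hF]; fun_prop
  have hLi : Integrable (Lop ζ) :=
    (Lop_continuous hζ).integrable_of_hasCompactSupport (Lop_compact hζ hc)
  have hFi : Integrable F (volume.prod volume) := by
    rw [integrable_prod_iff hFm.aestronglyMeasurable]
    constructor
    · refine ae_of_all _ fun q => ?_
      exact (Hop_integrable hφ hM q).mul_const (Lop ζ q)
    · refine (hLi.abs.const_mul M).mono'
        hFm.norm.stronglyMeasurable.integral_prod_right'.aestronglyMeasurable (ae_of_all _ fun q => ?_)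
      have e : ∫ y, ‖F (q, y)‖ = Hop (fun y => |φ y|) q * |Lop ζ q| := by
        unfold Hop
        rw [← integral_mul_const]
        congr 1; ext p
        simp only [hF, norm_mul, Real.norm_eq_abs, abs_of_nonneg (hk_nonneg _)]
      rw [e]
      by_cases hL : Lop ζ q = 0
      · simp [hL]
      · have h0 : 0 ≤ Hop (fun y => |φ y|) q := Hop_nonneg (fun y => abs_nonneg _) q
        rw [Real.norm_of_nonneg (mul_nonneg h0 (abs_nonneg _))]
        refine mul_le_mul_of_nonneg_right ?_ (abs_nonneg _)
        exact Hop_le (measurable_abs.comp hφ) (fun y => by simpa using hM y) (hpos q hL) q.2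
  have e1 : ∀ q, Hop φ q * Lop ζ q = ∫ y, F (q, y) := by
    intro q
    unfold Hop
    rw [← integral_mul_const]
  refine ⟨?_, ?_⟩
  · simp only [e1]
    exact hFi.integral_prod_left
  · simp only [e1]
    rw [integral_integral_swap (f := fun q p => F (q, p)) hFi]
    rw [← integral_zero (Euc N) ℝ]
    refine integral_congr_ae (ae_of_all _ fun y => ?_)
    have h2 := (fund hζ hc (0, y)).2
    have h3 : ζ (0, y) = 0 := image_eq_zero_of_notMem_tsupport fun h' => by
      have : (0:ℝ) < 0 := (hsupp h').1
      exact lt_irrefl _ this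
    rw [h3] at h2
    have : ∀ q, F (q, y) = φ y * (hk (q - (0, y)) * Lop ζ q) := by
      intro q
      have : q - (0, y) = (q.1, q.2 - y) := by ext <;> simp
      rw [this]; simp only [hF]; ring
    simp only [this]
    rw [integral_const_mul, h2, mul_zero]


/-- The self-similar solution. -/
def Uf {N : ℕ} (α : ℝ) (f : ℝ → ℝ) (p : ℝ × Euc N) : ℝ :=
  p.1 ^ (-(1 / α)) * f (‖p.2‖ / Real.sqrt p.1)

/-- The domain of regularity of the self-similar solution. -/
def Omi (N : ℕ) : Set (ℝ × Euc N) := Set.Ioi 0 ×ˢ {x | x ≠ 0}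

lemma isOpen_Omi (N : ℕ) : IsOpen (Omi N) := isOpen_Ioi.prod isOpen_ne

lemma Uf_contDiffOn {N : ℕ} {α : ℝ} {f : ℝ → ℝ} (hf : ContDiffOn ℝ 2 f (Set.Ioi 0)) :
    ContDiffOn ℝ 2 (Uf (N := N) α f) (Omi N) := by
  have h1 : ContDiffOn ℝ 2 (fun p : ℝ × Euc N => p.1 ^ (-(1 / α))) (Omi N) :=
    contDiff_fst.contDiffOn.rpow_const_of_ne fun p hp => (Set.mem_Ioi.1 hp.1).ne'
  have h2 : ContDiffOn ℝ 2 (fun p : ℝ × Euc N => Real.sqrt p.1) (Omi N) :=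
    contDiff_fst.contDiffOn.sqrt fun p hp => (Set.mem_Ioi.1 hp.1).ne'
  have h3 : ContDiffOn ℝ 2 (fun p : ℝ × Euc N => ‖p.2‖) (Omi N) :=
    contDiff_snd.contDiffOn.norm ℝ fun p hp => hp.2
  have h4 : ContDiffOn ℝ 2 (fun p : ℝ × Euc N => ‖p.2‖ / Real.sqrt p.1) (Omi N) :=
    h3.div h2 fun p hp => (Real.sqrt_pos.2 hp.1).ne'
  refine h1.mul (hf.comp h4 fun p hp => ?_)
  exact div_pos (norm_pos_iff.2 hp.2) (Real.sqrt_pos.2 hp.1)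

lemma pd_of_line {N : ℕ} {g : ℝ × Euc N → ℝ} {p v : ℝ × Euc N} {d : ℝ} (hg : DifferentiableAt ℝ g p)
    (h : HasDerivAt (fun s : ℝ => g (p + s • v)) d 0) : pd v g p = d := by
  have h1 : HasDerivAt (fun s : ℝ => p + s • v) v 0 := by
    have := ((hasDerivAt_id (0:ℝ)).smul_const v).const_add p
    simpa using this
  have h2 : HasFDerivAt g (fderiv ℝ g p) (p + (0:ℝ) • v) := by
    simpa using hg.hasFDerivAt
  have h3 : HasDerivAt (fun s : ℝ => g (p + s • v)) (fderiv ℝ g p v) 0 := h2.comp_hasDerivAt 0 h1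
  exact h3.unique h

lemma norm_line {N : ℕ} {x : Euc N} (hx : x ≠ 0) (i : Fin N) :
    HasDerivAt (fun s : ℝ => ‖x + s • EuclideanSpace.single i (1 : ℝ)‖) (x i / ‖x‖) 0 := by
  have h1 : HasDerivAt (fun s : ℝ => x + s • (EuclideanSpace.single i (1 : ℝ) : Euc N))
      (EuclideanSpace.single i (1 : ℝ)) 0 := by
    have := ((hasDerivAt_id (0:ℝ)).smul_const (EuclideanSpace.single i (1 : ℝ) : Euc N)).const_add x
    simpa using this
  have h2 := h1.norm_sq
  have h3 := h2.sqrt (by simpa using hx)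
  simp only [Real.sqrt_sq (norm_nonneg _), zero_smul, add_zero] at h3
  convert h3 using 1
  rw [EuclideanSpace.inner_single_right]
  simp
  field_simp

lemma Uf_pd_i {N : ℕ} {α : ℝ} {f : ℝ → ℝ} (hf : ContDiffOn ℝ 2 f (Set.Ioi 0))
    (hf1 : ∀ r, 0 < r → HasDerivAt f (deriv f r) r) (i : Fin N) {p : ℝ × Euc N} (hp : p ∈ Omi N) :
    pd (ee i) (Uf α f) p
      = p.1 ^ (-(1 / α)) * (deriv f (‖p.2‖ / Real.sqrt p.1) * ((p.2 i / ‖p.2‖) / Real.sqrt p.1)) := by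
  have hd : DifferentiableAt ℝ (Uf (N := N) α f) p :=
    ((Uf_contDiffOn hf).differentiableOn (by norm_num)).differentiableAt ((isOpen_Omi N).mem_nhds hp)
  have hr : 0 < ‖p.2‖ / Real.sqrt p.1 := div_pos (norm_pos_iff.2 hp.2) (Real.sqrt_pos.2 hp.1)
  refine pd_of_line hd ?_
  simp only [Uf, ee, Prod.fst_add, Prod.snd_add, Prod.smul_fst, Prod.smul_snd, smul_zero, add_zero]
  have h1 := (norm_line hp.2 i).div_const (Real.sqrt p.1)
  have h2 : HasDerivAt f (deriv f (‖p.2‖ / Real.sqrt p.1))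
      (‖p.2 + (0:ℝ) • EuclideanSpace.single i (1 : ℝ)‖ / Real.sqrt p.1) := by
    simpa using hf1 _ hr
  exact (h2.comp (0:ℝ) h1).const_mul _

lemma Uf_pd_contDiffOn {N : ℕ} {α : ℝ} {f : ℝ → ℝ} (hf : ContDiffOn ℝ 2 f (Set.Ioi 0))
    (v : ℝ × Euc N) : ContDiffOn ℝ 1 (pd v (Uf α f)) (Omi N) :=
  ((Uf_contDiffOn hf).fderiv_of_isOpen (m := 1) (isOpen_Omi N) (by norm_num)).clm_apply
    contDiffOn_const

lemma Uf_pd_ii {N : ℕ} {α : ℝ} {f : ℝ → ℝ} (hf : ContDiffOn ℝ 2 f (Set.Ioi 0))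
    (hf1 : ∀ r, 0 < r → HasDerivAt f (deriv f r) r)
    (hf2 : ∀ r, 0 < r → HasDerivAt (deriv f) (deriv (deriv f) r) r)
    (i : Fin N) {p : ℝ × Euc N} (hp : p ∈ Omi N) :
    pd (ee i) (pd (ee i) (Uf α f)) p
      = p.1 ^ (-(1 / α)) * (deriv (deriv f) (‖p.2‖ / Real.sqrt p.1) * ((p.2 i / ‖p.2‖) / Real.sqrt p.1) *
          ((p.2 i / ‖p.2‖) / Real.sqrt p.1) + deriv f (‖p.2‖ / Real.sqrt p.1) *
          (((1 * ‖p.2‖ - p.2 i * (p.2 i / ‖p.2‖)) / ‖p.2‖ ^ 2) / Real.sqrt p.1)) := by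
  have hd : DifferentiableAt ℝ (pd (ee i) (Uf (N := N) α f)) p :=
    ((Uf_pd_contDiffOn hf _).differentiableOn (by norm_num)).differentiableAt
      ((isOpen_Omi N).mem_nhds hp)
  have hr : 0 < ‖p.2‖ / Real.sqrt p.1 := div_pos (norm_pos_iff.2 hp.2) (Real.sqrt_pos.2 hp.1)
  refine pd_of_line hd ?_
  have hn := norm_line hp.2 i
  have h1 := hn.div_const (Real.sqrt p.1)
  have h2 : HasDerivAt (deriv f) (deriv (deriv f) (‖p.2‖ / Real.sqrt p.1))
      (‖p.2 + (0:ℝ) • EuclideanSpace.single i (1 : ℝ)‖ / Real.sqrt p.1) := by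
    simpa using hf2 _ hr
  have h3 := h2.comp (0:ℝ) h1
  have h4 : HasDerivAt (fun s : ℝ => p.2 i + s) 1 0 := by
    simpa using (hasDerivAt_id (0:ℝ)).const_add (p.2 i)
  have h5 := ((h4.div hn (by simpa using hp.2)).div_const (Real.sqrt p.1))
  have h6 := (h3.mul h5).const_mul (p.1 ^ (-(1 / α)))
  simp only [zero_smul, add_zero, Function.comp_apply, Pi.div_apply] at h6
  refine h6.congr_of_eventuallyEq ?_
  have hcont : ContinuousAt (fun s : ℝ => p + s • (ee i : ℝ × Euc N)) 0 := by fun_prop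
  have hev : ∀ᶠ s : ℝ in nhds 0, p + s • (ee i : ℝ × Euc N) ∈ Omi N :=
    hcont.eventually (by simpa using (isOpen_Omi N).mem_nhds hp)
  filter_upwards [hev] with s hs
  rw [Uf_pd_i hf hf1 i hs]
  simp [ee]

lemma Uf_pd_t {N : ℕ} {α : ℝ} {f : ℝ → ℝ} (hf : ContDiffOn ℝ 2 f (Set.Ioi 0))
    (hf1 : ∀ r, 0 < r → HasDerivAt f (deriv f r) r) {p : ℝ × Euc N} (hp : p ∈ Omi N) :
    pd (1, 0) (Uf α f) p
      = (-(1 / α) * p.1 ^ (-(1 / α) - 1)) * f (‖p.2‖ / Real.sqrt p.1) +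
        p.1 ^ (-(1 / α)) * (deriv f (‖p.2‖ / Real.sqrt p.1) *
          (-(‖p.2‖ * (1 / (2 * Real.sqrt p.1))) / (Real.sqrt p.1) ^ 2)) := by
  have hd : DifferentiableAt ℝ (Uf (N := N) α f) p :=
    ((Uf_contDiffOn hf).differentiableOn (by norm_num)).differentiableAt ((isOpen_Omi N).mem_nhds hp)
  have ht : 0 < p.1 := hp.1
  have hr : 0 < ‖p.2‖ / Real.sqrt p.1 := div_pos (norm_pos_iff.2 hp.2) (Real.sqrt_pos.2 ht)
  rw [← deriv_slice hd]
  have h1 := (Real.hasDerivAt_sqrt ht.ne')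
  have h2 : HasDerivAt (fun s => ‖p.2‖ / Real.sqrt s) _ p.1 :=
    (hasDerivAt_const p.1 ‖p.2‖).div h1 (Real.sqrt_pos.2 ht).ne'
  have h3 := (hf1 _ hr).comp p.1 h2
  have h4 := (Real.hasDerivAt_rpow_const (p := -(1 / α)) (Or.inl ht.ne'))
  have h5 : HasDerivAt (fun s => Uf α f (s, p.2)) _ p.1 := h4.mul h3
  rw [h5.deriv]
  simp only [Function.comp_apply]
  ring

lemma Uf_eqn {N : ℕ} {α : ℝ} (hα : 0 < α) {f : ℝ → ℝ} (hf : ContDiffOn ℝ 2 f (Set.Ioi 0))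
    (hf1 : ∀ r, 0 < r → HasDerivAt f (deriv f r) r)
    (hf2 : ∀ r, 0 < r → HasDerivAt (deriv f) (deriv (deriv f) r) r)
    (hfode : ∀ r : ℝ, 0 < r →
      deriv (deriv f) r + (((N : ℝ) - 1) / r + r / 2) * deriv f r + f r / α
        + |f r| ^ α * f r = 0) {p : ℝ × Euc N} (hp : p ∈ Omi N) :
    pd (1, 0) (Uf α f) p - ∑ i : Fin N, pd (ee i) (pd (ee i) (Uf α f)) p = Fnl α (Uf α f p) := by
  have ht : 0 < p.1 := hp.1
  have hx : 0 < ‖p.2‖ := norm_pos_iff.2 hp.2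
  have hs : 0 < Real.sqrt p.1 := Real.sqrt_pos.2 ht
  have hr : 0 < ‖p.2‖ / Real.sqrt p.1 := div_pos hx hs
  rw [Uf_pd_t hf hf1 hp]
  simp only [Uf_pd_ii hf hf1 hf2 _ hp]
  have ode := hfode _ hr
  have hF : Fnl α (Uf α f p) = p.1 ^ (-(1 / α) - 1) *
      (|f (‖p.2‖ / Real.sqrt p.1)| ^ α * f (‖p.2‖ / Real.sqrt p.1)) := by
    unfold Fnl Uf
    have h0 : 0 < p.1 ^ (-(1 / α)) := Real.rpow_pos_of_pos ht _
    rw [abs_mul, abs_of_pos h0, Real.mul_rpow h0.le (abs_nonneg _), ← Real.rpow_mul ht.le]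
    have e : -(1 / α) * α = -1 := by field_simp
    rw [e, Real.rpow_sub ht, Real.rpow_one, Real.rpow_neg_one]
    ring
  rw [hF]
  have e1 : p.1 ^ (-(1 / α)) = p.1 ^ (-(1 / α) - 1) * (Real.sqrt p.1) ^ 2 := by
    rw [Real.sq_sqrt ht.le, Real.rpow_sub ht, Real.rpow_one]
    field_simp
  have hsum : ∑ i : Fin N, p.2 i ^ 2 = ‖p.2‖ ^ 2 := by
    rw [EuclideanSpace.norm_sq_eq]
    simp
  rw [e1]
  set c := p.1 ^ (-(1 / α) - 1)
  set ρ := ‖p.2‖ / Real.sqrt p.1 with hρ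
  set s := Real.sqrt p.1
  set n := ‖p.2‖
  have e2 : ∀ i : Fin N, c * s ^ 2 * (deriv (deriv f) ρ * (p.2 i / n / s) * (p.2 i / n / s) +
      deriv f ρ * ((1 * n - p.2 i * (p.2 i / n)) / n ^ 2 / s))
      = c * (deriv (deriv f) ρ / n ^ 2 - s * deriv f ρ / n ^ 3) * p.2 i ^ 2
        + c * s * deriv f ρ / n := by
    intro i; field_simp; ring
  simp only [e2]
  rw [Finset.sum_add_distrib, ← Finset.mul_sum, hsum]
  simp only [Finset.sum_const, Finset.card_univ, Fintype.card_fin, nsmul_eq_mul]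
  have e3 : deriv (deriv f) ρ = -((((N : ℝ) - 1) / ρ + ρ / 2) * deriv f ρ + f ρ / α
        + |f ρ| ^ α * f ρ) := by linarith
  have e4 : n = ρ * s := by rw [hρ]; field_simp
  rw [e3, e4]
  have hρ0 : ρ ≠ 0 := hr.ne'
  field_simp
  ring


lemma mul_supp_continuous {N : ℕ} {V h : ℝ × Euc N → ℝ} {O : Set (ℝ × Euc N)} (hO : IsOpen O)
    (hV : ContinuousOn V O) (hh : Continuous h) (hs : tsupport h ⊆ O) :
    Continuous (fun p => V p * h p) := by
  refine continuous_of_tsupport fun p hp => ?_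
  have : p ∈ tsupport h := closure_mono (Function.support_mul_subset_right V h) hp
  exact (hV.continuousAt (hO.mem_nhds (hs this))).mul hh.continuousAt

lemma mul_supp_integrable {N : ℕ} {V h : ℝ × Euc N → ℝ} {O : Set (ℝ × Euc N)} (hO : IsOpen O)
    (hV : ContinuousOn V O) (hh : Continuous h) (hc : HasCompactSupport h) (hs : tsupport h ⊆ O) :
    Integrable (fun p => V p * h p) :=
  (mul_supp_continuous hO hV hh hs).integrable_of_hasCompactSupport hc.mul_left

lemma ibp {N : ℕ} {V h : ℝ × Euc N → ℝ} {O : Set (ℝ × Euc N)} (hO : IsOpen O)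
    (hV : ContDiffOn ℝ 1 V O) (hh : ContDiff ℝ 1 h) (hc : HasCompactSupport h)
    (hs : tsupport h ⊆ O) (v : ℝ × Euc N) :
    ∫ p, V p * pd v h p = - ∫ p, pd v V p * h p := by
  have hVd : ContinuousOn (pd v V) O :=
    ((hV.fderiv_of_isOpen (m := 0) hO (by norm_num)).clm_apply contDiffOn_const).continuousOn
  refine integral_mul_fderiv_eq_neg_fderiv_mul_of_integrable
    (μ := (volume : Measure (ℝ × Euc N))) (f := V) (g := h) (v := v) ?_ ?_ ?_ ?_ ?_
  · exact mul_supp_integrable hO hVd hh.continuous hc hs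
  · exact mul_supp_integrable hO hV.continuousOn
      (pd_contDiff (m := 0) v hh (by norm_num)).continuous
      (hc.of_isClosed_subset (isClosed_tsupport _) (pd_tsupport v h)) ((pd_tsupport v h).trans hs)
  · exact mul_supp_integrable hO hV.continuousOn hh.continuous hc hs
  · exact fun p hp => (hV.differentiableOn (by norm_num)).differentiableAt (hO.mem_nhds (hs hp))
  · exact fun p _ => hh.differentiable (by norm_num) p

lemma weak_off {N : ℕ} {α : ℝ} (hα : 0 < α) {f : ℝ → ℝ} (hf : ContDiffOn ℝ 2 f (Set.Ioi 0))
    (hf1 : ∀ r, 0 < r → HasDerivAt f (deriv f r) r)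
    (hf2 : ∀ r, 0 < r → HasDerivAt (deriv f) (deriv (deriv f) r) r)
    (hfode : ∀ r : ℝ, 0 < r →
      deriv (deriv f) r + (((N : ℝ) - 1) / r + r / 2) * deriv f r + f r / α
        + |f r| ^ α * f r = 0)
    {ξ : ℝ × Euc N → ℝ} (hξ : ContDiff ℝ 2 ξ) (hc : HasCompactSupport ξ) (hs : tsupport ξ ⊆ Omi N) :
    ∫ p, Uf α f p * Lop ξ p = ∫ p, Fnl α (Uf α f p) * ξ p := by
  have hO := isOpen_Omi N
  have hU := Uf_contDiffOn (N := N) (α := α) hf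
  have hU1 : ContDiffOn ℝ 1 (Uf (N := N) α f) (Omi N) := hU.of_le (by norm_num)
  have hUp := fun v => Uf_pd_contDiffOn (N := N) (α := α) hf v
  have hUpp : ∀ v, ContinuousOn (pd v (pd v (Uf (N := N) α f))) (Omi N) := fun v =>
    (((hUp v).fderiv_of_isOpen (m := 0) hO (by norm_num)).clm_apply contDiffOn_const).continuousOn
  have h1 : ∀ v, ContDiff ℝ 1 (pd v ξ) := fun v => pd_contDiff v hξ (by norm_num)
  have h2 : ∀ v, Continuous (pd v (pd v ξ)) := fun v =>
    (pd_contDiff (m := 0) v (h1 v) (by norm_num)).continuous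
  have s1 : ∀ v, tsupport (pd v ξ) ⊆ Omi N := fun v => (pd_tsupport v ξ).trans hs
  have s2 : ∀ v, tsupport (pd v (pd v ξ)) ⊆ Omi N := fun v => (pd_tsupport v _).trans (s1 v)
  have hc1 : ∀ v, HasCompactSupport (pd v ξ) := fun v =>
    hc.of_isClosed_subset (isClosed_tsupport _) (pd_tsupport v ξ)
  have hc2 : ∀ v, HasCompactSupport (pd v (pd v ξ)) := fun v =>
    (hc1 v).of_isClosed_subset (isClosed_tsupport _) (pd_tsupport v _)
  have hξ1 : ContDiff ℝ 1 ξ := hξ.of_le (by norm_num)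
  have e1 : ∀ p, Uf α f p * Lop ξ p = -(Uf α f p * pd (1, 0) ξ p)
      - ∑ i : Fin N, Uf α f p * pd (ee i) (pd (ee i) ξ) p := by
    intro p; rw [Lop_eq hξ, ← Finset.mul_sum]; ring
  simp only [e1]
  have i1 : Integrable (fun p => Uf α f p * pd (1, 0) ξ p) :=
    mul_supp_integrable hO hU.continuousOn (h1 _).continuous (hc1 _) (s1 _)
  have i2 : ∀ i : Fin N, Integrable (fun p => Uf α f p * pd (ee i) (pd (ee i) ξ) p) := fun i =>
    mul_supp_integrable hO hU.continuousOn (h2 _) (hc2 _) (s2 _)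
  have i3 : Integrable (fun p => pd (1, 0) (Uf α f) p * ξ p) :=
    mul_supp_integrable hO (hUp _).continuousOn hξ.continuous hc hs
  have i4 : ∀ i : Fin N, Integrable (fun p => pd (ee i) (pd (ee i) (Uf α f)) p * ξ p) := fun i =>
    mul_supp_integrable hO (hUpp _) hξ.continuous hc hs
  have i1n : Integrable (fun p => -(Uf α f p * pd (1, 0) ξ p)) := i1.neg
  rw [integral_sub i1n (integrable_finsetSum _ fun i _ => i2 i), integral_neg,
    integral_finsetSum _ fun i _ => i2 i]
  rw [ibp hO hU1 hξ1 hc hs]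
  have e2 : ∀ i : Fin N, ∫ p, Uf α f p * pd (ee i) (pd (ee i) ξ) p
      = ∫ p, pd (ee i) (pd (ee i) (Uf α f)) p * ξ p := by
    intro i
    rw [ibp hO hU1 (h1 _) (hc1 _) (s1 _), ibp hO (hUp _) hξ1 hc hs, neg_neg]
  simp only [e2]
  rw [neg_neg, ← integral_finsetSum _ fun i _ => i4 i,
    ← integral_sub i3 (integrable_finsetSum _ fun i _ => i4 i)]
  refine integral_congr_ae (ae_of_all _ fun p => ?_)
  simp only []
  rw [← Finset.sum_mul, ← sub_mul]
  by_cases hp : p ∈ Omi N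
  · rw [Uf_eqn hα hf hf1 hf2 hfode hp]
  · have : ξ p = 0 := image_eq_zero_of_notMem_tsupport fun h => hp (hs h)
    rw [this]; simp

lemma pd_mul {N : ℕ} {a b : ℝ × Euc N → ℝ} (ha : Differentiable ℝ a) (hb : Differentiable ℝ b)
    (v : ℝ × Euc N) : pd v (fun p => a p * b p) = fun p => a p * pd v b p + b p * pd v a p := by
  ext p
  unfold pd
  have : (fun p => a p * b p) = a * b := rfl
  rw [this, fderiv_mul (ha p) (hb p)]
  simp

lemma pd_add {N : ℕ} {a b : ℝ × Euc N → ℝ} (ha : Differentiable ℝ a) (hb : Differentiable ℝ b)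
    (v : ℝ × Euc N) : pd v (fun p => a p + b p) = fun p => pd v a p + pd v b p := by
  ext p
  unfold pd
  have : (fun p => a p + b p) = a + b := rfl
  rw [this, fderiv_add (ha p) (hb p)]
  simp

lemma pd_smul {N : ℕ} (c : ℝ) (b : ℝ × Euc N → ℝ) (v : ℝ × Euc N) :
    pd v (fun p => b (c • p)) = fun p => c * pd v b (c • p) := by
  ext p
  unfold pd
  rw [fderiv_comp_smul]
  simp

lemma pd_const_mul {N : ℕ} (c : ℝ) {b : ℝ × Euc N → ℝ} (hb : Differentiable ℝ b) (v : ℝ × Euc N) :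
    pd v (fun p => c * b p) = fun p => c * pd v b p := by
  ext p
  unfold pd
  rw [fderiv_const_mul (hb p)]
  simp

lemma pd_snd {N : ℕ} {b : Euc N → ℝ} (hb : Differentiable ℝ b) (v : ℝ × Euc N) :
    pd v (fun p => b p.2) = fun p => fderiv ℝ b p.2 v.2 := by
  ext p
  unfold pd
  have h : HasFDerivAt (fun p : ℝ × Euc N => b p.2)
      ((fderiv ℝ b p.2).comp (ContinuousLinearMap.snd ℝ ℝ (Euc N))) p :=
    HasFDerivAt.comp (g := b) p (hb p.2).hasFDerivAt hasFDerivAt_snd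
  rw [h.fderiv]
  simp

lemma Lop_mul {N : ℕ} {a b : ℝ × Euc N → ℝ} (ha : ContDiff ℝ 2 a) (hb : ContDiff ℝ 2 b)
    (p : ℝ × Euc N) :
    Lop (fun p => a p * b p) p = b p * Lop a p - a p * pd (1, 0) b p
      - ∑ i : Fin N, (a p * pd (ee i) (pd (ee i) b) p + 2 * (pd (ee i) a p * pd (ee i) b p)) := by
  have da : Differentiable ℝ a := ha.differentiable (by norm_num)
  have db : Differentiable ℝ b := hb.differentiable (by norm_num)
  have pa : ∀ v, Differentiable ℝ (pd v a) := fun v =>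
    (pd_contDiff (m := 1) v ha (by norm_num)).differentiable (by norm_num)
  have pb : ∀ v, Differentiable ℝ (pd v b) := fun v =>
    (pd_contDiff (m := 1) v hb (by norm_num)).differentiable (by norm_num)
  rw [Lop_eq (ha.mul hb), Lop_eq ha, pd_mul da db]
  have e : ∀ i : Fin N, pd (ee i) (pd (ee i) (fun p => a p * b p)) p
      = b p * pd (ee i) (pd (ee i) a) p
        + (a p * pd (ee i) (pd (ee i) b) p + 2 * (pd (ee i) a p * pd (ee i) b p)) := by
    intro i
    rw [pd_mul da db, pd_add (a := fun p => a p * pd (ee i) b p)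
      (b := fun p => b p * pd (ee i) a p) (da.mul (pb _)) (db.mul (pa _)), pd_mul da (pb _), pd_mul db (pa _)]
    ring
  simp only [e]
  rw [Finset.sum_add_distrib, ← Finset.mul_sum]
  ring


lemma cutoff (N : ℕ) : ∃ ψ : Euc N → ℝ, ContDiff ℝ 2 ψ ∧ (∀ x, ‖x‖ ≤ 1 → ψ x = 0) ∧
    (∀ x, 2 < ‖x‖ → ψ x = 1) ∧ (∀ x, |ψ x| ≤ 1) ∧
    (∀ x (i : Fin N), 2 < ‖x‖ → fderiv ℝ ψ x (EuclideanSpace.single i (1 : ℝ)) = 0 ∧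
      fderiv ℝ (fun y => fderiv ℝ ψ y (EuclideanSpace.single i (1 : ℝ))) x
        (EuclideanSpace.single i (1 : ℝ)) = 0) ∧
    ∃ K : ℝ, 0 ≤ K ∧ ∀ x (i : Fin N), |fderiv ℝ ψ x (EuclideanSpace.single i (1 : ℝ))| * ‖x‖ ≤ K ∧
      |fderiv ℝ (fun y => fderiv ℝ ψ y (EuclideanSpace.single i (1 : ℝ))) x
        (EuclideanSpace.single i (1 : ℝ))| * ‖x‖ ^ 2 ≤ K := by
  let χ : ContDiffBump (0 : Euc N) := ⟨1, 2, one_pos, one_lt_two⟩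
  have hχ : ContDiff ℝ 2 (χ : Euc N → ℝ) := χ.contDiff
  have hχc : HasCompactSupport (χ : Euc N → ℝ) := χ.hasCompactSupport
  have hts : tsupport (χ : Euc N → ℝ) = Metric.closedBall 0 2 := χ.tsupport_eq
  set e := fun i : Fin N => (EuclideanSpace.single i (1 : ℝ) : Euc N)
  have d1 : ∀ (i : Fin N), (fun y => fderiv ℝ (fun x => 1 - χ x) y (e i))
      = fun y => -(fderiv ℝ χ y (e i)) := by
    intro i; ext y
    rw [fderiv_const_sub]; rfl
  have c1 : ∀ i, ContDiff ℝ 1 (fun y => -(fderiv ℝ χ y (e i))) := fun i =>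
    ((hχ.fderiv_right (m := 1) (by norm_num)).clm_apply contDiff_const).neg
  have t1 : ∀ i, tsupport (fun y => -(fderiv ℝ χ y (e i))) ⊆ Metric.closedBall 0 2 := by
    intro i
    rw [← hts]
    refine Set.Subset.trans ?_ (tsupport_fderiv_subset ℝ (f := (χ : Euc N → ℝ)))
    apply closure_mono
    intro y hy
    simp only [Function.mem_support] at hy ⊢
    intro h; apply hy; rw [h]; simp
  have k1 : ∀ i, HasCompactSupport (fun y => -(fderiv ℝ χ y (e i))) := fun i =>
    (isCompact_closedBall (0 : Euc N) 2).of_isClosed_subset (isClosed_tsupport _) (t1 i)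
  have c2 : ∀ i, Continuous (fun x => fderiv ℝ (fun y => -(fderiv ℝ χ y (e i))) x (e i)) := fun i =>
    ((c1 i).continuous_fderiv (by norm_num)).clm_apply continuous_const
  have k2 : ∀ i, HasCompactSupport (fun x => fderiv ℝ (fun y => -(fderiv ℝ χ y (e i))) x (e i)) :=
    fun i => (k1 i).fderiv_apply ℝ _
  have b1 : ∀ i, ∃ K, ∀ x, ‖-(fderiv ℝ χ x (e i)) * ‖x‖‖ ≤ K := fun i =>
    (k1 i).mul_right.exists_bound_of_continuous ((c1 i).continuous.mul continuous_norm)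
  have b2 : ∀ i, ∃ K, ∀ x, ‖fderiv ℝ (fun y => -(fderiv ℝ χ y (e i))) x (e i) * ‖x‖ ^ 2‖ ≤ K :=
    fun i => (k2 i).mul_right.exists_bound_of_continuous ((c2 i).mul (continuous_norm.pow 2))
  choose K1 hK1 using b1
  choose K2 hK2 using b2
  have n1 : ∀ i, 0 ≤ K1 i := fun i => (norm_nonneg _).trans (hK1 i 0)
  have n2 : ∀ i, 0 ≤ K2 i := fun i => (norm_nonneg _).trans (hK2 i 0)
  refine ⟨fun x => 1 - χ x, contDiff_const.sub hχ, ?_, ?_, ?_, ?_, ∑ i, (K1 i + K2 i), ?_, ?_⟩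
  · intro x hx
    have : χ x = 1 := χ.one_of_mem_closedBall (by simpa using hx)
    simp [this]
  · intro x hx
    have : χ x = 0 := χ.zero_of_le_dist (by simpa using hx.le)
    simp [this]
  · intro x
    have h1 := χ.nonneg (x := x)
    have h2 := χ.le_one (x := x)
    rw [abs_le]; constructor <;> linarith
  · intro x i hx
    have hx' : x ∉ Metric.closedBall (0 : Euc N) 2 := by simpa using hx
    have h1 := congrFun (d1 i) x
    simp only [e] at h1
    constructor
    · rw [h1]
      exact image_eq_zero_of_notMem_tsupport (f := fun y => -(fderiv ℝ χ y (e i))) fun h => hx' (t1 i h)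
    · have h3 := d1 i
      simp only [e] at h3
      rw [h3]
      have h2 : fderiv ℝ (fun y => -(fderiv ℝ χ y (e i))) x = 0 :=
        image_eq_zero_of_notMem_tsupport fun h => hx' (t1 i (tsupport_fderiv_subset ℝ h))
      simp only [e] at h2
      rw [h2]; rfl
  · exact Finset.sum_nonneg fun i _ => add_nonneg (n1 i) (n2 i)
  · intro x i
    have hs : K1 i + K2 i ≤ ∑ i, (K1 i + K2 i) :=
      Finset.single_le_sum (f := fun i => K1 i + K2 i) (fun i _ => add_nonneg (n1 i) (n2 i))
        (Finset.mem_univ i)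
    have h3 := d1 i
    have h1 := hK1 i x
    have h2 := hK2 i x
    rw [Real.norm_eq_abs, abs_mul, abs_of_nonneg (norm_nonneg x)] at h1
    rw [Real.norm_eq_abs, abs_mul, abs_of_nonneg (pow_nonneg (norm_nonneg x) 2)] at h2
    have h4 := congrFun h3 x
    simp only [e] at h1 h2 h3 h4
    rw [h3]
    constructor
    · simp only [h4]; linarith [n2 i]
    · linarith [n1 i]

set_option maxHeartbeats 1000000 in
lemma weak_U {N : ℕ} (hN : 3 ≤ N) {α Kf : ℝ} (hα : 0 < α) {f : ℝ → ℝ}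
    (hf : ContDiffOn ℝ 2 f (Set.Ioi 0))
    (hf1 : ∀ r, 0 < r → HasDerivAt f (deriv f r) r)
    (hf2 : ∀ r, 0 < r → HasDerivAt (deriv f) (deriv (deriv f) r) r)
    (hfode : ∀ r : ℝ, 0 < r →
      deriv (deriv f) r + (((N : ℝ) - 1) / r + r / 2) * deriv f r + f r / α
        + |f r| ^ α * f r = 0)
    (hKf : 0 ≤ Kf) (hU : ∀ p ∈ Omi N, |Uf α f p| ≤ Kf * ‖p.2‖ ^ (-(2 / α)))
    (hpn : 2 / α < (N : ℝ) - 2)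
    {ζ : ℝ × Euc N → ℝ} (hζ : ContDiff ℝ 2 ζ) (hc : HasCompactSupport ζ) (hs : tsupport ζ ⊆ PosT N) :
    Integrable (fun p => Uf α f p * Lop ζ p) ∧ Integrable (fun p => Fnl α (Uf α f p) * ζ p) ∧
    ∫ p, Uf α f p * Lop ζ p = ∫ p, Fnl α (Uf α f p) * ζ p := by
  obtain ⟨ψ, hψ, hψ0, hψ1, hψb, hψz, K, hK0, hK⟩ := cutoff N
  have hdψ : Differentiable ℝ ψ := hψ.differentiable (by norm_num)
  set c : ℕ → ℝ := fun k => (k : ℝ) + 1 with hcdef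
  have hcpos : ∀ k, 0 < c k := fun k => by positivity
  set Ψ : ℕ → ℝ × Euc N → ℝ := fun k p => ψ (c k • p.2) with hΨ
  have hΨc : ∀ k, ContDiff ℝ 2 (Ψ k) := fun k => hψ.comp ((contDiff_const_smul (c k)).comp contDiff_snd)
  have hΨt : ∀ k p, pd (1, 0) (Ψ k) p = 0 := by
    intro k p
    have h := pd_smul (c k) (fun p : ℝ × Euc N => ψ p.2) (1, 0)
    rw [pd_snd hdψ] at h
    have := congrFun h p
    simpa [hΨ] using this
  have hΨi : ∀ k (i : Fin N), pd (ee i) (Ψ k)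
      = fun p => c k * fderiv ℝ ψ (c k • p.2) (EuclideanSpace.single i (1 : ℝ)) := by
    intro k i
    have h := pd_smul (c k) (fun p : ℝ × Euc N => ψ p.2) (ee i)
    rw [pd_snd hdψ] at h
    exact h
  have hdd : ∀ i : Fin N, Differentiable ℝ (fun y => fderiv ℝ ψ y (EuclideanSpace.single i (1 : ℝ))) :=
    fun i => ((hψ.fderiv_right (m := 1) (by norm_num)).clm_apply contDiff_const).differentiable
      (by norm_num)
  have hΨii : ∀ k (i : Fin N), pd (ee i) (pd (ee i) (Ψ k))
      = fun p => c k * (c k * fderiv ℝ (fun y => fderiv ℝ ψ y (EuclideanSpace.single i (1 : ℝ)))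
        (c k • p.2) (EuclideanSpace.single i (1 : ℝ))) := by
    intro k i
    rw [hΨi]
    have hdk : Differentiable ℝ (fun p : ℝ × Euc N =>
        fderiv ℝ ψ (c k • p.2) (EuclideanSpace.single i (1 : ℝ))) :=
      (hdd i).comp (by fun_prop)
    rw [pd_const_mul _ hdk]
    have h := pd_smul (c k) (fun p : ℝ × Euc N =>
      fderiv ℝ ψ p.2 (EuclideanSpace.single i (1 : ℝ))) (ee i)
    rw [pd_snd (hdd i)] at h
    have h' : pd (ee i) (fun p : ℝ × Euc N =>
        fderiv ℝ ψ (c k • p.2) (EuclideanSpace.single i (1 : ℝ))) = _ := h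
    rw [h']
    rfl
  -- bounds
  have nrm : ∀ k (p : ℝ × Euc N), ‖c k • p.2‖ = c k * ‖p.2‖ := fun k p => by
    rw [norm_smul, Real.norm_of_nonneg (hcpos k).le]
  have bi : ∀ k i (p : ℝ × Euc N), p.2 ≠ 0 → |pd (ee i) (Ψ k) p| ≤ K * ‖p.2‖⁻¹ := by
    intro k i p hp
    have h := (hK (c k • p.2) i).1
    rw [nrm] at h
    rw [hΨi]
    simp only [abs_mul, abs_of_pos (hcpos k)]
    rw [← div_eq_mul_inv, le_div_iff₀ (norm_pos_iff.2 hp)]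
    linarith
  have bii : ∀ k i (p : ℝ × Euc N), p.2 ≠ 0 →
      |pd (ee i) (pd (ee i) (Ψ k)) p| ≤ K * (‖p.2‖ ^ 2)⁻¹ := by
    intro k i p hp
    have h := (hK (c k • p.2) i).2
    rw [nrm, mul_pow] at h
    rw [hΨii]
    simp only [abs_mul, abs_of_pos (hcpos k)]
    have := norm_pos_iff.2 hp
    rw [← div_eq_mul_inv, le_div_iff₀ (by positivity)]
    linarith
  obtain ⟨KL, hKL0, hKL⟩ := Lop_bdd hζ hc
  obtain ⟨Kz, hKz⟩ := hc.exists_bound_of_continuous hζ.continuous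
  have hKz0 : 0 ≤ Kz := (norm_nonneg _).trans (hKz 0)
  obtain ⟨Kd, hKd⟩ := (hc.fderiv ℝ).exists_bound_of_continuous (hζ.continuous_fderiv (by norm_num))
  have hKd0 : 0 ≤ Kd := (norm_nonneg _).trans (hKd 0)
  have hpdz : ∀ i p, |pd (ee i) ζ p| ≤ Kd := by
    intro i p
    have := (fderiv ℝ ζ p).le_opNorm (ee i)
    have h1 : ‖(ee i : ℝ × Euc N)‖ = 1 := by simp [ee, Prod.norm_def]
    rw [h1, mul_one] at this
    exact this.trans (hKd p)
  set A : ℝ := KL + N * (Kz * K + 2 * (Kd * K)) with hA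
  have hA0 : 0 ≤ A := by positivity
  have hLb : ∀ k p, p.2 ≠ 0 → |Lop (fun p => ζ p * Ψ k p) p| ≤ A * (1 + (‖p.2‖ ^ 2)⁻¹) := by
    intro k p hp
    have hx := norm_pos_iff.2 hp
    rw [Lop_mul hζ (hΨc k), hΨt, mul_zero, sub_zero]
    have hy0 : 0 ≤ (‖p.2‖ ^ 2)⁻¹ := by positivity
    have hy1 : ‖p.2‖⁻¹ ≤ 1 + (‖p.2‖ ^ 2)⁻¹ := by
      rw [← inv_pow]
      nlinarith [sq_nonneg (‖p.2‖⁻¹ - 1), inv_pos.2 hx]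
    have t1 : |Ψ k p * Lop ζ p| ≤ KL := by
      rw [abs_mul]
      calc _ ≤ 1 * KL := mul_le_mul (hψb _) (hKL p) (abs_nonneg _) zero_le_one
        _ = KL := one_mul _
    have t2 : ∀ i : Fin N, |ζ p * pd (ee i) (pd (ee i) (Ψ k)) p + 2 * (pd (ee i) ζ p * pd (ee i) (Ψ k) p)|
        ≤ (Kz * K + 2 * (Kd * K)) * (1 + (‖p.2‖ ^ 2)⁻¹) := by
      intro i
      refine (abs_add_le _ _).trans ?_
      rw [abs_mul, abs_mul, abs_mul, abs_two]
      have a1 : |ζ p| * |pd (ee i) (pd (ee i) (Ψ k)) p| ≤ Kz * (K * (‖p.2‖ ^ 2)⁻¹) :=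
        mul_le_mul (hKz p) (bii k i p hp) (abs_nonneg _) hKz0
      have a2 : |pd (ee i) ζ p| * |pd (ee i) (Ψ k) p| ≤ Kd * (K * ‖p.2‖⁻¹) :=
        mul_le_mul (hpdz i p) (bi k i p hp) (abs_nonneg _) hKd0
      have a3 : Kd * (K * ‖p.2‖⁻¹) ≤ Kd * (K * (1 + (‖p.2‖ ^ 2)⁻¹)) := by gcongr
      have a4 : Kz * (K * (‖p.2‖ ^ 2)⁻¹) ≤ Kz * (K * (1 + (‖p.2‖ ^ 2)⁻¹)) := by
        gcongr; linarith
      linarith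
    have t3 : |∑ i : Fin N, (ζ p * pd (ee i) (pd (ee i) (Ψ k)) p
        + 2 * (pd (ee i) ζ p * pd (ee i) (Ψ k) p))|
        ≤ N * ((Kz * K + 2 * (Kd * K)) * (1 + (‖p.2‖ ^ 2)⁻¹)) := by
      refine (Finset.abs_sum_le_sum_abs _ _).trans ?_
      refine (Finset.sum_le_sum fun i _ => t2 i).trans ?_
      simp
    refine (abs_sub _ _).trans ?_
    have t4 : KL ≤ KL * (1 + (‖p.2‖ ^ 2)⁻¹) := le_mul_of_one_le_right hKL0 (by linarith)
    rw [hA, add_mul]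
    linarith
  -- support
  obtain ⟨R, hR, hRs⟩ := exists_radius hc
  set D := Set.Ioo (-(R + 1)) (R + 1) ×ˢ Metric.ball (0 : Euc N) (R + 1) with hD
  have hzD : ∀ p, ζ p ≠ 0 → p ∈ D := by
    intro p hp
    have h := hRs p.1 p.2 hp
    have h1 := abs_le.1 h.1
    refine ⟨⟨by linarith, by linarith⟩, ?_⟩
    rw [mem_ball_zero_iff]; linarith [h.2]
  have htD : ∀ p ∈ tsupport ζ, p ∈ Set.Icc (-R) R ×ˢ Metric.closedBall (0 : Euc N) R := by
    have hcl : IsClosed (Set.Icc (-R) R ×ˢ Metric.closedBall (0 : Euc N) R) :=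
      isClosed_Icc.prod Metric.isClosed_closedBall
    refine fun p hp => closure_minimal (fun q hq => ?_) hcl hp
    have h := hRs q.1 q.2 hq
    exact ⟨abs_le.1 h.1, by simpa using h.2⟩
  have htD' : ∀ p ∈ tsupport ζ, p ∈ D := by
    intro p hp
    have h := htD p hp
    have h1 := h.1
    have h2 := mem_closedBall_zero_iff.1 h.2
    refine ⟨⟨by linarith [h1.1], by linarith [h1.2]⟩, ?_⟩
    rw [mem_ball_zero_iff]; linarith
  have hξc : ∀ k, ContDiff ℝ 2 (fun p => ζ p * Ψ k p) := fun k => hζ.mul (hΨc k)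
  have hξs : ∀ k, tsupport (fun p => ζ p * Ψ k p) ⊆ tsupport ζ := fun k =>
    closure_mono (Function.support_mul_subset_left ζ (Ψ k))
  have hξcc : ∀ k, HasCompactSupport (fun p => ζ p * Ψ k p) := fun k => hc.mul_right
  have hξO : ∀ k, tsupport (fun p => ζ p * Ψ k p) ⊆ Omi N := by
    intro k p hp
    refine ⟨(hs (hξs k hp)).1, ?_⟩
    have hcl : IsClosed {p : ℝ × Euc N | 1 ≤ ‖c k • p.2‖} :=
      isClosed_le continuous_const (by fun_prop)
    have : p ∈ {p : ℝ × Euc N | 1 ≤ ‖c k • p.2‖} := by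
      refine closure_minimal (fun q hq => ?_) hcl hp
      by_contra hlt
      have : Ψ k q = 0 := hψ0 _ (not_le.1 hlt).le
      exact hq (by simp [this])
    intro h0
    have h1 : (1:ℝ) ≤ ‖c k • p.2‖ := this
    rw [h0] at h1
    simp at h1
    linarith
  have hoff : ∀ k, ∫ p, Uf α f p * Lop (fun p => ζ p * Ψ k p) p
      = ∫ p, Fnl α (Uf α f p) * (ζ p * Ψ k p) := fun k =>
    weak_off hα hf hf1 hf2 hfode (hξc k) (hξcc k) (hξO k)
  -- measurability
  have hOm : MeasurableSet (Omi N) := (isOpen_Omi N).measurableSet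
  have hVm : AEStronglyMeasurable ((Omi N).indicator (Uf α f)) volume :=
    (aestronglyMeasurable_indicator_iff hOm).2
      ((Uf_contDiffOn hf).continuousOn.aestronglyMeasurable hOm)
  have hFm : AEStronglyMeasurable (fun p => Fnl α ((Omi N).indicator (Uf α f) p)) volume :=
    (Fnl_continuous hα).comp_aestronglyMeasurable hVm
  have gen : ∀ (F : ℝ → ℝ), Continuous F → ∀ g : ℝ × Euc N → ℝ, Continuous g →
      (∀ p, p ∉ tsupport ζ → g p = 0) →
      AEStronglyMeasurable (fun p => F (Uf α f p) * g p) volume := by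
    intro F hF g hg hgz
    have h1 : AEStronglyMeasurable (fun p => F ((Omi N).indicator (Uf α f) p) * g p) volume :=
      (hF.comp_aestronglyMeasurable hVm).mul hg.aestronglyMeasurable
    refine h1.congr ?_
    filter_upwards [ae_snd_ne hN] with p hp
    by_cases h : p ∈ tsupport ζ
    · rw [Set.indicator_of_mem (show p ∈ Omi N from ⟨(hs h).1, hp⟩)]
    · simp [hgz p h]
  have hLz : ∀ k p, p ∉ tsupport ζ → Lop (fun p => ζ p * Ψ k p) p = 0 := fun k p hp =>
    Lop_zero (hξc k) fun h => hp (hξs k h)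
  have s0 : (2:ℝ) / α + 2 < N := by linarith
  have hr : ∀ p : ℝ × Euc N, p.2 ≠ 0 → ‖p.2‖ ^ (-(2 / α)) * (‖p.2‖ ^ 2)⁻¹ = ‖p.2‖ ^ (-(2 / α + 2)) := by
    intro p hp
    have hx := norm_pos_iff.2 hp
    rw [neg_add, Real.rpow_add hx, Real.rpow_neg hx.le 2]
    norm_cast
  -- the dominating functions
  have hDm : MeasurableSet D := measurableSet_Ioo.prod measurableSet_ball
  set b1 : ℝ × Euc N → ℝ := D.indicator
    (fun p => Kf * A * (‖p.2‖ ^ (-(2 / α)) + ‖p.2‖ ^ (-(2 / α + 2)))) with hb1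
  set b2 : ℝ × Euc N → ℝ := D.indicator
    (fun p => Kf ^ (α + 1) * Kz * ‖p.2‖ ^ (-(2 / α + 2))) with hb2
  have ib1 : Integrable b1 := by
    rw [hb1, integrable_indicator_iff hDm]
    exact ((integrableOn_strip (by linarith) hN _ _ _).add
      (integrableOn_strip s0 hN _ _ _)).const_mul _
  have ib2 : Integrable b2 := by
    rw [hb2, integrable_indicator_iff hDm]
    exact (integrableOn_strip s0 hN _ _ _).const_mul _
  have b1n : ∀ p, 0 ≤ b1 p := Set.indicator_nonneg fun p _ => by positivity
  have b2n : ∀ p, 0 ≤ b2 p := Set.indicator_nonneg fun p _ => by positivity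
  have dom1 : ∀ g : ℝ × Euc N → ℝ, (∀ p, p ∉ tsupport ζ → g p = 0) →
      ∀ p, p.2 ≠ 0 → |g p| ≤ A * (1 + (‖p.2‖ ^ 2)⁻¹) → ‖Uf α f p * g p‖ ≤ b1 p := by
    intro g hg p hp hgp
    by_cases h : p ∈ tsupport ζ
    · rw [hb1, Set.indicator_of_mem (htD' p h), norm_mul]
      refine (mul_le_mul (hU p ⟨(hs h).1, hp⟩) hgp (abs_nonneg _) (by positivity)).trans (le_of_eq ?_)
      rw [← hr p hp]; ring
    · rw [hg p h, mul_zero, norm_zero]; exact b1n p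
  have hFU : ∀ p ∈ Omi N, |Fnl α (Uf α f p)| ≤ Kf ^ (α + 1) * ‖p.2‖ ^ (-(2 / α + 2)) := by
    intro p hp
    have hx := norm_pos_iff.2 hp.2
    rw [Fnl_abs hα]
    refine (Real.rpow_le_rpow (abs_nonneg _) (hU p hp) (by linarith)).trans (le_of_eq ?_)
    rw [Real.mul_rpow hKf (by positivity), ← Real.rpow_mul hx.le]
    congr 2
    field_simp
    ring
  have dom2 : ∀ g : ℝ × Euc N → ℝ, (∀ p, p ∉ tsupport ζ → g p = 0) →
      ∀ p, p.2 ≠ 0 → |g p| ≤ Kz → ‖Fnl α (Uf α f p) * g p‖ ≤ b2 p := by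
    intro g hg p hp hgp
    by_cases h : p ∈ tsupport ζ
    · rw [hb2, Set.indicator_of_mem (htD' p h), norm_mul]
      refine (mul_le_mul (hFU p ⟨(hs h).1, hp⟩) hgp (abs_nonneg _) (by positivity)).trans (le_of_eq ?_)
      ring
    · rw [hg p h, mul_zero, norm_zero]; exact b2n p
  have zz : ∀ p, p ∉ tsupport ζ → ζ p = 0 := fun p hp => image_eq_zero_of_notMem_tsupport hp
  have I1 : Integrable (fun p => Uf α f p * Lop ζ p) := by
    refine ib1.mono' (gen id continuous_id _ (Lop_continuous hζ) fun p hp => Lop_zero hζ hp) ?_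
    filter_upwards [ae_snd_ne hN] with p hp
    refine dom1 _ (fun p hp => Lop_zero hζ hp) p hp ((hKL p).trans ?_)
    have h1 : KL ≤ A := by rw [hA]; exact le_add_of_nonneg_right (by positivity)
    have h2 : 0 ≤ (‖p.2‖ ^ 2)⁻¹ := by positivity
    exact h1.trans (le_mul_of_one_le_right hA0 (by linarith))
  have I2 : Integrable (fun p => Fnl α (Uf α f p) * ζ p) := by
    refine ib2.mono' (gen (Fnl α) (Fnl_continuous hα) _ hζ.continuous zz) ?_
    filter_upwards [ae_snd_ne hN] with p hp
    exact dom2 _ zz p hp (hKz p)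
  refine ⟨I1, I2, ?_⟩
  have big : ∀ p : ℝ × Euc N, p.2 ≠ 0 → ∀ᶠ k in atTop, 2 < ‖c k • p.2‖ := by
    intro p hp
    have hx := norm_pos_iff.2 hp
    obtain ⟨n, hn⟩ := exists_nat_gt (2 / ‖p.2‖)
    filter_upwards [eventually_ge_atTop n] with k hk
    rw [nrm]
    have h1 : (n : ℝ) ≤ k := by exact_mod_cast hk
    rw [div_lt_iff₀ hx] at hn
    have h2 : (n : ℝ) * ‖p.2‖ ≤ c k * ‖p.2‖ :=
      mul_le_mul_of_nonneg_right (by simp only [hcdef]; linarith) hx.le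
    linarith
  have L1 : Tendsto (fun k => ∫ p, Uf α f p * Lop (fun p => ζ p * Ψ k p) p) atTop
      (nhds (∫ p, Uf α f p * Lop ζ p)) := by
    refine tendsto_integral_of_dominated_convergence b1 (fun k => gen id continuous_id _
      (Lop_continuous (hξc k)) (hLz k)) ib1 (fun k => ?_) ?_
    · filter_upwards [ae_snd_ne hN] with p hp
      exact dom1 _ (hLz k) p hp (hLb k p hp)
    · filter_upwards [ae_snd_ne hN] with p hp
      refine tendsto_const_nhds.congr' ?_
      filter_upwards [big p hp] with k hk
      rw [Lop_mul hζ (hΨc k), hΨt]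
      have h1 : Ψ k p = 1 := hψ1 _ hk
      have h2 : ∀ i : Fin N, pd (ee i) (Ψ k) p = 0 := fun i => by
        rw [hΨi]; simp only [(hψz _ i hk).1, mul_zero]
      have h3 : ∀ i : Fin N, pd (ee i) (pd (ee i) (Ψ k)) p = 0 := fun i => by
        rw [hΨii]; simp only [(hψz _ i hk).2, mul_zero]
      simp [h1, h2, h3]
  have L2 : Tendsto (fun k => ∫ p, Fnl α (Uf α f p) * (ζ p * Ψ k p)) atTop
      (nhds (∫ p, Fnl α (Uf α f p) * ζ p)) := by
    have hz' : ∀ k p, p ∉ tsupport ζ → ζ p * Ψ k p = 0 := fun k p hp => by rw [zz p hp, zero_mul]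
    refine tendsto_integral_of_dominated_convergence b2 (fun k => gen (Fnl α) (Fnl_continuous hα) _
      (hξc k).continuous (hz' k)) ib2 (fun k => ?_) ?_
    · filter_upwards [ae_snd_ne hN] with p hp
      refine dom2 _ (hz' k) p hp ?_
      rw [abs_mul]
      calc _ ≤ Kz * 1 := mul_le_mul (hKz p) (hψb _) (abs_nonneg _) hKz0
        _ = Kz := mul_one _
    · filter_upwards [ae_snd_ne hN] with p hp
      refine tendsto_const_nhds.congr' ?_
      filter_upwards [big p hp] with k hk
      have h1 : Ψ k p = 1 := hψ1 _ hk
      rw [h1, mul_one]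
  have L1' := L1.congr hoff
  exact tendsto_nhds_unique L1' L2


lemma trans_cont {N : ℕ} {ψ : Euc N → ℝ} (hψ : Integrable ψ) :
    Tendsto (fun h : Euc N => ∫ x, |ψ (x - h) - ψ x|) (nhds 0) (nhds 0) := by
  rw [Metric.tendsto_nhds]
  intro ε hε
  obtain ⟨g, gc, hg, gcont, gi⟩ := hψ.exists_hasCompactSupport_integral_sub_le (ε := ε / 4) (by linarith)
  obtain ⟨M, hM⟩ := gcont.bounded_above_of_compact_support gc
  obtain ⟨R, hR⟩ := gc.isCompact.isBounded.subset_closedBall 0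
  have h0 : Tendsto (fun h : Euc N => ∫ x, |g (x - h) - g x|) (nhds 0)
      (nhds (∫ x : Euc N, (0:ℝ))) := by
    refine tendsto_integral_filter_of_dominated_convergence
      ((Metric.closedBall (0 : Euc N) (R + 1)).indicator (fun _ => 2 * M)) ?_ ?_ ?_ ?_
    · exact Eventually.of_forall fun h => by
        have : Continuous (fun x => |g (x - h) - g x|) := by fun_prop
        exact this.aestronglyMeasurable
    · filter_upwards [Metric.closedBall_mem_nhds (0 : Euc N) one_pos] with h hh
      refine Eventually.of_forall fun x => ?_
      by_cases hx : x ∈ Metric.closedBall (0 : Euc N) (R + 1)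
      · rw [Set.indicator_of_mem hx, Real.norm_eq_abs, abs_abs]
        have a := hM (x - h)
        have b := hM x
        rw [Real.norm_eq_abs] at a b
        exact (abs_sub _ _).trans (by linarith)
      · rw [Set.indicator_of_notMem hx]
        simp only [Metric.mem_closedBall, dist_zero_right, not_le] at hx hh
        have a : g x = 0 := by
          by_contra hne
          have := hR (subset_tsupport _ hne)
          simp only [Metric.mem_closedBall, dist_zero_right] at this
          linarith
        have b : g (x - h) = 0 := by
          by_contra hne
          have := hR (subset_tsupport _ hne)
          simp only [Metric.mem_closedBall, dist_zero_right] at this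
          have := norm_sub_norm_le x h
          linarith
        simp [a, b]
    · exact (integrable_indicator_iff Metric.isClosed_closedBall.measurableSet).2
        (integrableOn_const (isCompact_closedBall _ _).measure_lt_top.ne)
    · refine Eventually.of_forall fun x => ?_
      have : Continuous (fun h => |g (x - h) - g x|) := by fun_prop
      have := this.tendsto 0
      simpa using this
  rw [integral_zero] at h0
  filter_upwards [(Metric.tendsto_nhds.1 h0) (ε / 4) (by linarith)] with h hh
  rw [dist_zero_right, Real.norm_eq_abs, abs_of_nonneg (integral_nonneg fun _ => abs_nonneg _)] at hh ⊢
  have i1 : Integrable (fun x => |ψ (x - h) - g (x - h)|) := ((hψ.sub gi).comp_sub_right h).abs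
  have i2 : Integrable (fun x => |g (x - h) - g x|) := ((gi.comp_sub_right h).sub gi).abs
  have i3 : Integrable (fun x => |ψ x - g x|) := (hψ.sub gi).abs
  have e1 : ∫ x, |ψ (x - h) - g (x - h)| = ∫ x, |ψ x - g x| :=
    integral_sub_right_eq_self (fun x => |ψ x - g x|) h
  have i4 : Integrable (fun x => |ψ (x - h) - ψ x|) := ((hψ.comp_sub_right h).sub hψ).abs
  have i12 : Integrable (fun x => |ψ (x - h) - g (x - h)| + |g (x - h) - g x|) := i1.add i2
  have i13 : Integrable (fun x => |ψ (x - h) - g (x - h)| + |g (x - h) - g x| + |ψ x - g x|) :=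
    i12.add i3
  have key : ∫ x, |ψ (x - h) - ψ x|
      ≤ ∫ x, (|ψ (x - h) - g (x - h)| + |g (x - h) - g x| + |ψ x - g x|) := by
    refine integral_mono i4 i13 fun x => ?_
    have := abs_sub_le (ψ (x - h)) (g (x - h)) (ψ x)
    have := abs_sub_le (g (x - h)) (g x) (ψ x)
    have := abs_sub_comm (g x) (ψ x)
    show |ψ (x - h) - ψ x| ≤ _
    linarith
  rw [integral_add i12 i3, integral_add i1 i2, e1] at key
  simp only [Real.norm_eq_abs] at hg
  linarith

lemma trans_loc {N : ℕ} {φ : Euc N → ℝ} (hφ : Measurable φ) {M : ℝ} (hM : ∀ y, |φ y| ≤ M) (R : ℝ) :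
    Tendsto (fun h : Euc N => ∫ x in Metric.ball 0 R, |φ (x - h) - φ x|) (nhds 0) (nhds 0) := by
  set ψ := (Metric.ball (0 : Euc N) (R + 1)).indicator φ with hψ
  have hψi : Integrable ψ := by
    rw [hψ, integrable_indicator_iff Metric.isOpen_ball.measurableSet]
    exact Measure.integrableOn_of_bounded (M := M) Metric.isBounded_ball.measure_lt_top.ne
      hφ.aestronglyMeasurable (Eventually.of_forall fun x => hM x)
  refine squeeze_zero' (Eventually.of_forall fun h => integral_nonneg fun _ => abs_nonneg _) ?_
    (trans_cont hψi)
  filter_upwards [Metric.ball_mem_nhds (0 : Euc N) one_pos] with h hh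
  have e : ∫ x in Metric.ball 0 R, |φ (x - h) - φ x| = ∫ x in Metric.ball 0 R, |ψ (x - h) - ψ x| := by
    refine setIntegral_congr_fun Metric.isOpen_ball.measurableSet fun x hx => ?_
    have h1 : x ∈ Metric.ball (0 : Euc N) (R + 1) := Metric.ball_subset_ball (by linarith) hx
    have h2 : x - h ∈ Metric.ball (0 : Euc N) (R + 1) := by
      simp only [Metric.mem_ball, dist_zero_right] at hx hh ⊢
      exact (norm_sub_le _ _).trans_lt (by linarith)
    simp only [hψ, Set.indicator_of_mem h1, Set.indicator_of_mem h2]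
  rw [e]
  exact setIntegral_le_integral (((hψi.comp_sub_right h).sub hψi).abs)
    (Eventually.of_forall fun _ => abs_nonneg _)

lemma Hop_scale {N : ℕ} (φ : Euc N → ℝ) {t : ℝ} (ht : 0 < t) (x : Euc N) :
    Hop φ (t, x) = ∫ z, hk (1, z) * φ (x - Real.sqrt t • z) := by
  rw [← hk_scale_integral ht (fun y => φ (x - y))]
  have := integral_sub_left_eq_self (fun y => hk (t, y) * φ (x - y)) volume x
  rw [← this]
  simp [Hop]

lemma Hop_L1 {N : ℕ} {φ : Euc N → ℝ} (hφ : Measurable φ) {M : ℝ} (hM : ∀ y, |φ y| ≤ M) (R : ℝ) :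
    Tendsto (fun t : ℝ => ∫ x in Metric.ball 0 R, |Hop φ (t, x) - φ x|)
      (nhdsWithin 0 (Set.Ioi 0)) (nhds 0) := by
  have hM0 : 0 ≤ M := (abs_nonneg _).trans (hM 0)
  have hfin : volume (Metric.ball (0 : Euc N) R) ≠ ⊤ := Metric.isBounded_ball.measure_lt_top.ne
  have : IsFiniteMeasure (volume.restrict (Metric.ball (0 : Euc N) R)) :=
    ⟨by rw [Measure.restrict_apply_univ]; exact hfin.lt_top⟩
  set J : ℝ → Euc N → ℝ := fun t z => ∫ x in Metric.ball 0 R, |φ (x - Real.sqrt t • z) - φ x| with hJ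
  have hjm : ∀ t : ℝ, Measurable (fun q : Euc N × Euc N => |φ (q.1 - Real.sqrt t • q.2) - φ q.1|) := by
    intro t; fun_prop
  have hjb : ∀ t (x z : Euc N), |φ (x - Real.sqrt t • z) - φ x| ≤ 2 * M := fun t x z =>
    (abs_sub _ _).trans (by linarith [hM (x - Real.sqrt t • z), hM x])
  set V := volume.real (Metric.ball (0 : Euc N) R) with hV
  have hJb : ∀ t z, |J t z| ≤ 2 * M * V := by
    intro t z
    have := norm_setIntegral_le_of_norm_le_const (μ := volume) (s := Metric.ball (0 : Euc N) R)
      (f := fun x => |φ (x - Real.sqrt t • z) - φ x|) (C := 2 * M) hfin.lt_top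
      (fun x _ => by rw [Real.norm_eq_abs, abs_abs]; exact hjb t x z)
    exact this
  have hJm : ∀ t, Measurable (J t) := by
    intro t
    have h := ((hjm t).stronglyMeasurable.integral_prod_left'
      (μ := volume.restrict (Metric.ball (0 : Euc N) R)))
    exact h.measurable
  have lim : Tendsto (fun t : ℝ => ∫ z : Euc N, hk (1, z) * J t z) (nhdsWithin 0 (Set.Ioi 0))
      (nhds (∫ z : Euc N, (0 : ℝ))) := by
    refine tendsto_integral_filter_of_dominated_convergence (fun z => hk (1, z) * (2 * M * V))
      ?_ ?_ (hk1_integrable.mul_const _) ?_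
    · exact Eventually.of_forall fun t =>
        (hk1_continuous.measurable.mul (hJm t)).aestronglyMeasurable
    · refine Eventually.of_forall fun t => Eventually.of_forall fun z => ?_
      rw [Real.norm_eq_abs, abs_mul, abs_of_nonneg (hk_nonneg _)]
      exact mul_le_mul_of_nonneg_left (hJb t z) (hk_nonneg _)
    · refine Eventually.of_forall fun z => ?_
      have h1 : Tendsto (fun t : ℝ => Real.sqrt t • z) (nhdsWithin 0 (Set.Ioi 0)) (nhds 0) := by
        have : Continuous (fun t : ℝ => Real.sqrt t • z) := by fun_prop
        have := (this.tendsto 0).mono_left (nhdsWithin_le_nhds (s := Set.Ioi 0))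
        simpa using this
      have h2 := ((trans_loc hφ hM R).comp h1).const_mul (hk (1, z))
      rw [mul_zero] at h2
      exact h2
  rw [integral_zero] at lim
  refine squeeze_zero' (Eventually.of_forall fun h => integral_nonneg fun _ => abs_nonneg _) ?_ lim
  filter_upwards [self_mem_nhdsWithin] with t ht
  have ht : 0 < t := ht
  have hpi : Integrable (fun q : Euc N × Euc N =>
      hk (1, q.2) * |φ (q.1 - Real.sqrt t • q.2) - φ q.1|)
      ((volume.restrict (Metric.ball (0 : Euc N) R)).prod volume) := by
    have h1 : Integrable (fun q : Euc N × Euc N => (2 * M) * hk (1, q.2))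
      ((volume.restrict (Metric.ball (0 : Euc N) R)).prod volume) :=
      (integrable_const (2 * M)).mul_prod hk1_integrable
    refine h1.mono' ((hk1_continuous.measurable.comp measurable_snd).mul (hjm t)).aestronglyMeasurable
      (Eventually.of_forall fun q => ?_)
    rw [Real.norm_eq_abs, abs_mul, abs_of_nonneg (hk_nonneg _), abs_abs, mul_comm]
    exact mul_le_mul_of_nonneg_right (hjb t _ _) (hk_nonneg _)
  have e : ∫ z : Euc N, hk (1, z) * J t z = ∫ x in Metric.ball (0 : Euc N) R,
      ∫ z : Euc N, hk (1, z) * |φ (x - Real.sqrt t • z) - φ x| := by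
    rw [integral_integral_swap hpi]
    simp only [hJ, integral_const_mul]
  rw [e]
  refine integral_mono_of_nonneg (Eventually.of_forall fun _ => abs_nonneg _)
    hpi.integral_prod_left (Eventually.of_forall fun x => ?_)
  have i1 : Integrable (fun z : Euc N => hk (1, z) * φ (x - Real.sqrt t • z)) :=
    hk1_integrable.mul_bdd (by
      have : Measurable fun z : Euc N => φ (x - Real.sqrt t • z) := by fun_prop
      exact this.aestronglyMeasurable) (Eventually.of_forall fun z => hM _)
  have i2 : Integrable (fun z : Euc N => hk (1, z) * φ x) := hk1_integrable.mul_const _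
  have e2 : Hop φ (t, x) - φ x = ∫ z : Euc N, (hk (1, z) * φ (x - Real.sqrt t • z) - hk (1, z) * φ x) := by
    rw [integral_sub i1 i2, integral_mul_const, hk1_mass, one_mul, Hop_scale φ ht]
  show |Hop φ (t, x) - φ x| ≤ ∫ z : Euc N, hk (1, z) * |φ (x - Real.sqrt t • z) - φ x|
  rw [e2]
  refine abs_integral_le_integral_abs.trans (le_of_eq ?_)
  congr 1
  ext z
  rw [← mul_sub, abs_mul, abs_of_nonneg (hk_nonneg _)]


lemma integrableOn_ball_rpow {N : ℕ} {s : ℝ} (hsN : s < N) (hN : 3 ≤ N) (R : ℝ) :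
    IntegrableOn (fun y : Euc N => ‖y‖ ^ (-s)) (Metric.ball 0 R) := by
  have : Nonempty (Fin N) := ⟨⟨0, by omega⟩⟩
  refine integrableOn_ball_of_norm_le_rpow (C := 1) (α := s) ?_ ?_ ?_ ?_
  · simp; omega
  · simpa using hsN
  · refine Eventually.of_forall fun y => ?_
    rw [one_mul, Real.norm_of_nonneg (by positivity)]
  · exact Measurable.aestronglyMeasurable (by fun_prop)

lemma ae_ne_zero {N : ℕ} (hN : 3 ≤ N) : ∀ᵐ x : Euc N, x ≠ 0 := by
  have : Nontrivial (Euc N) := by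
    have : Nonempty (Fin N) := ⟨⟨0, by omega⟩⟩
    infer_instance
  exact Measure.ae_ne volume 0

lemma Uf_scale {N : ℕ} {α : ℝ} (f : ℝ → ℝ) {p : ℝ × Euc N} (ht : 0 < p.1) :
    ‖p.2‖ ^ (2 / α) * Uf α f p
      = (‖p.2‖ / Real.sqrt p.1) ^ (2 / α) * f (‖p.2‖ / Real.sqrt p.1) := by
  have h : (Real.sqrt p.1) ^ (2 / α) = p.1 ^ (1 / α) := by
    rw [Real.sqrt_eq_rpow, ← Real.rpow_mul ht.le]
    congr 1
    ring
  rw [Uf, Real.div_rpow (norm_nonneg _) (Real.sqrt_nonneg _), h, Real.rpow_neg ht.le]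
  ring

lemma Uf_eq {N : ℕ} {α : ℝ} (f : ℝ → ℝ) {p : ℝ × Euc N} (ht : 0 < p.1) (hx : p.2 ≠ 0) :
    Uf α f p = ‖p.2‖ ^ (-(2 / α)) *
      ((‖p.2‖ / Real.sqrt p.1) ^ (2 / α) * f (‖p.2‖ / Real.sqrt p.1)) := by
  rw [← Uf_scale f ht, ← mul_assoc, ← Real.rpow_add (norm_pos_iff.2 hx)]
  simp

lemma Uf_abs_le {N : ℕ} {α Kf : ℝ} {f : ℝ → ℝ} (hKf : ∀ r : ℝ, 0 < r → |r ^ (2 / α) * f r| ≤ Kf)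
    {p : ℝ × Euc N} (ht : 0 < p.1) (hx : p.2 ≠ 0) : |Uf α f p| ≤ Kf * ‖p.2‖ ^ (-(2 / α)) := by
  rw [Uf_eq f ht hx, abs_mul, abs_of_nonneg (by positivity : (0:ℝ) ≤ ‖p.2‖ ^ (-(2 / α))), mul_comm]
  exact mul_le_mul_of_nonneg_right
    (hKf _ (div_pos (norm_pos_iff.2 hx) (Real.sqrt_pos.2 ht))) (by positivity)

lemma Uf_L1 {N : ℕ} (hN : 3 ≤ N) {α Kf μ : ℝ} {f : ℝ → ℝ} (hf : ContDiffOn ℝ 2 f (Set.Ioi 0))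
    (hKf : ∀ r : ℝ, 0 < r → |r ^ (2 / α) * f r| ≤ Kf) (hpN : 2 / α < N)
    (hμ : Tendsto (fun r : ℝ => r ^ (2 / α) * f r) atTop (nhds μ)) (R : ℝ) :
    Tendsto (fun t : ℝ => ∫ x in Metric.ball (0 : Euc N) R,
      |Uf α f (t, x) - μ * ‖x‖ ^ (-(2 / α))|) (nhdsWithin 0 (Set.Ioi 0)) (nhds 0) := by
  have key : Tendsto (fun t : ℝ => ∫ x in Metric.ball (0 : Euc N) R,
      |Uf α f (t, x) - μ * ‖x‖ ^ (-(2 / α))|) (nhdsWithin 0 (Set.Ioi 0))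
      (nhds (∫ x in Metric.ball (0 : Euc N) R, (0 : ℝ))) := by
    have hne : ∀ᵐ x ∂(volume.restrict (Metric.ball (0 : Euc N) R)), x ≠ 0 :=
      ae_restrict_of_ae (ae_ne_zero hN)
    refine tendsto_integral_filter_of_dominated_convergence
      (fun x => (Kf + |μ|) * ‖x‖ ^ (-(2 / α))) ?_ ?_ ?_ ?_
    · filter_upwards [self_mem_nhdsWithin] with t ht
      have ht : 0 < t := ht
      have hc : ContinuousOn (fun x : Euc N => Uf α f (t, x)) {x | x ≠ 0} := by
        refine (Uf_contDiffOn hf).continuousOn.comp (by fun_prop) fun x hx => ?_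
        exact ⟨ht, hx⟩
      have hm : AEStronglyMeasurable (fun x : Euc N => Uf α f (t, x)) := by
        have h1 := hc.aestronglyMeasurable (μ := volume) isOpen_ne.measurableSet
        rwa [Measure.restrict_eq_self_of_ae_mem (s := {x : Euc N | x ≠ 0}) (ae_ne_zero hN)] at h1
      have h2 : Measurable (fun x : Euc N => μ * ‖x‖ ^ (-(2 / α))) := by fun_prop
      exact (hm.sub h2.aestronglyMeasurable).norm.restrict
    · filter_upwards [self_mem_nhdsWithin] with t ht
      have ht : 0 < t := ht
      filter_upwards [hne] with x hx
      rw [Real.norm_eq_abs, abs_abs]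
      refine (abs_sub _ _).trans ?_
      rw [add_mul, abs_mul μ, abs_of_nonneg (by positivity : (0:ℝ) ≤ ‖x‖ ^ (-(2 / α)))]
      have := Uf_abs_le hKf (p := (t, x)) ht hx
      linarith
    · exact (integrableOn_ball_rpow hpN hN R).const_mul _
    · filter_upwards [hne] with x hx
      have hx0 : 0 < ‖x‖ := norm_pos_iff.2 hx
      have h1 : Tendsto (fun t : ℝ => ‖x‖ / Real.sqrt t) (nhdsWithin 0 (Set.Ioi 0)) atTop := by
        have : Tendsto (fun t : ℝ => Real.sqrt t) (nhdsWithin 0 (Set.Ioi 0))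
            (nhdsWithin 0 (Set.Ioi 0)) := by
          refine tendsto_nhdsWithin_iff.2 ⟨?_, ?_⟩
          · have := (Real.continuous_sqrt.tendsto 0).mono_left (nhdsWithin_le_nhds (s := Set.Ioi 0))
            simpa using this
          · filter_upwards [self_mem_nhdsWithin] with t ht using Real.sqrt_pos.2 ht
        simp only [div_eq_mul_inv]
        exact Tendsto.const_mul_atTop hx0 (tendsto_inv_nhdsGT_zero.comp this)
      have h2 := (((hμ.comp h1).const_mul (‖x‖ ^ (-(2 / α)))).sub_const (μ * ‖x‖ ^ (-(2 / α)))).abs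
      have e : |‖x‖ ^ (-(2 / α)) * μ - μ * ‖x‖ ^ (-(2 / α))| = 0 := by rw [mul_comm, sub_self, abs_zero]
      rw [e] at h2
      refine h2.congr' ?_
      filter_upwards [self_mem_nhdsWithin] with t ht
      rw [Uf_eq f (p := (t, x)) ht hx]
      rfl
  simpa using key

/-- The weak formulation for the perturbed solution. -/
lemma weak_main {N : ℕ} (hN : 3 ≤ N) {α Kf σ C M T : ℝ} (hα : 0 < α) {f : ℝ → ℝ}
    (hf : ContDiffOn ℝ 2 f (Set.Ioi 0))
    (hf1 : ∀ r, 0 < r → HasDerivAt f (deriv f r) r)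
    (hf2 : ∀ r, 0 < r → HasDerivAt (deriv f) (deriv (deriv f) r) r)
    (hfode : ∀ r : ℝ, 0 < r →
      deriv (deriv f) r + (((N : ℝ) - 1) / r + r / 2) * deriv f r + f r / α
        + |f r| ^ α * f r = 0)
    (hKf : 0 ≤ Kf) (hU : ∀ p ∈ Omi N, |Uf α f p| ≤ Kf * ‖p.2‖ ^ (-(2 / α)))
    (hpn : 2 / α < (N : ℝ) - 2) (hσ0 : 0 < σ) (hσ : σ < (N : ℝ) - 2) (hC : 0 ≤ C)
    {φ : Euc N → ℝ} (hφ : Measurable φ) (hM : ∀ y, |φ y| ≤ M)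
    {w : ℝ × Euc N → ℝ} (hw : ContinuousOn w (Om N T))
    (hweq : ∀ p ∈ Om N T, w p = Hop φ p + Dop (gw α T (Uf α f) w) p)
    (hgb : ∀ p ∈ Om N T, |gw α T (Uf α f) w p| ≤ C * (‖p.2‖ ^ (-(σ + 2)) + 1))
    {ζ : ℝ × Euc N → ℝ} (hζ : ContDiff ℝ 2 ζ) (hc : HasCompactSupport ζ)
    (hs : tsupport ζ ⊆ Set.Ioo 0 T ×ˢ (Set.univ : Set (Euc N))) :
    ∫ p in Set.Ioo 0 T ×ˢ (Set.univ : Set (Euc N)), (Uf α f p + w p) * Lop ζ p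
      = ∫ p in Set.Ioo 0 T ×ˢ (Set.univ : Set (Euc N)), Fnl α (Uf α f p + w p) * ζ p := by
  have hs' : tsupport ζ ⊆ PosT N := fun q hq => ⟨(hs hq).1.1, trivial⟩
  have hUc : ContinuousOn (Uf α f) (Om N T) :=
    (Uf_contDiffOn hf).continuousOn.mono fun p hp => ⟨hp.1.1, hp.2⟩
  have hgm : Measurable (gw α T (Uf α f) w) := (gw_measurable hα hUc hw).2
  have hgb' : ∀ p : ℝ × Euc N, p.2 ≠ 0 →
      |gw α T (Uf α f) w p| ≤ C * (‖p.2‖ ^ (-(σ + 2)) + 1) := by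
    intro p hp
    by_cases h : p ∈ Om N T
    · exact hgb p h
    · rw [gw_of_notMem h, abs_zero]; positivity
  obtain ⟨u1, u2, u3⟩ := weak_U hN hα hf hf1 hf2 hfode hKf hU hpn hζ hc hs'
  obtain ⟨d1, d2⟩ := weak_Dop hN hσ0 hσ hC hgm hgb' hζ hc hs'
  obtain ⟨k1, k2⟩ := weak_Hop hφ hM hζ hc hs'
  have hz : ∀ q : ℝ × Euc N, q ∉ Set.Ioo 0 T ×ˢ (Set.univ : Set (Euc N)) → ζ q = 0 ∧ Lop ζ q = 0 :=
    fun q hq => ⟨image_eq_zero_of_notMem_tsupport fun h => hq (hs h), Lop_zero hζ fun h => hq (hs h)⟩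
  have gi : Integrable (fun p => gw α T (Uf α f) w p * ζ p) := by
    obtain ⟨R, hR, hR2⟩ := exists_radius hc
    obtain ⟨K, hK⟩ := hc.exists_bound_of_continuous hζ.continuous
    have hK0 : 0 ≤ K := (norm_nonneg _).trans (hK 0)
    set S := Set.Ioo (-(R + 1)) (R + 1) ×ˢ Metric.ball (0 : Euc N) (R + 1) with hS
    have hSm : MeasurableSet S := measurableSet_Ioo.prod Metric.isOpen_ball.measurableSet
    have i0 : IntegrableOn (fun p : ℝ × Euc N => C * (‖p.2‖ ^ (-(σ + 2)) + 1) * K) S := by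
      have a := integrableOn_strip (N := N) (s := σ + 2) (by linarith) hN (-(R + 1)) (R + 1) (R + 1)
      have b := integrableOn_strip (N := N) (s := 0) (by positivity) hN (-(R + 1)) (R + 1) (R + 1)
      simp only [neg_zero, Real.rpow_zero] at b
      exact ((a.add b).const_mul C).mul_const K
    rw [← integrable_indicator_iff hSm] at i0
    refine i0.mono' (hgm.mul hζ.continuous.measurable).aestronglyMeasurable ?_
    filter_upwards [ae_snd_ne hN] with p hp
    by_cases h0 : ζ p = 0
    · rw [h0, mul_zero, norm_zero]
      exact Set.indicator_nonneg (fun q _ => by positivity) _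
    · have := hR2 p.1 p.2 h0
      have h1 := abs_le.1 this.1
      have hpS : p ∈ S := by
        refine ⟨⟨by linarith, by linarith⟩, ?_⟩
        rw [Metric.mem_ball, dist_zero_right]
        linarith [this.2]
      rw [Set.indicator_of_mem hpS, norm_mul]
      exact mul_le_mul (hgb' p hp) (hK p) (norm_nonneg _) (by positivity)
  have hPos : ∫ p in PosT N, gw α T (Uf α f) w p * ζ p = ∫ p, gw α T (Uf α f) w p * ζ p := by
    refine setIntegral_eq_integral_of_forall_compl_eq_zero fun p hp => ?_
    rw [image_eq_zero_of_notMem_tsupport fun h => hp (hs' h), mul_zero]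
  rw [setIntegral_eq_integral_of_forall_compl_eq_zero fun p hp => by rw [(hz p hp).2, mul_zero],
    setIntegral_eq_integral_of_forall_compl_eq_zero fun p hp => by rw [(hz p hp).1, mul_zero]]
  have kd : Integrable (fun p => Hop φ p * Lop ζ p + Dop (gw α T (Uf α f) w) p * Lop ζ p) := k1.add d1
  have e1 : ∫ p, (Uf α f p + w p) * Lop ζ p
      = ∫ p, (Uf α f p * Lop ζ p + (Hop φ p * Lop ζ p + Dop (gw α T (Uf α f) w) p * Lop ζ p)) := by
    refine integral_congr_ae ?_
    filter_upwards [ae_snd_ne hN] with p hp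
    by_cases h : p ∈ Set.Ioo 0 T ×ˢ (Set.univ : Set (Euc N))
    · rw [hweq p ⟨h.1, hp⟩]; ring
    · rw [(hz p h).2]; ring
  have e2 : ∫ p, Fnl α (Uf α f p + w p) * ζ p
      = ∫ p, (Fnl α (Uf α f p) * ζ p + gw α T (Uf α f) w p * ζ p) := by
    refine integral_congr_ae ?_
    filter_upwards [ae_snd_ne hN] with p hp
    by_cases h : p ∈ Set.Ioo 0 T ×ˢ (Set.univ : Set (Euc N))
    · rw [gw_of_mem ⟨h.1, hp⟩]; ring
    · rw [(hz p h).1]; ring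
  rw [e1, e2, integral_add u1 kd, integral_add k1 d1, integral_add u2 gi, u3, k2, d2, hPos, zero_add]

lemma Lloc {N : ℕ} (hN : 3 ≤ N) {α p η K C T : ℝ} (hα : 0 < α) (hp : p = 2 / α)
    (hpn : p < (N : ℝ) - 2) (hηp : η ≤ p) (hK : 0 ≤ K) (hC : 0 ≤ C)
    {u : ℝ × Euc N → ℝ} (hu : ContinuousOn u (Om N T))
    (hub : ∀ q ∈ Om N T, |u q| ≤ K * ‖q.2‖ ^ (-p) + C * (1 + ‖q.2‖ ^ (-η)))
    {a b R : ℝ} (ha : 0 < a) (hb : b < T) (hR : 0 < R) :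
    IntegrableOn (fun q => |u q| ^ (α + 1)) (Set.Ioo a b ×ˢ Metric.ball 0 R) := by
  set S := Set.Ioo a b ×ˢ Metric.ball (0 : Euc N) R with hS
  have hSm : MeasurableSet S := measurableSet_Ioo.prod Metric.isOpen_ball.measurableSet
  have hp0 : 0 < p := by rw [hp]; positivity
  set K' := K + C * (R ^ p + R ^ (p - η)) with hK'
  have hK'0 : 0 ≤ K' := by positivity
  have hne : ∀ᵐ q ∂(volume.restrict S), q ∈ Om N T ∧ q ∈ S := by
    filter_upwards [ae_restrict_of_ae (ae_snd_ne hN), ae_restrict_mem hSm] with q hq hqS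
    exact ⟨⟨⟨ha.trans hqS.1.1, hqS.1.2.trans hb⟩, hq⟩, hqS⟩
  have i0 := (integrableOn_strip (N := N) (s := p + 2) (by linarith) hN a b R).const_mul (K' ^ (α + 1))
  refine i0.mono' ?_ ?_
  · have h1 := measurable_indicator_of_continuousOn (hu.abs.rpow_const (p := α + 1)
      (fun q _ => Or.inr (by positivity)))
    refine h1.aestronglyMeasurable.congr ?_
    filter_upwards [hne] with q hq
    rw [Set.indicator_of_mem hq.1]
  · filter_upwards [hne] with q hq
    have hx : 0 < ‖q.2‖ := norm_pos_iff.2 hq.1.2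
    have hxR : ‖q.2‖ ≤ R := by
      have := hq.2.2
      rw [Metric.mem_ball, dist_zero_right] at this
      exact this.le
    have b1 : (1:ℝ) ≤ R ^ p * ‖q.2‖ ^ (-p) := by
      rw [Real.rpow_neg hx.le, ← div_eq_mul_inv, one_le_div (by positivity)]
      exact Real.rpow_le_rpow hx.le hxR hp0.le
    have b2 : ‖q.2‖ ^ (-η) ≤ R ^ (p - η) * ‖q.2‖ ^ (-p) := by
      have : ‖q.2‖ ^ (-η) = ‖q.2‖ ^ (p - η) * ‖q.2‖ ^ (-p) := by
        rw [← Real.rpow_add hx]; congr 1; ring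
      rw [this]
      exact mul_le_mul_of_nonneg_right (Real.rpow_le_rpow hx.le hxR (by linarith)) (by positivity)
    have b3 : |u q| ≤ K' * ‖q.2‖ ^ (-p) := by
      refine (hub q hq.1).trans ?_
      have := mul_le_mul_of_nonneg_left (add_le_add b1 b2) hC
      rw [hK']
      linarith
    rw [Real.norm_of_nonneg (by positivity)]
    refine (Real.rpow_le_rpow (abs_nonneg _) b3 (by positivity)).trans (le_of_eq ?_)
    rw [Real.mul_rpow hK'0 (by positivity), ← Real.rpow_mul hx.le]
    congr 2
    rw [hp]
    field_simp
    ring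


lemma Uf_int {N : ℕ} (hN : 3 ≤ N) {α Kf μ : ℝ} {f : ℝ → ℝ} (hf : ContDiffOn ℝ 2 f (Set.Ioi 0))
    (hKf : ∀ r : ℝ, 0 < r → |r ^ (2 / α) * f r| ≤ Kf) (hpN : 2 / α < N) (R : ℝ) {t : ℝ} (ht : 0 < t) :
    IntegrableOn (fun x : Euc N => |Uf α f (t, x) - μ * ‖x‖ ^ (-(2 / α))|) (Metric.ball 0 R) := by
  have hc : ContinuousOn (fun x : Euc N => Uf α f (t, x)) {x | x ≠ 0} := by
    refine (Uf_contDiffOn hf).continuousOn.comp (by fun_prop) fun x hx => ?_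
    exact ⟨ht, hx⟩
  have hm : AEStronglyMeasurable (fun x : Euc N => Uf α f (t, x)) := by
    have h1 := hc.aestronglyMeasurable (μ := volume) isOpen_ne.measurableSet
    rwa [Measure.restrict_eq_self_of_ae_mem (s := {x : Euc N | x ≠ 0}) (ae_ne_zero hN)] at h1
  have h2 : Measurable (fun x : Euc N => μ * ‖x‖ ^ (-(2 / α))) := by fun_prop
  refine ((integrableOn_ball_rpow hpN hN R).const_mul (Kf + |μ|)).mono'
    (hm.sub h2.aestronglyMeasurable).norm.restrict ?_
  filter_upwards [ae_restrict_of_ae (ae_ne_zero hN)] with x hx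
  rw [Real.norm_eq_abs, abs_abs]
  refine (abs_sub _ _).trans ?_
  rw [add_mul, abs_mul μ, abs_of_nonneg (by positivity : (0:ℝ) ≤ ‖x‖ ^ (-(2 / α)))]
  have := Uf_abs_le hKf (p := (t, x)) ht hx
  linarith

lemma data {N : ℕ} {p μ δ : ℝ} (hp : 0 < p) (hδ : 0 < δ)
    (u₀ : Euc N → ℝ) (hu₀loc : LocallyIntegrable u₀)
    (hu₀bdd : ∃ M : ℝ, ∀ᵐ x ∂(volume : Measure (Euc N)), δ < ‖x‖ → |u₀ x| ≤ M)
    (hu₀eq : ∀ᵐ x ∂(volume : Measure (Euc N)), ‖x‖ < δ → u₀ x = μ * ‖x‖ ^ (-p)) :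
    ∃ φ : Euc N → ℝ, ∃ M0 : ℝ, Measurable φ ∧ (∀ y, |φ y| ≤ M0) ∧ (∀ y, ‖y‖ < δ → φ y = 0) ∧
      ∀ᵐ x : Euc N, u₀ x = φ x + μ * ‖x‖ ^ (-p) := by
  obtain ⟨M, hM⟩ := hu₀bdd
  have hae := hu₀loc.aestronglyMeasurable
  set m := hae.mk u₀ with hm
  have hmm : Measurable m := hae.stronglyMeasurable_mk.measurable
  set E := {x : Euc N | δ < ‖x‖} ∩ {x | |m x| ≤ |M|} with hE
  have hEm : MeasurableSet E :=
    (measurableSet_lt measurable_const measurable_norm).inter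
      (measurableSet_le hmm.abs measurable_const)
  refine ⟨E.indicator (fun x => m x - μ * ‖x‖ ^ (-p)), |M| + |μ| * δ ^ (-p), ?_, ?_, ?_, ?_⟩
  · exact Measurable.indicator (by fun_prop) hEm
  · intro y
    by_cases hy : y ∈ E
    · rw [Set.indicator_of_mem hy]
      refine (abs_sub _ _).trans (add_le_add hy.2 ?_)
      rw [abs_mul, abs_of_nonneg (by positivity : (0:ℝ) ≤ ‖y‖ ^ (-p))]
      exact mul_le_mul_of_nonneg_left
        (Real.rpow_le_rpow_of_nonpos hδ (le_of_lt hy.1) (by linarith)) (abs_nonneg _)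
    · rw [Set.indicator_of_notMem hy, abs_zero]; positivity
  · intro y hy
    exact Set.indicator_of_notMem (fun h => absurd h.1 (not_lt.2 hy.le)) _
  · have hsph : ∀ᵐ x : Euc N, ‖x‖ ≠ δ := by
      have h := Measure.addHaar_sphere_of_ne_zero (volume : Measure (Euc N)) 0 hδ.ne'
      have : {x : Euc N | ¬ ‖x‖ ≠ δ} = Metric.sphere 0 δ := by ext x; simp
      rw [ae_iff, this]
      exact h
    filter_upwards [hsph, hM, hu₀eq, hae.ae_eq_mk] with x h1 h2 h3 h4
    rw [← hm] at h4
    rcases lt_or_gt_of_ne h1 with h | h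
    · rw [Set.indicator_of_notMem (fun h' => absurd h'.1 (not_lt.2 h.le)), h3 h, zero_add]
    · have hx : x ∈ E := ⟨h, by
        show |m x| ≤ |M|
        rw [← h4]
        exact (h2 h).trans (le_abs_self _)⟩
      rw [Set.indicator_of_mem hx, ← h4]
      ring

lemma init_L1 {N : ℕ} (hN : 3 ≤ N) {α Kf μ σ C M T : ℝ} {f : ℝ → ℝ} (hf : ContDiffOn ℝ 2 f (Set.Ioi 0))
    (hKf : ∀ r : ℝ, 0 < r → |r ^ (2 / α) * f r| ≤ Kf) (hpN : 2 / α < N) (hσN : σ < N)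
    (hμ : Tendsto (fun r : ℝ => r ^ (2 / α) * f r) atTop (nhds μ)) (hT : 0 < T)
    {φ : Euc N → ℝ} (hφ : Measurable φ) (hM : ∀ y, |φ y| ≤ M) {u₀ : Euc N → ℝ}
    (hu₀ : ∀ᵐ x : Euc N, u₀ x = φ x + μ * ‖x‖ ^ (-(2 / α)))
    {w : ℝ × Euc N → ℝ}
    (hw : ∀ p ∈ Om N T, |w p - Hop φ p| ≤ C * p.1 * (1 + ‖p.2‖ ^ (-σ))) (R : ℝ) :
    Tendsto (fun t : ℝ => ∫ x in Metric.ball (0 : Euc N) R, |Uf α f (t, x) + w (t, x) - u₀ x|)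
      (nhdsWithin 0 (Set.Ioi 0)) (nhds 0) := by
  set A := ∫ x in Metric.ball (0 : Euc N) R, (1 + ‖x‖ ^ (-σ)) with hA
  have hlin : Tendsto (fun t : ℝ => C * t * A) (nhdsWithin 0 (Set.Ioi 0)) (nhds 0) := by
    have : Continuous (fun t : ℝ => C * t * A) := by fun_prop
    have := (this.tendsto 0).mono_left (nhdsWithin_le_nhds (s := Set.Ioi 0))
    simpa using this
  have hlim := ((Uf_L1 hN hf hKf hpN hμ R).add (Hop_L1 hφ hM R)).add hlin
  rw [add_zero, add_zero] at hlim
  refine squeeze_zero' (Eventually.of_forall fun h => integral_nonneg fun _ => abs_nonneg _) ?_ hlim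
  filter_upwards [self_mem_nhdsWithin, nhdsWithin_le_nhds (Iio_mem_nhds hT)] with t ht htT
  have ht : 0 < t := ht
  have htT : t < T := htT
  have hfin : volume (Metric.ball (0 : Euc N) R) ≠ ⊤ := Metric.isBounded_ball.measure_lt_top.ne
  have i1 := Uf_int (μ := μ) hN hf hKf hpN R ht
  have i2 : IntegrableOn (fun x : Euc N => |Hop φ (t, x) - φ x|) (Metric.ball 0 R) := by
    have hm : Measurable (fun x : Euc N => |Hop φ (t, x) - φ x|) :=
      (((Hop_measurable hφ).comp (by fun_prop : Measurable fun x : Euc N => (t, x))).sub hφ).abs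
    refine Measure.integrableOn_of_bounded (M := 2 * M) hfin hm.aestronglyMeasurable
      (Eventually.of_forall fun x => ?_)
    rw [Real.norm_eq_abs, abs_abs]
    exact (abs_sub _ _).trans (by linarith [(Hop_abs_le φ (t, x)).trans (Hop_le hφ.abs (fun y => (abs_abs (φ y)).trans_le (hM y)) ht x), hM x])
  have i3 : IntegrableOn (fun x : Euc N => C * t * (1 + ‖x‖ ^ (-σ))) (Metric.ball 0 R) :=
    ((integrableOn_const hfin).add (integrableOn_ball_rpow hσN hN R)).const_mul _
  have i12 : IntegrableOn (fun x : Euc N => |Uf α f (t, x) - μ * ‖x‖ ^ (-(2 / α))|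
    + |Hop φ (t, x) - φ x|) (Metric.ball 0 R) := i1.add i2
  have e : ∫ x in Metric.ball (0 : Euc N) R, (|Uf α f (t, x) - μ * ‖x‖ ^ (-(2 / α))|
      + |Hop φ (t, x) - φ x| + C * t * (1 + ‖x‖ ^ (-σ)))
      = (∫ x in Metric.ball (0 : Euc N) R, |Uf α f (t, x) - μ * ‖x‖ ^ (-(2 / α))|)
        + (∫ x in Metric.ball (0 : Euc N) R, |Hop φ (t, x) - φ x|) + C * t * A := by
    rw [integral_add i12 i3, integral_add i1 i2, integral_const_mul]
  rw [← e]
  refine integral_mono_of_nonneg (Eventually.of_forall fun _ => abs_nonneg _) (i12.add i3) ?_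
  filter_upwards [ae_restrict_of_ae (ae_ne_zero hN), ae_restrict_of_ae hu₀] with x hx h0
  have h1 := hw (t, x) ⟨⟨ht, htT⟩, hx⟩
  have h2 : Uf α f (t, x) + w (t, x) - u₀ x = (Uf α f (t, x) - μ * ‖x‖ ^ (-(2 / α)))
      + (Hop φ (t, x) - φ x) + (w (t, x) - Hop φ (t, x)) := by rw [h0]; ring
  show |Uf α f (t, x) + w (t, x) - u₀ x| ≤ _
  rw [h2]
  exact (abs_add_three _ _ _).trans (add_le_add le_rfl h1)

lemma sing_lim {N : ℕ} {α B C η ν Kf t : ℝ} (hηp : η < 2 / α) (hp : 0 < 2 / α) (hν : 0 < ν)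
    (ht : 0 < t)
    {U u : Euc N → ℝ} (hU : ∀ x : Euc N, x ≠ 0 → |‖x‖ ^ (2 / α) * U x - B| ≤ Kf * (‖x‖ / √t) ^ ν)
    (hu : ∀ x : Euc N, x ≠ 0 → |u x - U x| ≤ C * (1 + ‖x‖ ^ (-η))) :
    Tendsto (fun x : Euc N => ‖x‖ ^ (2 / α) * u x) (nhdsWithin 0 {x | x ≠ 0}) (nhds B) := by
  have hs : 0 < √t := Real.sqrt_pos.2 ht
  rw [tendsto_iff_dist_tendsto_zero]
  have lim : Tendsto (fun x : Euc N => Kf * (‖x‖ / √t) ^ ν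
      + C * (‖x‖ ^ (2 / α) + ‖x‖ ^ (2 / α - η))) (nhdsWithin 0 {x | x ≠ 0}) (nhds 0) := by
    have c : Continuous (fun x : Euc N => Kf * (‖x‖ / √t) ^ ν
      + C * (‖x‖ ^ (2 / α) + ‖x‖ ^ (2 / α - η))) := by
      have a1 : Continuous (fun x : Euc N => (‖x‖ / √t) ^ ν) :=
        (continuous_norm.div_const _).rpow_const fun x => Or.inr hν.le
      have a2 : Continuous (fun x : Euc N => ‖x‖ ^ (2 / α)) :=
        continuous_norm.rpow_const fun x => Or.inr hp.le
      have a3 : Continuous (fun x : Euc N => ‖x‖ ^ (2 / α - η)) :=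
        continuous_norm.rpow_const fun x => Or.inr (by linarith)
      exact (continuous_const.mul a1).add (continuous_const.mul (a2.add a3))
    have := (c.tendsto 0).mono_left (nhdsWithin_le_nhds (s := {x : Euc N | x ≠ 0}))
    rwa [norm_zero, zero_div, Real.zero_rpow hν.ne', Real.zero_rpow hp.ne',
      Real.zero_rpow (by linarith), mul_zero, add_zero, mul_zero, add_zero] at this
  refine squeeze_zero' (Eventually.of_forall fun h => dist_nonneg) ?_ lim
  filter_upwards [self_mem_nhdsWithin] with x hx
  have hx : x ≠ 0 := hx
  have hx0 : 0 < ‖x‖ := norm_pos_iff.2 hx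
  rw [Real.dist_eq]
  have e : ‖x‖ ^ (2 / α) * u x - B = (‖x‖ ^ (2 / α) * U x - B) + ‖x‖ ^ (2 / α) * (u x - U x) := by ring
  rw [e]
  refine (abs_add_le _ _).trans (add_le_add (hU x hx) ?_)
  rw [abs_mul, abs_of_nonneg (by positivity : (0:ℝ) ≤ ‖x‖ ^ (2 / α))]
  refine (mul_le_mul_of_nonneg_left (hu x hx) (by positivity)).trans (le_of_eq ?_)
  have : ‖x‖ ^ (2 / α - η) = ‖x‖ ^ (2 / α) * ‖x‖ ^ (-η) := by
    rw [← Real.rpow_add hx0]; congr 1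
  rw [this]; ring



theorem stmt_2 (N : ℕ) (hN : 3 ≤ N) (α α₀ β η : ℝ)
    (hα₀ : α₀ = 4 / ((N : ℝ) - 4 + 2 * Real.sqrt ((N : ℝ) - 1)))
    (hα1 : 2 / ((N : ℝ) - 2) < α) (hα2 : α < α₀)
    (hβ : β = 2 / α * ((N : ℝ) - 2 - 2 / α))
    (hη : η = ((N : ℝ) - 2) / 2 - Real.sqrt (((N : ℝ) - 2) ^ 2 / 4 - β * (α + 1)))
    -- f : the self-similar profile
    (f : ℝ → ℝ) (hfC2 : ContDiffOn ℝ 2 f (Set.Ioi 0))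
    (hfode : ∀ r : ℝ, 0 < r →
      deriv (deriv f) r + (((N : ℝ) - 1) / r + r / 2) * deriv f r + f r / α
        + |f r| ^ α * f r = 0)
    (hfsing : Tendsto (fun r : ℝ => r ^ (2 / α) * f r)
      (nhdsWithin 0 (Set.Ioi 0)) (nhds (β ^ (1 / α))))
    (μ : ℝ) (hμ : Tendsto (fun r : ℝ => r ^ (2 / α) * f r) atTop (nhds μ))
    (δ : ℝ) (hδ : 0 < δ)
    (u₀ : Euc N → ℝ) (hu₀loc : LocallyIntegrable u₀)
    (hu₀bdd : ∃ M : ℝ, ∀ᵐ x ∂(volume : Measure (Euc N)), δ < ‖x‖ → |u₀ x| ≤ M)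
    (hu₀eq : ∀ᵐ x ∂(volume : Measure (Euc N)), ‖x‖ < δ → u₀ x = μ * ‖x‖ ^ (-(2 / α))) :
    ∃ T : ℝ, 0 < T ∧ ∃ C : ℝ, ∃ u : ℝ → Euc N → ℝ,
      -- u ∈ L^{α+1}_loc((0,T) × ℝ^N)
      (∀ a b R : ℝ, 0 < a → a < b → b < T → 0 < R →
        IntegrableOn (fun p : ℝ × Euc N => |u p.1 p.2| ^ (α + 1))
          (Set.Ioo a b ×ˢ Metric.ball 0 R)) ∧
      -- u continuous on (0,T) × (ℝ^N ∖ {0})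
      ContinuousOn (fun p : ℝ × Euc N => u p.1 p.2)
        (Set.Ioo 0 T ×ˢ {x : Euc N | x ≠ 0}) ∧
      -- (a) distributional equation ∂ₜu = Δu + |u|^α u
      (∀ ζ : ℝ × Euc N → ℝ, ContDiff ℝ (⊤ : ℕ∞) ζ → HasCompactSupport ζ →
        tsupport ζ ⊆ Set.Ioo 0 T ×ˢ (Set.univ : Set (Euc N)) →
        (∫ p in Set.Ioo 0 T ×ˢ (Set.univ : Set (Euc N)),
            u p.1 p.2 *
              (-(deriv (fun s => ζ (s, p.2)) p.1) - lapl (fun y => ζ (p.1, y)) p.2))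
          = ∫ p in Set.Ioo 0 T ×ˢ (Set.univ : Set (Euc N)),
              |u p.1 p.2| ^ α * u p.1 p.2 * ζ p) ∧
      -- (b) u(t) → u₀ in L¹_loc as t → 0
      (∀ R : ℝ, 0 < R →
        Tendsto (fun t => ∫ x in Metric.ball (0 : Euc N) R, |u t x - u₀ x|)
          (nhdsWithin 0 (Set.Ioi 0)) (nhds 0)) ∧
      -- (c) |u(t,x) − U(t,x)| ≤ C (1 + |x|^{-η}), U(t,x) = t^{-1/α} f(|x|/√t)
      (∀ t : ℝ, ∀ x : Euc N, 0 < t → t < T → x ≠ 0 →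
        |u t x - t ^ (-(1 / α)) * f (‖x‖ / Real.sqrt t)| ≤ C * (1 + ‖x‖ ^ (-η))) ∧
      -- (d) |x|^{2/α} u(t,x) → β^{1/α} as x → 0, for every 0 < t < T
      (∀ t : ℝ, 0 < t → t < T →
        Tendsto (fun x : Euc N => ‖x‖ ^ (2 / α) * u t x)
          (nhdsWithin (0 : Euc N) {x : Euc N | x ≠ 0}) (nhds (β ^ (1 / α)))) := by
  obtain ⟨hα, hpn, hpn2, hβ0, hη0, hηn, hηe⟩ := exponents hN hα₀ hα1 hα2 hβ hη
  have hp : 0 < 2 / α := by positivity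
  have hηp : η < 2 / α := by linarith
  obtain ⟨ν0, hν0, r1, hr1, K0, hK0, hrate⟩ :=
    rate (N := N) hα rfl hβ hβ0 hpn2 rfl hfC2 hfode hfsing
  obtain ⟨Kf1, hKf1, hKf⟩ := profile_bdd hfC2.continuousOn hfsing hμ
  have hf1 : ∀ r : ℝ, 0 < r → HasDerivAt f (deriv f r) r := fun r hr =>
    ((hfC2.differentiableOn (by norm_num)).differentiableAt (Ioi_mem_nhds hr)).hasDerivAt
  have hf2 : ∀ r : ℝ, 0 < r → HasDerivAt (deriv f) (deriv (deriv f) r) r := by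
    intro r hr
    have h1 : ContDiffOn ℝ 1 (deriv f) (Set.Ioi 0) :=
      ((contDiffOn_succ_iff_deriv_of_isOpen (n := 1) isOpen_Ioi).1 hfC2).2.2
    exact ((h1.differentiableOn (by norm_num)).differentiableAt (Ioi_mem_nhds hr)).hasDerivAt
  -- choice of the exponent
  obtain ⟨ν, hν, hνν0, hν2, hν3, hν4, hν5⟩ : ∃ ν : ℝ, 0 < ν ∧ ν ≤ ν0 ∧ ν ≤ 2 ∧
      2 * (η + ν / 2) < (N : ℝ) - 2 ∧ η + ν / 2 + ν ≤ 2 / α ∧ ν / 2 < η := by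
    refine ⟨min (min ν0 2) (min (((N : ℝ) - 2 - 2 * η) / 2) (min ((2 / α - η) / 2) η)), ?_⟩
    set m := min (min ν0 2) (min (((N : ℝ) - 2 - 2 * η) / 2) (min ((2 / α - η) / 2) η)) with hm
    have a1 : m ≤ ν0 := (min_le_left _ _).trans (min_le_left _ _)
    have a2 : m ≤ 2 := (min_le_left _ _).trans (min_le_right _ _)
    have a3 : m ≤ ((N : ℝ) - 2 - 2 * η) / 2 := (min_le_right _ _).trans (min_le_left _ _)
    have a4 : m ≤ (2 / α - η) / 2 :=
      (min_le_right _ _).trans ((min_le_right _ _).trans (min_le_left _ _))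
    have a5 : m ≤ η := (min_le_right _ _).trans ((min_le_right _ _).trans (min_le_right _ _))
    have a0 : 0 < m := by
      refine lt_min (lt_min hν0 two_pos) (lt_min (by linarith) (lt_min (by linarith) hη0))
    exact ⟨a0, a1, a2, by linarith, by linarith, by linarith⟩
  obtain ⟨Kg, hKg0, hKg⟩ := rate_global hKf hr1 hK0 hrate hν hνν0
  obtain ⟨φ, M0, hφ, hφM, hφ0, hu₀φ⟩ := data hp hδ u₀ hu₀loc hu₀bdd hu₀eq
  have hU1 : ∀ p : ℝ × Euc N, 0 < p.1 → p.2 ≠ 0 →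
      |Uf α f p| ≤ max Kf1 Kg * ‖p.2‖ ^ (-(2 / α)) := fun p h1 h2 =>
    (Uf_abs_le hKf h1 h2).trans (mul_le_mul_of_nonneg_right (le_max_left _ _) (by positivity))
  have hU2 : ∀ p : ℝ × Euc N, 0 < p.1 → p.2 ≠ 0 →
      |‖p.2‖ ^ (2 / α) * Uf α f p - β ^ (1 / α)| ≤ max Kf1 Kg * (‖p.2‖ / √p.1) ^ ν := by
    intro p h1 h2
    rw [Uf_scale f h1]
    exact (hKg _ (div_pos (norm_pos_iff.2 h2) (Real.sqrt_pos.2 h1))).trans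
      (mul_le_mul_of_nonneg_right (le_max_right _ _) (by positivity))
  have hUc : ∀ T : ℝ, ContinuousOn (Uf α f) (Om N T) := fun T =>
    (Uf_contDiffOn hfC2).continuousOn.mono fun p hp => ⟨hp.1.1, hp.2⟩
  have hKm : 0 ≤ max Kf1 Kg := hKf1.trans (le_max_left _ _)
  have S : Stp N α β η ν (β ^ (1 / α)) (max Kf1 Kg) M0 δ (Uf α f) φ :=
    { hN := hN, hα := hα, hB := by positivity,
      hBβ := by rw [← Real.rpow_mul hβ0.le, one_div, inv_mul_cancel₀ hα.ne', Real.rpow_one],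
      hη0 := hη0, hη := hηe, hν := hν, hν2 := hν2, hσn := hν3, hνp := hν4, hpn := hpn, hνη := hν5,
      hKf := hKm, hδ := hδ, hU1 := hU1, hU2 := hU2, hUc := hUc,
      hφ := hφ, hφM := hφM, hφ0 := hφ0 }
  obtain ⟨T, hT, -, C, hC, w, hwc, hweq, hwb, hDb, hgb⟩ := S.solve
  refine ⟨T, hT, C, fun t x => Uf α f (t, x) + w (t, x), ?_, ?_, ?_, ?_, ?_, ?_⟩
  · intro a b R ha _ hb hR
    refine Lloc (u := fun q => Uf α f q + w q) (T := T) hN hα rfl hpn hηp.le hKm hC ((hUc T).add hwc)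
      (fun q hq => ?_) ha hb hR
    exact (abs_add_le _ _).trans (add_le_add (hU1 q hq.1.1 hq.2) (hwb q hq))
  · exact (hUc T).add hwc
  · intro ζ hζ hc hs
    exact weak_main hN hα hfC2 hf1 hf2 hfode hKm (fun p hp => hU1 p hp.1 hp.2) hpn
      (σ := η + ν / 2) (by linarith) (by linarith) hC hφ hφM hwc hweq hgb
      (hζ.of_le (WithTop.coe_le_coe.2 (le_top : (2 : ℕ∞) ≤ ⊤))) hc hs
  · intro R _
    refine init_L1 (σ := η + ν / 2) (C := C) hN hfC2 hKf (by linarith) (by linarith) hμ hT hφ hφM hu₀φ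
      (fun p hp => ?_) R
    have e : w p - Hop φ p = Dop (gw α T (Uf α f) w) p := by rw [hweq p hp]; ring
    rw [e]
    exact hDb p hp
  · intro t x ht htT hx
    have e : Uf α f (t, x) + w (t, x) - t ^ (-(1 / α)) * f (‖x‖ / Real.sqrt t) = w (t, x) := by
      rw [Uf]; ring
    rw [e]
    exact hwb (t, x) ⟨⟨ht, htT⟩, hx⟩
  · intro t ht htT
    refine sing_lim (C := C) (U := fun x => Uf α f (t, x)) hηp hp hν ht
      (fun x hx => hU2 (t, x) ht hx) (fun x hx => ?_)
    have e : Uf α f (t, x) + w (t, x) - Uf α f (t, x) = w (t, x) := by ring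
    show |Uf α f (t, x) + w (t, x) - Uf α f (t, x)| ≤ _
    rw [e]
    exact hwb (t, x) ⟨⟨ht, htT⟩, hx⟩

end
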